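/- arXiv:1806.02236 — 2 statements merged into one kernel-verified Lean document; each statement's English description precedes it below -/
import Mathlib

section
/- The set of normalized volumes attained by 3-dimensional reflexive canonical subpolytopes of 4Δ₃ is exactly the set of all even integers v with 4 ≤ v ≤ 50, together with 54, 56 and 64. (Equivalently, by the f-vector formula for K3 polytopes, the f-vectors of K3 polytopes are exactly the triples (v, 3v/2, v/2 + 2) with v in this set.) -/
open Set MeasureTheory

noncomputable section

/-- Points of `ℝ³` with integer coordinates. -/
def latticePts : Set (Fin 3 → ℝ) := {x | ∀ i, ∃ n : ℤ, x i = (n : ℝ)}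

/-- The point `(1,1,1)`. -/
def pOne : Fin 3 → ℝ := ![1, 1, 1]

/-- The tetrahedron `4Δ₃ = conv{(0,0,0),(4,0,0),(0,4,0),(0,0,4)}`. -/
def Delta4 : Set (Fin 3 → ℝ) :=
  convexHull ℝ {![0, 0, 0], ![4, 0, 0], ![0, 4, 0], ![0, 0, 4]}

/-- A subpolytope of `4Δ₃`: a lattice polytope `P ⊆ 4Δ₃` with `P = conv(P ∩ ℤ³)`. -/
def IsSubpolytope (P : Set (Fin 3 → ℝ)) : Prop :=
  P ⊆ Delta4 ∧ P = convexHull ℝ (P ∩ latticePts)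

/-- A canonical subpolytope of `4Δ₃`: a subpolytope with `(1,1,1)` in its interior
(this forces it to be `3`-dimensional). -/
def IsCanonicalSub (P : Set (Fin 3 → ℝ)) : Prop :=
  IsSubpolytope P ∧ pOne ∈ interior P

/-- The standard inner product on `ℝⁿ`. -/
def dotp {n : ℕ} (a x : Fin n → ℝ) : ℝ := ∑ i, a i * x i

/-- Equivalence of subsets of `ℝ³` under the group of affine symmetries of `4Δ₃`. -/
def SymEquiv (P Q : Set (Fin 3 → ℝ)) : Prop :=
  ∃ g : (Fin 3 → ℝ) ≃ᵃ[ℝ] (Fin 3 → ℝ), g '' Delta4 = Delta4 ∧ g '' P = Q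

/-- `F` is a facet of `P`: an exposed face of dimension `2`. -/
def IsFacetOf (F P : Set (Fin 3 → ℝ)) : Prop :=
  ∃ (a : Fin 3 → ℝ) (b : ℝ),
    (∀ x ∈ P, b ≤ dotp a x) ∧ F = P ∩ {x | dotp a x = b} ∧
    Module.finrank ℝ (affineSpan ℝ F).direction = 2

/-- `P` (canonical, with interior lattice point `p`) is reflexive: every facet lies on an
integral hyperplane at lattice distance one from `p`. -/
def IsReflexive (P : Set (Fin 3 → ℝ)) (p : Fin 3 → ℝ) : Prop :=
  ∀ F, IsFacetOf F P →
    ∃ (a : Fin 3 → ℤ) (b : ℤ),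
      (∀ x ∈ F, dotp (fun i => (a i : ℝ)) x = (b : ℝ)) ∧
      (∀ x ∈ P, (b : ℝ) ≤ dotp (fun i => (a i : ℝ)) x) ∧
      dotp (fun i => (a i : ℝ)) p = (b : ℝ) + 1

/-! ### Cells of a weighted vector configuration -/

section Fan

variable {ι : Type*}

/-- `x` lies in no subspace spanned by at most two of the vectors `u i`. -/
def Generic (u : ι → Fin 3 → ℝ) (x : Fin 3 → ℝ) : Prop :=
  ∀ J : Finset ι, J.card ≤ 2 → x ∉ Submodule.span ℝ (u '' J)

variable {u : ι → Fin 3 → ℝ}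

lemma exists_dotProduct_eq (f : (Fin 3 → ℝ) →ₗ[ℝ] ℝ) : ∃ d : Fin 3 → ℝ, ∀ v, f v = d ⬝ᵥ v := by
  refine ⟨fun i => f fun j => if i = j then 1 else 0, fun v => ?_⟩
  rw [LinearMap.pi_apply_eq_sum_univ f v, dotProduct]
  simp only [smul_eq_mul, mul_comm]

lemma exists_dotProduct_pos {p : Submodule ℝ (Fin 3 → ℝ)} {x : Fin 3 → ℝ} (hx : x ∉ p) :
    ∃ d : Fin 3 → ℝ, (∀ v ∈ p, d ⬝ᵥ v = 0) ∧ 0 < d ⬝ᵥ x := by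
  obtain ⟨f, hf, hp⟩ := Submodule.exists_le_ker_of_notMem hx
  obtain ⟨d, hd⟩ := exists_dotProduct_eq f
  have h0 : ∀ v ∈ p, d ⬝ᵥ v = 0 := fun v hv => by rw [← hd]; exact hp hv
  rw [hd] at hf
  rcases lt_or_gt_of_ne hf with h | h
  · exact ⟨-d, fun v hv => by simp [h0 v hv], by simpa using h⟩
  · exact ⟨d, h0, h⟩

lemma Generic.neg {x : Fin 3 → ℝ} (hx : Generic u x) : Generic u (-x) := fun J hJ h =>
  hx J hJ (by simpa using h)

lemma Generic.coeff_ne_zero {x : Fin 3 → ℝ} (hx : Generic u x) {T : Finset ι} (hT : T.card = 3)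
    {α : ι → ℝ} (hα : x = ∑ i ∈ T, α i • u i) {i : ι} (hi : i ∈ T) : α i ≠ 0 := by
  classical
  intro h
  refine hx (T.erase i) (by rw [Finset.card_erase_of_mem hi, hT]) ?_
  rw [hα, ← Finset.add_sum_erase _ _ hi, h, zero_smul, zero_add]
  exact Submodule.sum_mem _ fun j hj => Submodule.smul_mem _ _
    (Submodule.subset_span ⟨j, hj, rfl⟩)

lemma mem_span_image_finset {T : Finset ι} {x : Fin 3 → ℝ}
    (h : x ∈ Submodule.span ℝ (u '' T)) : ∃ α : ι → ℝ, x = ∑ i ∈ T, α i • u i := by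
  classical
  obtain ⟨α, hα⟩ := (Submodule.mem_span_image_finset_iff_exists_fun ℝ).1 h
  refine ⟨fun i => if hi : i ∈ T then α ⟨i, hi⟩ else 0, ?_⟩
  rw [← hα, ← Finset.sum_coe_sort T]
  simp

lemma card_filter_erase_subset [DecidableEq ι] {T q : Finset ι} (hT : T.card = 3) (hq : q ⊆ T) :
    (T.filter fun i => T.erase i ⊆ q).card =
      if q.card = 3 then 3 else if q.card = 2 then 1 else 0 := by
  have hle := Finset.card_le_card hq
  split_ifs with h3 h2
  · have : q = T := Finset.eq_of_subset_of_card_le hq (by omega)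
    rw [this, Finset.filter_true_of_mem fun i _ => Finset.erase_subset i T, hT]
  · have hd : (T \ q).card = 1 := by rw [Finset.card_sdiff_of_subset hq]; omega
    rw [← hd]
    obtain ⟨k, hk⟩ := Finset.card_eq_one.1 hd
    congr 1
    ext i
    simp only [Finset.mem_filter, Finset.mem_sdiff]
    refine and_congr_right fun hi => ⟨fun h hiq => ?_, fun h j hj => ?_⟩
    · have : T ⊆ q := fun j hj => by
        by_cases hji : j = i
        · exact hji ▸ hiq
        · exact h (Finset.mem_erase.2 ⟨hji, hj⟩)
      have := Finset.card_le_card this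
      omega
    · by_contra hjq
      have hjk : j ∈ T \ q := Finset.mem_sdiff.2 ⟨Finset.mem_of_mem_erase hj, hjq⟩
      have hik : i ∈ T \ q := Finset.mem_sdiff.2 ⟨hi, h⟩
      rw [hk, Finset.mem_singleton] at hjk hik
      exact Finset.ne_of_mem_erase hj (hjk.trans hik.symm)
  · rw [Finset.card_eq_zero, Finset.filter_eq_empty_iff]
    intro i hi h
    have := Finset.card_le_card h
    rw [Finset.card_erase_of_mem hi] at this
    omega

variable [Fintype ι]

lemma ae_generic (u : ι → Fin 3 → ℝ) : ∀ᵐ x : Fin 3 → ℝ, Generic u x := by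
  classical
  unfold Generic
  rw [ae_all_iff]
  intro J
  rw [ae_all_iff]
  intro hJ
  have h : Submodule.span ℝ (u '' J) ≠ ⊤ := by
    intro h
    have h1 := finrank_span_finset_le_card (R := ℝ) (J.image u)
    have h2 := Finset.card_image_le (s := J) (f := u)
    rw [Set.finrank, Finset.coe_image, h, finrank_top] at h1
    simp at h1
    omega
  exact measure_eq_zero_iff_ae_notMem.1 (Measure.addHaar_submodule volume _ h)

/-- `y` satisfies the linear constraints with normals `u i` and bounds `c i`. -/
def Feasible (u : ι → Fin 3 → ℝ) (c : ι → ℝ) (y : Fin 3 → ℝ) : Prop := ∀ i, y ⬝ᵥ u i ≤ c i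

open Classical in
/-- The constraints that are equalities at `y`. -/
def tightSet (u : ι → Fin 3 → ℝ) (c : ι → ℝ) (y : Fin 3 → ℝ) : Finset ι :=
  Finset.univ.filter fun i => y ⬝ᵥ u i = c i

open Classical in
/-- The triples of constraints that cut out a vertex of the feasible region. -/
def cells (u : ι → Fin 3 → ℝ) (c : ι → ℝ) : Finset (Finset ι) :=
  Finset.univ.filter fun T => T.card = 3 ∧ ∃ y, Feasible u c y ∧ tightSet u c y = T

variable {c : ι → ℝ}

lemma mem_tightSet {y : Fin 3 → ℝ} {i : ι} : i ∈ tightSet u c y ↔ y ⬝ᵥ u i = c i := by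
  simp [tightSet]

lemma mem_cells {T : Finset ι} :
    T ∈ cells u c ↔ T.card = 3 ∧ ∃ y, Feasible u c y ∧ tightSet u c y = T := by
  simp [cells]

lemma isCompact_feasible (hb : Bornology.IsBounded {y | Feasible u c y}) (I : Finset ι) :
    IsCompact {y | Feasible u c y ∧ I ⊆ tightSet u c y} := by
  have hc : ∀ i, Continuous fun y : Fin 3 → ℝ => y ⬝ᵥ u i := fun i => by
    unfold dotProduct; fun_prop
  refine Metric.isCompact_of_isClosed_isBounded ?_ (hb.subset fun y hy => hy.1)
  have : {y | Feasible u c y ∧ I ⊆ tightSet u c y} =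
      (⋂ i, {y | y ⬝ᵥ u i ≤ c i}) ∩ ⋂ i ∈ I, {y | y ⬝ᵥ u i = c i} := by
    ext y
    simp [Feasible, Finset.subset_iff, mem_tightSet]
  rw [this]
  exact (isClosed_iInter fun i => isClosed_le (hc i) continuous_const).inter
    (isClosed_biInter fun i _ => isClosed_eq (hc i) continuous_const)

lemma exists_optimal (hb : Bornology.IsBounded {y | Feasible u c y}) (x : Fin 3 → ℝ)
    (I : Finset ι) (hI : ∃ y, Feasible u c y ∧ I ⊆ tightSet u c y) :
    ∃ y, Feasible u c y ∧ I ⊆ tightSet u c y ∧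
      ∀ d : Fin 3 → ℝ, (∀ i ∈ I, d ⬝ᵥ u i = 0) → (∀ i ∈ tightSet u c y, d ⬝ᵥ u i ≤ 0) →
        d ⬝ᵥ x ≤ 0 := by
  obtain ⟨y, ⟨hy, hyI⟩, hmax⟩ := (isCompact_feasible hb I).exists_isMaxOn hI
    (f := fun y => y ⬝ᵥ x) (by unfold dotProduct; fun_prop)
  refine ⟨y, hy, hyI, fun d hd0 hd => ?_⟩
  have key : ∀ᶠ t : ℝ in nhdsWithin 0 (Ioi 0), ∀ i, (y + t • d) ⬝ᵥ u i ≤ c i := by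
    rw [Filter.eventually_all]
    intro i
    by_cases hi : i ∈ tightSet u c y
    · filter_upwards [self_mem_nhdsWithin] with t ht
      rw [add_dotProduct, smul_dotProduct, mem_tightSet.1 hi, smul_eq_mul]
      have := mul_nonpos_of_nonneg_of_nonpos (le_of_lt ht) (hd i hi)
      linarith
    · have hlt : y ⬝ᵥ u i < c i := lt_of_le_of_ne (hy i) fun h => hi (mem_tightSet.2 h)
      have hcont : Continuous fun t : ℝ => (y + t • d) ⬝ᵥ u i := by
        unfold dotProduct; fun_prop
      have : ∀ᶠ t : ℝ in nhds 0, (y + t • d) ⬝ᵥ u i < c i :=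
        hcont.continuousAt.eventually_lt_const (by simpa using hlt)
      exact (this.filter_mono nhdsWithin_le_nhds).mono fun t ht => ht.le
  obtain ⟨t, ht, ht0⟩ := (key.and self_mem_nhdsWithin).exists
  have h1 : (y + t • d) ⬝ᵥ x ≤ y ⬝ᵥ x := hmax ⟨ht, fun i hi => by
    rw [mem_tightSet, add_dotProduct, smul_dotProduct, hd0 i hi, mem_tightSet.1 (hyI hi)]
    simp⟩
  rw [add_dotProduct, smul_dotProduct, smul_eq_mul] at h1
  have ht0' : (0 : ℝ) < t := ht0
  by_contra! h
  have := mul_pos ht0' h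
  linarith

lemma exists_cell (hb : Bornology.IsBounded {y | Feasible u c y})
    (hind : ∀ y, LinearIndepOn ℝ u (tightSet u c y : Set ι)) {x : Fin 3 → ℝ} (hx : Generic u x)
    (I : Finset ι) (hI : ∃ y, Feasible u c y ∧ I ⊆ tightSet u c y) :
    ∃ T ∈ cells u c, I ⊆ T ∧ ∃ α : ι → ℝ, x = ∑ i ∈ T, α i • u i ∧
      ∀ i ∈ T, i ∉ I → 0 < α i := by
  classical
  obtain ⟨y, hy, hyI, hopt⟩ := exists_optimal hb x I hI
  set J := tightSet u c y with hJ
  have hJ3 : J.card ≤ 3 := by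
    have h := (hind y).linearIndependent.fintype_card_le_finrank
    simpa using h
  have hxs : x ∈ Submodule.span ℝ (u '' J) := by
    by_contra h
    obtain ⟨d, hd, hdx⟩ := exists_dotProduct_pos h
    have hd' : ∀ i ∈ J, d ⬝ᵥ u i = 0 := fun i hi => hd _ (Submodule.subset_span ⟨i, hi, rfl⟩)
    exact hdx.not_ge (hopt d (fun i hi => hd' i (hyI hi)) fun i hi => (hd' i hi).le)
  have hJc : J.card = 3 := by
    by_contra h
    exact hx J (by omega) hxs
  obtain ⟨α, hα⟩ := mem_span_image_finset hxs
  refine ⟨J, mem_cells.2 ⟨hJc, y, hy, rfl⟩, hyI, α, hα, fun k hk hkI => ?_⟩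
  by_contra! hneg
  have hneg' : α k < 0 := lt_of_le_of_ne hneg (hx.coeff_ne_zero hJc hα hk)
  have hk' := (linearIndepOn_iff_notMem_span.1 (hind y)) k hk
  obtain ⟨d, hd, hdk⟩ := exists_dotProduct_pos hk'
  have hd' : ∀ i ∈ J, i ≠ k → d ⬝ᵥ u i = 0 := fun i hi hik =>
    hd _ (Submodule.subset_span ⟨i, ⟨hi, hik⟩, rfl⟩)
  have h1 : (-d) ⬝ᵥ x ≤ 0 := by
    refine hopt (-d) (fun i hi => ?_) fun i hi => ?_
    · rw [neg_dotProduct, hd' i (hyI hi) fun h => hkI (h ▸ hi), neg_zero]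
    · by_cases hik : i = k
      · rw [hik, neg_dotProduct]; linarith
      · rw [neg_dotProduct, hd' i hi hik, neg_zero]
  have h2 : d ⬝ᵥ x = α k * d ⬝ᵥ u k := by
    rw [hα, dotProduct_sum, Finset.sum_eq_single_of_mem k hk fun i hi hik => by
      rw [dotProduct_smul, hd' i hi hik, smul_zero], dotProduct_smul, smul_eq_mul]
  rw [neg_dotProduct, h2] at h1
  have := mul_neg_of_neg_of_pos hneg' hdk
  linarith

lemma cell_unique {x : Fin 3 → ℝ} {I T T' : Finset ι} (hT : T ∈ cells u c) (hT' : T' ∈ cells u c)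
    (hI : I ⊆ T) (hI' : I ⊆ T') {α β : ι → ℝ} (hα : x = ∑ i ∈ T, α i • u i)
    (hβ : x = ∑ i ∈ T', β i • u i) (hαp : ∀ i ∈ T, i ∉ I → 0 < α i)
    (hβp : ∀ i ∈ T', i ∉ I → 0 < β i) : T = T' := by
  obtain ⟨hc, y, hy, hyT⟩ := mem_cells.1 hT
  obtain ⟨hc', y', hy', hyT'⟩ := mem_cells.1 hT'
  have value : ∀ {S : Finset ι} {γ : ι → ℝ} {z : Fin 3 → ℝ}, x = ∑ i ∈ S, γ i • u i →
      z ⬝ᵥ x = ∑ i ∈ S, γ i * z ⬝ᵥ u i := fun h => by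
    rw [h, dotProduct_sum]; simp [dotProduct_smul]
  have term : ∀ {S S' : Finset ι} {γ : ι → ℝ} {z : Fin 3 → ℝ}, I ⊆ S' → tightSet u c z = S' →
      Feasible u c z → (∀ i ∈ S, i ∉ I → 0 < γ i) → ∀ i ∈ S, γ i * z ⬝ᵥ u i ≤ γ i * c i := by
    intro S S' γ z hS' hz hzf hγ i hi
    by_cases hiI : i ∈ I
    · have : i ∈ tightSet u c z := hz ▸ hS' hiI
      rw [mem_tightSet.1 this]
    · exact mul_le_mul_of_nonneg_left (hzf i) (hγ i hi hiI).le
  have own : ∀ {S : Finset ι} {γ : ι → ℝ} {z : Fin 3 → ℝ}, tightSet u c z = S →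
      ∑ i ∈ S, γ i * z ⬝ᵥ u i = ∑ i ∈ S, γ i * c i := fun h =>
    Finset.sum_congr rfl fun i hi => by rw [mem_tightSet.1 (h ▸ hi)]
  have h1 : y' ⬝ᵥ x ≤ y ⬝ᵥ x := by
    rw [value hα, value hα, own hyT]
    exact Finset.sum_le_sum (term hI' hyT' hy' hαp)
  have h2 : y ⬝ᵥ x ≤ y' ⬝ᵥ x := by
    rw [value hβ, value hβ, own hyT']
    exact Finset.sum_le_sum (term hI hyT hy hβp)
  have h3 : ∀ i ∈ T, α i * y' ⬝ᵥ u i = α i * c i := by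
    refine (Finset.sum_eq_sum_iff_of_le (term hI' hyT' hy' hαp)).1 ?_
    rw [← value hα, ← own hyT, ← value hα]
    exact le_antisymm h1 h2
  refine Finset.eq_of_subset_of_card_le (fun i hi => ?_) (by rw [hc, hc'])
  by_cases hiI : i ∈ I
  · exact hI' hiI
  · rw [← hyT', mem_tightSet]
    exact mul_left_cancel₀ (hαp i hi hiI).ne' (h3 i hi)

lemma exists_coeff (hind : ∀ y, LinearIndepOn ℝ u (tightSet u c y : Set ι)) {T : Finset ι}
    (hT : T ∈ cells u c) (x : Fin 3 → ℝ) : ∃ α : ι → ℝ, x = ∑ i ∈ T, α i • u i := by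
  obtain ⟨hc, y, -, rfl⟩ := mem_cells.1 hT
  have h := (hind y).linearIndependent.span_eq_top_of_card_eq_finrank' (by simp [hc])
  refine mem_span_image_finset ?_
  have : u '' (tightSet u c y) = range fun i : (tightSet u c y : Set ι) => u i := by
    rw [image_eq_range]
  rw [this, h]
  trivial

lemma sum_ite_of_existsUnique [DecidableEq ι] {C : Finset (Finset ι)}
    {q : Finset ι → Finset ι} (hC : ∀ T ∈ C, T.card = 3) (hq : ∀ T, q T ⊆ T)
    (h0 : ∃! T, T ∈ C ∧ q T = T) (h1 : ∀ i, ∃! T, T ∈ C ∧ i ∈ T ∧ T.erase i ⊆ q T) :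
    ∑ T ∈ C, (if (q T).card = 3 then 1 else 0) = 1 ∧
      ∑ T ∈ C, (if (q T).card = 3 then 3 else if (q T).card = 2 then 1 else 0) =
        Fintype.card ι := by
  constructor
  · obtain ⟨T, hT, hu⟩ := h0
    rw [Finset.sum_eq_single_of_mem T hT.1 fun S hS hST => if_neg fun h => hST (hu S ⟨hS, ?_⟩),
      if_pos (by rw [hT.2, hC T hT.1])]
    exact Finset.eq_of_subset_of_card_le (hq S) (by rw [h, hC S hS])
  · have hone : ∀ i, (C.filter fun T => i ∈ T ∧ T.erase i ⊆ q T).card = 1 := fun i => by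
      obtain ⟨T, hT, hu⟩ := h1 i
      refine Finset.card_eq_one.2 ⟨T, ?_⟩
      ext S
      rw [Finset.mem_filter, Finset.mem_singleton]
      exact ⟨hu S, fun h => h ▸ hT⟩
    calc _ = ∑ T ∈ C, (Finset.univ.filter fun i => i ∈ T ∧ T.erase i ⊆ q T).card := by
          refine Finset.sum_congr rfl fun T hT => ?_
          rw [← card_filter_erase_subset (hC T hT) (hq T)]
          congr 1
          ext i
          simp
      _ = ∑ i, (C.filter fun T => i ∈ T ∧ T.erase i ⊆ q T).card := by
          simp only [Finset.card_filter]
          exact Finset.sum_comm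
      _ = Fintype.card ι := by simp [hone]

/-- A complete fan cut out by generic weights, in which every vector is used, has `2 n - 4`
maximal cones, where `n ≥ 4` is the number of vectors. -/
theorem card_cells_add_four (hb : Bornology.IsBounded {y | Feasible u c y})
    (hind : ∀ y, LinearIndepOn ℝ u (tightSet u c y : Set ι)) (hne : ∃ y, Feasible u c y)
    (huse : ∀ i, ∃ y, Feasible u c y ∧ i ∈ tightSet u c y) :
    (cells u c).card + 4 = 2 * Fintype.card ι ∧ 4 ≤ Fintype.card ι := by
  classical
  obtain ⟨x, hx⟩ := (ae_generic u).exists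
  choose! α hα using fun T (hT : T ∈ cells u c) => exists_coeff hind hT x
  have hC : ∀ T ∈ cells u c, T.card = 3 := fun T hT => (mem_cells.1 hT).1
  -- the coefficients of `s • x` for a sign `s` have the expected uniqueness properties
  have key : ∀ s : ℝ, s = 1 ∨ s = -1 →
      (∃! T, T ∈ cells u c ∧ (T.filter fun i => 0 < s * α T i) = T) ∧
      ∀ i, ∃! T, T ∈ cells u c ∧ i ∈ T ∧ T.erase i ⊆ T.filter fun i => 0 < s * α T i := by
    intro s hs
    have hxs : Generic u (s • x) := by
      rcases hs with rfl | rfl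
      · simpa using hx
      · simpa using hx.neg
    have hαs : ∀ T ∈ cells u c, s • x = ∑ i ∈ T, (s * α T i) • u i := fun T hT => by
      conv_lhs => rw [hα T hT, Finset.smul_sum]
      simp only [smul_smul]
    have main : ∀ I : Finset ι, (∃ y, Feasible u c y ∧ I ⊆ tightSet u c y) →
        ∃! T, T ∈ cells u c ∧ I ⊆ T ∧ ∀ i ∈ T, i ∉ I → 0 < s * α T i := by
      intro I hI
      obtain ⟨T, hT, hIT, β, hβ, hpos⟩ := exists_cell hb hind hxs I hI
      have hβα : ∀ i ∈ T, β i = s * α T i := by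
        obtain ⟨-, y, -, hy⟩ := mem_cells.1 hT
        have hl := linearIndepOn_finset_iff.1 (hind y) (fun i => β i - s * α T i) (by
          simp only [hy, sub_smul, Finset.sum_sub_distrib]
          rw [← hβ, ← hαs T hT, sub_self])
        exact fun i hi => sub_eq_zero.1 (hl i (hy ▸ hi))
      refine ⟨T, ⟨hT, hIT, fun i hi hiI => hβα i hi ▸ hpos i hi hiI⟩, ?_⟩
      rintro S ⟨hS, hIS, hSpos⟩
      exact cell_unique hS hT hIS hIT (hαs S hS) hβ hSpos hpos
    constructor
    · obtain ⟨T, ⟨hT, -, hp⟩, hu⟩ := main ∅ (by simpa using hne)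
      refine ⟨T, ⟨hT, Finset.filter_true_of_mem fun i hi => hp i hi (by simp)⟩, ?_⟩
      rintro S ⟨hS, hSp⟩
      exact hu S ⟨hS, by simp, fun i hi _ => Finset.filter_eq_self.1 hSp i hi⟩
    · intro i
      obtain ⟨T, ⟨hT, hiT, hp⟩, hu⟩ := main {i} (by simpa using huse i)
      refine ⟨T, ⟨hT, by simpa using hiT, fun j hj => ?_⟩, ?_⟩
      · rw [Finset.mem_erase] at hj
        exact Finset.mem_filter.2 ⟨hj.2, hp j hj.2 (by simpa using hj.1)⟩
      · rintro S ⟨hS, hiS, hSp⟩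
        refine hu S ⟨hS, by simpa using hiS, fun j hj hji => ?_⟩
        exact (Finset.mem_filter.1 (hSp (Finset.mem_erase.2 ⟨by simpa using hji, hj⟩))).2
  obtain ⟨hp0, hp1⟩ := key 1 (Or.inl rfl)
  obtain ⟨hn0, hn1⟩ := key (-1) (Or.inr rfl)
  obtain ⟨p3, psum⟩ := sum_ite_of_existsUnique hC
    (fun T => Finset.filter_subset (fun i => 0 < 1 * α T i) T) hp0 hp1
  obtain ⟨n3, nsum⟩ := sum_ite_of_existsUnique hC
    (fun T => Finset.filter_subset (fun i => 0 < -1 * α T i) T) hn0 hn1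
  have hcompl : ∀ T ∈ cells u c, (T.filter fun i => 0 < 1 * α T i).card +
      (T.filter fun i => 0 < -1 * α T i).card = 3 := fun T hT => by
    rw [← hC T hT, ← Finset.card_filter_add_card_filter_not (s := T) fun i => 0 < 1 * α T i]
    congr 2
    refine Finset.filter_congr fun i hi => ?_
    have := hx.coeff_ne_zero (hC T hT) (hα T hT) hi
    rw [not_lt, one_mul, neg_one_mul, neg_pos]
    exact ⟨le_of_lt, fun h => lt_of_le_of_ne h this⟩
  constructor
  · have h := Finset.sum_congr (rfl : cells u c = cells u c) fun T hT =>
      show ((if (T.filter fun i => 0 < 1 * α T i).card = 3 then 3 else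
          if (T.filter fun i => 0 < 1 * α T i).card = 2 then 1 else 0) +
        (if (T.filter fun i => 0 < -1 * α T i).card = 3 then 3 else
          if (T.filter fun i => 0 < -1 * α T i).card = 2 then 1 else 0) : ℕ) =
        1 + 2 * (if (T.filter fun i => 0 < 1 * α T i).card = 3 then 1 else 0) +
          2 * (if (T.filter fun i => 0 < -1 * α T i).card = 3 then 1 else 0) by
        have := hcompl T hT
        split_ifs <;> omega
    simp only [Finset.sum_add_distrib, ← Finset.mul_sum] at h
    rw [psum, nsum, p3, n3, Finset.sum_const, smul_eq_mul, mul_one] at h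
    omega
  · obtain ⟨T, ⟨hT, hTp⟩, -⟩ := hp0
    obtain ⟨S, ⟨hS, hSn⟩, -⟩ := hn0
    have hne : ¬ S ⊆ T := by
      intro h
      have hST : S = T := Finset.eq_of_subset_of_card_le h (by rw [hC T hT, hC S hS])
      subst hST
      have := hcompl S hS
      rw [hTp, hSn, hC S hS] at this
      omega
    obtain ⟨i, hi, hiT⟩ := Finset.not_subset.1 hne
    have h := Finset.card_le_univ (insert i T)
    rwa [Finset.card_insert_of_notMem hiT, hC T hT] at h

/-- The standard simplex of `ℝ³`, without its facets through the origin. -/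
def openCorner : Set (Fin 3 → ℝ) := {α | (∀ i, 0 < α i) ∧ ∑ i, α i ≤ 1}

lemma convex_openCorner : Convex ℝ openCorner := by
  rintro x ⟨hx, hx1⟩ y ⟨hy, hy1⟩ a b ha hb hab
  refine ⟨fun i => ?_, ?_⟩
  · simp only [Pi.add_apply, Pi.smul_apply, smul_eq_mul]
    rcases ha.eq_or_lt with rfl | ha
    · rw [zero_add] at hab; simp [hab, hy i]
    · exact add_pos_of_pos_of_nonneg (mul_pos ha (hx i)) (mul_nonneg hb (hy i).le)
  · simp only [Pi.add_apply, Pi.smul_apply, smul_eq_mul, Finset.sum_add_distrib, ← Finset.mul_sum]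
    nlinarith

lemma volume_openCorner : volume openCorner * 6 = 1 := by
  let f : (Fin 3 → ℤˣ) → (Fin 3 → ℝ) →ₗ[ℝ] (Fin 3 → ℝ) := fun s =>
    Matrix.toLin' (Matrix.diagonal fun i => ((s i : ℤ) : ℝ))
  have hf : ∀ s x i, f s x i = ((s i : ℤ) : ℝ) * x i := fun s x i => by
    simp [f, Matrix.mulVec_diagonal]
  have hsq : ∀ e : ℤˣ, ((e : ℤ) : ℝ) * ((e : ℤ) : ℝ) = 1 := fun e => by
    rcases Int.units_eq_one_or e with rfl | rfl <;> simp
  have hvol : ∀ s, volume (f s '' openCorner) = volume openCorner := fun s => by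
    have hdet : |LinearMap.det (f s)| = 1 := by
      rw [LinearMap.det_toLin', Matrix.det_diagonal, Finset.abs_prod]
      refine Finset.prod_eq_one fun i _ => ?_
      rcases Int.units_eq_one_or (s i) with h | h <;> simp [h]
    rw [Measure.addHaar_image_linearMap, hdet, ENNReal.ofReal_one, one_mul]
  have habs : ∀ s, ∀ α ∈ openCorner, ∀ i, |f s α i| = α i := fun s α hα i => by
    rw [hf, abs_mul, abs_of_pos (hα.1 i)]
    rcases Int.units_eq_one_or (s i) with h | h <;> simp [h]
  have hball : volume {x : Fin 3 → ℝ | ∑ i, |x i| ≤ 1} = ENNReal.ofReal (8 / 6) := by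
    have h := volume_sum_rpow_le (Fin 3) (p := 1) le_rfl 1
    simp only [Real.rpow_one, div_one, ENNReal.ofReal_one, one_pow, one_mul,
      Fintype.card_fin] at h
    rw [h, Real.Gamma_add_one one_ne_zero, Real.Gamma_one]
    have h4 : Real.Gamma (((3 : ℕ) : ℝ) + 1) = 6 := by
      rw [Real.Gamma_nat_eq_factorial]; norm_num [Nat.factorial]
    rw [h4]
    norm_num
  have hunion : {x : Fin 3 → ℝ | ∑ i, |x i| ≤ 1} =ᵐ[volume]
      ⋃ s ∈ (Finset.univ : Finset (Fin 3 → ℤˣ)), f s '' openCorner := by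
    have hne : ∀ᵐ x : Fin 3 → ℝ, ∀ i, x i ≠ 0 := by
      rw [ae_all_iff]
      exact fun i => Measure.ae_eval_ne (μ := fun _ => volume) i 0
    filter_upwards [hne] with x hx
    refine propext ⟨fun h => ?_, fun h => ?_⟩
    · have hs : ∀ i, ∃ e : ℤˣ, ((e : ℤ) : ℝ) * x i = |x i| := fun i => by
        rcases lt_or_gt_of_ne (hx i) with h | h
        · exact ⟨-1, by simp [abs_of_neg h]⟩
        · exact ⟨1, by simp [abs_of_pos h]⟩
      choose s hs using hs
      refine mem_biUnion (x := s) (by simp) ⟨fun i => |x i|, ⟨fun i => abs_pos.2 (hx i), h⟩, ?_⟩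
      ext i
      rw [hf, ← hs, ← mul_assoc, hsq, one_mul]
    · obtain ⟨s, -, α, hα, rfl⟩ := mem_iUnion₂.1 h
      show ∑ i, |f s α i| ≤ 1
      simp only [habs s α hα]
      exact hα.2
  rw [measure_congr hunion, measure_biUnion_finset₀] at hball
  · simp only [hvol, Finset.sum_const, Finset.card_univ, nsmul_eq_mul] at hball
    have hcard : Fintype.card (Fin 3 → ℤˣ) = 8 := by simp
    rw [hcard] at hball
    have h8 : (8 : ENNReal) * (volume openCorner * 6) = 8 * 1 := by
      have e6 : (6 : ENNReal) = ENNReal.ofReal 6 := by norm_num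
      have e8 : (8 : ENNReal) = ENNReal.ofReal 8 := by norm_num
      rw [← mul_assoc, ← Nat.cast_ofNat (n := 8), hball, e6, ← ENNReal.ofReal_mul (by norm_num),
        Nat.cast_ofNat, e8, mul_one]
      norm_num
    exact (ENNReal.mul_right_inj (by norm_num) (by norm_num)).1 h8
  · intro s _ t _ hst
    refine Disjoint.aedisjoint (Set.disjoint_left.2 ?_)
    rintro _ ⟨α, hα, rfl⟩ ⟨β, hβ, h⟩
    apply hst
    ext i
    have h1 := congrFun h i
    have h2 : α i = β i := by rw [← habs s α hα i, ← habs t β hβ i, h]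
    rw [hf, hf, h2] at h1
    exact_mod_cast (mul_right_cancel₀ (hβ.1 i).ne' h1).symm
  · exact fun s _ => (convex_openCorner.linear_image (f s)).nullMeasurableSet _

/-- The part of a cell's cone cut off by the triangle spanned by the cell's vectors. -/
def coneCell (u : ι → Fin 3 → ℝ) (T : Finset ι) : Set (Fin 3 → ℝ) :=
  {x | ∃ α : ι → ℝ, (∀ i ∈ T, 0 < α i) ∧ ∑ i ∈ T, α i ≤ 1 ∧ x = ∑ i ∈ T, α i • u i}

omit [Fintype ι] in
lemma coneCell_eq_image [DecidableEq ι] {i j k : ι} (hij : i ≠ j) (hik : i ≠ k) (hjk : j ≠ k) :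
    coneCell u {i, j, k} =
      Matrix.toLin' (Matrix.of ![u i, u j, u k]).transpose '' openCorner := by
  have happ : ∀ β : Fin 3 → ℝ, Matrix.toLin' (Matrix.of ![u i, u j, u k]).transpose β =
      β 0 • u i + (β 1 • u j + β 2 • u k) := fun β => by
    ext l
    simp [Matrix.mulVec, dotProduct, Fin.sum_univ_three]
    ring
  have hsum : ∀ {M : Type} [AddCommMonoid M] (f : ι → M),
      ∑ l ∈ ({i, j, k} : Finset ι), f l = f i + (f j + f k) := fun f => by
    rw [Finset.sum_insert (by simp [hij, hik]), Finset.sum_pair hjk]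
  ext x
  constructor
  · rintro ⟨α, hpos, hle, rfl⟩
    refine ⟨![α i, α j, α k], ⟨fun l => ?_, ?_⟩, ?_⟩
    · fin_cases l <;> simp [hpos]
    · rw [hsum] at hle
      simpa [Fin.sum_univ_three, add_assoc] using hle
    · rw [happ, hsum]
      simp
  · rintro ⟨β, ⟨hpos, hle⟩, rfl⟩
    refine ⟨fun l => if l = i then β 0 else if l = j then β 1 else β 2, fun l hl => ?_, ?_, ?_⟩
    · dsimp only
      split_ifs <;> exact hpos _
    · rw [hsum]
      simpa [hij.symm, hik.symm, hjk.symm, Fin.sum_univ_three, add_assoc] using hle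
    · rw [happ, hsum]
      simp [hij.symm, hik.symm, hjk.symm]

omit [Fintype ι] in
lemma volume_coneCell [DecidableEq ι] {i j k : ι} (hij : i ≠ j) (hik : i ≠ k) (hjk : j ≠ k)
    (hdet : |(Matrix.of ![u i, u j, u k]).det| = 1) :
    volume (coneCell u {i, j, k}) * 6 = 1 := by
  rw [coneCell_eq_image hij hik hjk, Measure.addHaar_image_linearMap, LinearMap.det_toLin',
    Matrix.det_transpose, hdet, ENNReal.ofReal_one, one_mul, volume_openCorner]

omit [Fintype ι] in
lemma convex_coneCell [DecidableEq ι] {T : Finset ι} (hT : T.card = 3) :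
    Convex ℝ (coneCell u T) := by
  obtain ⟨i, j, k, hij, hik, hjk, rfl⟩ := Finset.card_eq_three.1 hT
  rw [coneCell_eq_image hij hik hjk]
  exact convex_openCorner.linear_image _

/-- If every cell spans a unimodular triangle on the boundary of `K`, then six times the volume
of `K` is the number of cells. -/
theorem volume_mul_six_eq_card_cells [DecidableEq ι] {K : Set (Fin 3 → ℝ)}
    (hb : Bornology.IsBounded {y | Feasible u c y})
    (hind : ∀ y, LinearIndepOn ℝ u (tightSet u c y : Set ι)) (hne : ∃ y, Feasible u c y)
    (hK : Convex ℝ K) (h0 : 0 ∈ K) (hu : ∀ i, u i ∈ K)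
    (hface : ∀ T ∈ cells u c, ∃ a : Fin 3 → ℝ, (∀ i ∈ T, a ⬝ᵥ u i = 1) ∧ ∀ x ∈ K, a ⬝ᵥ x ≤ 1)
    (hdet : ∀ i j k, i ≠ j → i ≠ k → j ≠ k → {i, j, k} ∈ cells u c →
      |(Matrix.of ![u i, u j, u k]).det| = 1) :
    volume K * 6 = (cells u c).card := by
  have hC : ∀ T ∈ cells u c, T.card = 3 := fun T hT => (mem_cells.1 hT).1
  have hunion : K =ᵐ[volume] ⋃ T ∈ cells u c, coneCell u T := by
    filter_upwards [ae_generic u] with x hx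
    refine propext ⟨fun h => ?_, fun h => ?_⟩
    · obtain ⟨T, hT, -, α, hα, hpos⟩ := exists_cell hb hind hx ∅ (by simpa using hne)
      obtain ⟨a, ha, haK⟩ := hface T hT
      refine mem_biUnion hT ⟨α, fun i hi => hpos i hi (by simp), ?_, hα⟩
      have h1 := haK x h
      rw [hα, dotProduct_sum] at h1
      refine le_trans (le_of_eq (Finset.sum_congr rfl fun i hi => ?_)) h1
      rw [dotProduct_smul, ha i hi, smul_eq_mul, mul_one]
    · obtain ⟨T, hT, α, hpos, hle, rfl⟩ := mem_iUnion₂.1 h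
      have hs : 0 < ∑ i ∈ T, α i := Finset.sum_pos hpos
        (Finset.card_pos.1 (by rw [hC T hT]; norm_num))
      have hmem := hK.centerMass_mem (t := T) (w := α) (z := u) (fun i hi => (hpos i hi).le) hs
        fun i _ => hu i
      have := hK.smul_mem_of_zero_mem h0 hmem ⟨hs.le, hle⟩
      rwa [Finset.centerMass, smul_smul, mul_inv_cancel₀ hs.ne', one_smul] at this
  have hvol : ∀ T ∈ cells u c, volume (coneCell u T) * 6 = 1 := fun T hT => by
    obtain ⟨i, j, k, hij, hik, hjk, rfl⟩ := Finset.card_eq_three.1 (hC T hT)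
    exact volume_coneCell hij hik hjk (hdet i j k hij hik hjk hT)
  rw [measure_congr hunion, measure_biUnion_finset₀, Finset.sum_mul, Finset.sum_congr rfl hvol]
  · simp
  · intro S hS T hT hST
    refine Disjoint.aedisjoint (Set.disjoint_left.2 ?_)
    rintro _ ⟨α, hα, -, rfl⟩ ⟨β, hβ, -, h⟩
    exact hST (cell_unique hS hT (Finset.empty_subset _) (Finset.empty_subset _) rfl h
      (fun i hi _ => hα i hi) fun i hi _ => hβ i hi)
  · exact fun T hT => (convex_coneCell (hC T hT)).nullMeasurableSet _

end Fan

lemma exists_generic_weights {ι : Type*} [Fintype ι] (u : ι → Fin 3 → ℝ) (lo : ι → ℝ) {δ : ℝ}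
    (hδ : 0 < δ) : ∃ c : ι → ℝ, (∀ i, lo i < c i ∧ c i < lo i + δ) ∧
      ∀ y, LinearIndepOn ℝ u (tightSet u c y : Set ι) := by
  have hdep : ∀ J : Finset ι, ¬ LinearIndepOn ℝ u (J : Set ι) →
      ∃ l : ι → ℝ, ∑ i ∈ J, l i • u i = 0 ∧ ∃ i ∈ J, l i ≠ 0 := fun J hJ => by
    rw [linearIndepOn_finset_iff] at hJ
    push Not at hJ
    exact hJ
  choose! l hl hl0 using hdep
  have hae : ∀ᵐ c : ι → ℝ, ∀ J : Finset ι, ¬ LinearIndepOn ℝ u (J : Set ι) →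
      ∑ i ∈ J, l J i * c i ≠ 0 := by
    classical
    rw [ae_all_iff]
    intro J
    rw [ae_all_iff]
    intro hJ
    let f : (ι → ℝ) →ₗ[ℝ] ℝ := ∑ i ∈ J, l J i • LinearMap.proj i
    have hf : ∀ c, f c = ∑ i ∈ J, l J i * c i := fun c => by simp [f]
    have htop : LinearMap.ker f ≠ ⊤ := by
      intro h
      obtain ⟨i, hi, hne⟩ := hl0 J hJ
      have : f (Pi.single i 1) = 0 := by
        rw [← LinearMap.mem_ker, h]; trivial
      rw [hf, Finset.sum_eq_single_of_mem i hi fun j _ hji => by simp [hji]] at this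
      simp at this
      exact hne this
    refine (measure_eq_zero_iff_ae_notMem.1 (Measure.addHaar_submodule volume _ htop)).mono ?_
    intro c hc h
    exact hc (by rw [SetLike.mem_coe, LinearMap.mem_ker, hf, h])
  have hopen : IsOpen (Set.pi univ fun i => Ioo (lo i) (lo i + δ)) :=
    isOpen_set_pi finite_univ fun i _ => isOpen_Ioo
  obtain ⟨c, hc, hbox⟩ := (Measure.dense_of_ae hae).exists_mem_open hopen
    ⟨fun i => lo i + δ / 2, fun i _ => ⟨by linarith, by linarith⟩⟩
  refine ⟨c, fun i => hbox i (mem_univ i), fun y => ?_⟩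
  by_contra h
  refine hc _ h ?_
  calc ∑ i ∈ tightSet u c y, l (tightSet u c y) i * c i
      = ∑ i ∈ tightSet u c y, y ⬝ᵥ (l (tightSet u c y) i • u i) :=
        Finset.sum_congr rfl fun i hi => by rw [dotProduct_smul, mem_tightSet.1 hi, smul_eq_mul]
    _ = 0 := by rw [← dotProduct_sum, hl _ h, dotProduct_zero]

lemma convex_feasible {ι : Type*} [Fintype ι] (u : ι → Fin 3 → ℝ) (c : ι → ℝ) :
    Convex ℝ {y | Feasible u c y} := by
  intro y hy z hz a b ha hb hab i
  rw [add_dotProduct, smul_dotProduct, smul_dotProduct, smul_eq_mul, smul_eq_mul]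
  calc a * y ⬝ᵥ u i + b * z ⬝ᵥ u i ≤ a * c i + b * c i :=
        add_le_add (mul_le_mul_of_nonneg_left (hy i) ha) (mul_le_mul_of_nonneg_left (hz i) hb)
    _ = c i := by rw [← add_mul, hab, one_mul]

lemma span_tightSet_of_mem_extremePoints {ι : Type*} [Fintype ι] {u : ι → Fin 3 → ℝ} {c : ι → ℝ}
    {y : Fin 3 → ℝ} (hy : y ∈ extremePoints ℝ {y | Feasible u c y}) :
    Submodule.span ℝ (u '' tightSet u c y) = ⊤ := by
  by_contra h
  obtain ⟨x, hx⟩ : ∃ x, x ∉ Submodule.span ℝ (u '' tightSet u c y) := by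
    by_contra! hall
    exact h (eq_top_iff.2 fun x _ => hall x)
  obtain ⟨d, hd, hdx⟩ := exists_dotProduct_pos hx
  have key : ∀ᶠ t : ℝ in nhdsWithin 0 (Ioi 0),
      ∀ i, (y + t • d) ⬝ᵥ u i ≤ c i ∧ (y - t • d) ⬝ᵥ u i ≤ c i := by
    rw [Filter.eventually_all]
    intro i
    by_cases hi : i ∈ tightSet u c y
    · refine Filter.Eventually.of_forall fun t => ?_
      rw [add_dotProduct, sub_dotProduct, smul_dotProduct,
        hd _ (Submodule.subset_span ⟨i, hi, rfl⟩), mem_tightSet.1 hi]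
      simp
    · have hlt : y ⬝ᵥ u i < c i := lt_of_le_of_ne (hy.1 i) fun h => hi (mem_tightSet.2 h)
      have hc1 : Continuous fun t : ℝ => (y + t • d) ⬝ᵥ u i := by
        unfold dotProduct; fun_prop
      have hc2 : Continuous fun t : ℝ => (y - t • d) ⬝ᵥ u i := by
        unfold dotProduct; fun_prop
      have h1 : ∀ᶠ t : ℝ in nhds 0, (y + t • d) ⬝ᵥ u i < c i :=
        hc1.continuousAt.eventually_lt_const (by simpa using hlt)
      have h2 : ∀ᶠ t : ℝ in nhds 0, (y - t • d) ⬝ᵥ u i < c i :=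
        hc2.continuousAt.eventually_lt_const (by simpa using hlt)
      exact ((h1.and h2).filter_mono nhdsWithin_le_nhds).mono fun t ht => ⟨ht.1.le, ht.2.le⟩
  obtain ⟨t, ht, ht0⟩ := (key.and self_mem_nhdsWithin).exists
  have hmid : y ∈ openSegment ℝ (y - t • d) (y + t • d) := by
    refine ⟨1 / 2, 1 / 2, by norm_num, by norm_num, by norm_num, ?_⟩
    module
  have h1 := hy.2 (fun i => (ht i).2) (fun i => (ht i).1) hmid
  have h2 : t • d = 0 := by simpa using h1
  rcases smul_eq_zero.1 h2 with h3 | h3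
  · exact (ne_of_gt (show (0 : ℝ) < t from ht0)) h3
  · rw [h3, zero_dotProduct] at hdx
    exact hdx.false

/-! ### Integral vectors -/

/-- An integral vector, viewed in `ℝ³`. -/
def toReal (v : Fin 3 → ℤ) : Fin 3 → ℝ := fun i => v i

lemma toReal_apply (v : Fin 3 → ℤ) (i : Fin 3) : toReal v i = v i := rfl

lemma toReal_injective : Function.Injective toReal := fun v w h =>
  funext fun i => by simpa [toReal] using congrFun h i

lemma toReal_dotProduct (v w : Fin 3 → ℤ) : toReal v ⬝ᵥ toReal w = ((v ⬝ᵥ w : ℤ) : ℝ) := by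
  simp [toReal, dotProduct]

lemma toReal_neg (v : Fin 3 → ℤ) : toReal (-v) = -toReal v := by
  ext i; simp [toReal]

/-- An integral triangle at lattice distance one from the origin which is not unimodular contains
a lattice point other than its vertices. -/
lemma exists_lattice_point_in_triangle (v : Fin 3 → Fin 3 → ℤ) {a : Fin 3 → ℤ}
    (ha : ∀ i, a ⬝ᵥ v i = 1) (h0 : (Matrix.of fun i => toReal (v i)).det ≠ 0)
    (h1 : |(Matrix.of fun i => toReal (v i)).det| ≠ 1) :
    ∃ (w : Fin 3 → ℤ) (γ : Fin 3 → ℝ), (∀ i, 0 ≤ γ i ∧ γ i < 1) ∧ ∑ i, γ i = 1 ∧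
      toReal w = ∑ i, γ i • toReal (v i) := by
  have hmap : (Matrix.of fun i => toReal (v i)) = (Matrix.of v).map (Int.castRingHom ℝ) := by
    ext i j; simp [toReal]
  have hdet : (Matrix.of fun i => toReal (v i)).det = (((Matrix.of v).det : ℤ) : ℝ) := by
    rw [hmap]; exact ((Int.castRingHom ℝ).map_det _).symm
  obtain ⟨z, hz⟩ : ∃ z : Fin 3 → ℤ, ∀ n : Fin 3 → ℤ, z ≠ ∑ i, n i • v i := by
    by_contra! hall
    choose N hN using hall
    have hmul : (Matrix.of fun l => N (Pi.single l 1)) * Matrix.of v = 1 := by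
      ext l j
      have := congrFun (hN (Pi.single l 1)) j
      rw [Matrix.mul_apply, Matrix.one_apply]
      simp only [Finset.sum_apply, Pi.smul_apply, smul_eq_mul, Pi.single_apply] at this
      simp only [Matrix.of_apply, ← this, eq_comm]
    have hu := Matrix.isUnit_det_of_left_inverse hmul
    rw [hdet] at h1
    rcases Int.isUnit_iff.1 hu with h | h <;> rw [h] at h1 <;> simp at h1
  obtain ⟨β, hβ⟩ : ∃ β : Fin 3 → ℝ, toReal z = ∑ i, β i • toReal (v i) := by
    refine ⟨Matrix.vecMul (toReal z) (Matrix.of fun i => toReal (v i))⁻¹, ?_⟩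
    have : Matrix.vecMul (Matrix.vecMul (toReal z) (Matrix.of fun i => toReal (v i))⁻¹)
        (Matrix.of fun i => toReal (v i)) = toReal z := by
      rw [Matrix.vecMul_vecMul, Matrix.nonsing_inv_mul _ (isUnit_iff_ne_zero.2 h0),
        Matrix.vecMul_one]
    rw [Matrix.vecMul_eq_sum] at this
    exact this.symm
  set f : Fin 3 → ℝ := fun i => Int.fract (β i) with hf
  have hf0 : ∀ i, 0 ≤ f i := fun i => Int.fract_nonneg _
  have hf1 : ∀ i, f i < 1 := fun i => Int.fract_lt_one _
  let w : Fin 3 → ℤ := z - ∑ i, ⌊β i⌋ • v i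
  have hw : toReal w = ∑ i, f i • toReal (v i) := by
    have : toReal w = toReal z - ∑ i, (⌊β i⌋ : ℝ) • toReal (v i) := by
      ext j; simp [w, toReal]
    rw [this, hβ, ← Finset.sum_sub_distrib]
    simp only [← sub_smul]
    rfl
  have haw : ((a ⬝ᵥ w : ℤ) : ℝ) = ∑ i, f i := by
    rw [← toReal_dotProduct, hw, dotProduct_sum]
    refine Finset.sum_congr rfl fun i _ => ?_
    rw [dotProduct_smul, toReal_dotProduct, ha]
    simp
  have hpos : 0 < ∑ i, f i := by
    refine lt_of_le_of_ne (Finset.sum_nonneg fun i _ => hf0 i) fun h => ?_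
    have hz0 := (Finset.sum_eq_zero_iff_of_nonneg fun i _ => hf0 i).1 h.symm
    apply hz fun i => ⌊β i⌋
    have hw0 : toReal w = 0 := by
      rw [hw]
      exact Finset.sum_eq_zero fun i hi => by rw [hz0 i hi, zero_smul]
    have : w = 0 := toReal_injective (by rw [hw0]; ext i; simp [toReal])
    exact sub_eq_zero.1 this
  have hlt3 : ∑ i, f i < 3 := by
    rw [Fin.sum_univ_three]
    linarith [hf1 0, hf1 1, hf1 2]
  rw [← haw] at hpos hlt3
  have hm0 : 0 < a ⬝ᵥ w := by exact_mod_cast hpos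
  have hm3 : a ⬝ᵥ w < 3 := by exact_mod_cast hlt3
  obtain hm | hm : a ⬝ᵥ w = 1 ∨ a ⬝ᵥ w = 2 := by omega
  · exact ⟨w, f, fun i => ⟨hf0 i, hf1 i⟩, by rw [← haw, hm]; simp, hw⟩
  · have hsum : ∑ i, f i = 2 := by rw [← haw, hm]; simp
    rw [Fin.sum_univ_three] at hsum
    refine ⟨(∑ i, v i) - w, fun i => 1 - f i, fun i => ⟨by linarith [hf1 i], ?_⟩, ?_, ?_⟩
    · have h0 := hf1 0
      have h1 := hf1 1
      have h2 := hf1 2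
      fin_cases i <;> simp <;> linarith
    · rw [Fin.sum_univ_three]; linarith
    · have : toReal ((∑ i, v i) - w) = ∑ i, toReal (v i) - toReal w := by
        ext j; simp [toReal]
      rw [this, hw, ← Finset.sum_sub_distrib]
      simp only [sub_smul, one_smul]

/-! ### Canonical subpolytopes -/

lemma mem_Delta4 {x : Fin 3 → ℝ} : x ∈ Delta4 ↔ (∀ i, 0 ≤ x i) ∧ x 0 + x 1 + x 2 ≤ 4 := by
  constructor
  · intro hx
    have hconv : Convex ℝ {x : Fin 3 → ℝ | (∀ i, 0 ≤ x i) ∧ x 0 + x 1 + x 2 ≤ 4} := by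
      intro y hy z hz a b ha hb hab
      refine ⟨fun i => add_nonneg (mul_nonneg ha (hy.1 i)) (mul_nonneg hb (hz.1 i)), ?_⟩
      simp only [Pi.add_apply, Pi.smul_apply, smul_eq_mul]
      nlinarith [mul_le_mul_of_nonneg_left hy.2 ha, mul_le_mul_of_nonneg_left hz.2 hb]
    refine convexHull_min ?_ hconv hx
    rintro y (rfl | rfl | rfl | rfl)
    all_goals
      refine ⟨fun i => ?_, ?_⟩
      · fin_cases i <;> simp
      · simp
  · rintro ⟨h, hs⟩
    have hmem : ∀ i, (![![0, 0, 0], ![4, 0, 0], ![0, 4, 0], ![0, 0, 4]] : Fin 4 → Fin 3 → ℝ) i ∈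
        Delta4 := fun i => subset_convexHull ℝ _ (by fin_cases i <;> simp)
    have := (convex_convexHull ℝ _ : Convex ℝ Delta4).sum_mem (t := Finset.univ)
      (w := ![1 - (x 0 + x 1 + x 2) / 4, x 0 / 4, x 1 / 4, x 2 / 4]) (fun i _ => ?_) ?_
      fun i _ => hmem i
    · have hx : x = ∑ i, ![1 - (x 0 + x 1 + x 2) / 4, x 0 / 4, x 1 / 4, x 2 / 4] i •
          (![![0, 0, 0], ![4, 0, 0], ![0, 4, 0], ![0, 0, 4]] : Fin 4 → Fin 3 → ℝ) i := by
        ext j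
        fin_cases j <;> simp [Fin.sum_univ_four]
      rw [hx]
      exact this
    · have h0 := h 0
      have h1 := h 1
      have h2 := h 2
      fin_cases i <;> simp <;> linarith
    · simp [Fin.sum_univ_four]; ring

/-- The translate of `P` that moves `(1,1,1)` to the origin. -/
def centered (P : Set (Fin 3 → ℝ)) : Set (Fin 3 → ℝ) := {x | pOne + x ∈ P}

open Classical in
/-- The lattice points of `P` other than `(1,1,1)`, relative to `(1,1,1)`. -/
def bdryPts (P : Set (Fin 3 → ℝ)) : Finset (Fin 3 → ℤ) :=
  (Finset.Icc (fun _ => -1) fun _ => 3).filter fun v => v ≠ 0 ∧ toReal v ∈ centered P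

/-- An integral functional that is at most `1` on the centered polytope. -/
def IsDual (P : Set (Fin 3 → ℝ)) (a : Fin 3 → ℤ) : Prop :=
  ∀ x ∈ centered P, toReal a ⬝ᵥ x ≤ 1

section Canonical

variable {P : Set (Fin 3 → ℝ)}

lemma pOne_apply (i : Fin 3) : pOne i = 1 := by
  fin_cases i <;> rfl

lemma toReal_zero : toReal 0 = 0 := by
  ext i; simp [toReal]

lemma centered_bounds (hP : P ⊆ Delta4) {x : Fin 3 → ℝ} (hx : x ∈ centered P) :
    (∀ i, -1 ≤ x i) ∧ x 0 + x 1 + x 2 ≤ 1 := by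
  obtain ⟨h, hs⟩ := mem_Delta4.1 (hP hx)
  simp only [Pi.add_apply, pOne_apply] at h hs
  exact ⟨fun i => by linarith [h i], by linarith⟩

lemma lattice_bounds (hP : P ⊆ Delta4) {v : Fin 3 → ℤ} (hv : toReal v ∈ centered P) :
    (∀ i, -1 ≤ v i) ∧ v 0 + v 1 + v 2 ≤ 1 := by
  obtain ⟨h, hs⟩ := centered_bounds hP hv
  simp only [toReal_apply] at h hs
  exact ⟨fun i => by exact_mod_cast h i, by exact_mod_cast hs⟩

open Classical in
lemma mem_bdryPts (hP : P ⊆ Delta4) {v : Fin 3 → ℤ} :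
    v ∈ bdryPts P ↔ v ≠ 0 ∧ toReal v ∈ centered P := by
  rw [bdryPts, Finset.mem_filter, and_iff_right_iff_imp]
  rintro ⟨-, hv⟩
  obtain ⟨h, hs⟩ := lattice_bounds hP hv
  have h0 := h 0
  have h1 := h 1
  have h2 := h 2
  refine Finset.mem_Icc.2 ⟨h, fun i => ?_⟩
  fin_cases i <;> simp <;> omega

lemma convex_centered (hP : IsSubpolytope P) : Convex ℝ (centered P) := by
  have : Convex ℝ P := hP.2 ▸ convex_convexHull ℝ _
  exact this.translate_preimage_right pOne

lemma finite_lattice (hP : P ⊆ Delta4) : (P ∩ latticePts).Finite := by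
  refine ((Finset.Icc (fun _ : Fin 3 => (-1 : ℤ)) fun _ => 3).finite_toSet.image
    fun v => pOne + toReal v).subset ?_
  rintro x ⟨hx, hl⟩
  choose n hn using hl
  have hxn : x = pOne + toReal (fun i => n i - 1) := by
    ext i; simp [pOne_apply, toReal, hn]
  refine ⟨fun i => n i - 1, ?_, hxn.symm⟩
  rw [hxn] at hx
  obtain ⟨h, hs⟩ := lattice_bounds hP hx
  have h0 := h 0
  have h1 := h 1
  have h2 := h 2
  refine Finset.mem_coe.2 (Finset.mem_Icc.2 ⟨h, fun i => ?_⟩)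
  fin_cases i <;> simp at * <;> omega

lemma isClosed_centered (hP : IsSubpolytope P) : IsClosed (centered P) := by
  have : IsClosed P := by
    rw [hP.2]; exact (finite_lattice hP.1).isClosed_convexHull ℝ
  exact this.preimage (continuous_const.add continuous_id)

lemma exists_ball_subset_centered (hp : pOne ∈ interior P) :
    ∃ ε > 0, Metric.ball 0 ε ⊆ centered P := by
  obtain ⟨ε, hε, h⟩ := Metric.mem_nhds_iff.1 (mem_interior_iff_mem_nhds.1 hp)
  refine ⟨ε, hε, fun x hx => h ?_⟩
  simpa [dist_eq_norm] using hx

lemma zero_mem_centered (hp : pOne ∈ interior P) : (0 : Fin 3 → ℝ) ∈ centered P := by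
  have : pOne + 0 ∈ P := by rw [add_zero]; exact interior_subset hp
  exact this

lemma volume_centered : volume (centered P) = volume P :=
  measure_preimage_add volume pOne P

lemma dotProduct_le_of_bdryPts (hP : IsSubpolytope P) {y : Fin 3 → ℝ} {t : ℝ} (ht : 0 ≤ t)
    (hy : ∀ v ∈ bdryPts P, y ⬝ᵥ toReal v ≤ t) : ∀ x ∈ centered P, y ⬝ᵥ x ≤ t := by
  intro x hx
  have hconv : Convex ℝ {z : Fin 3 → ℝ | y ⬝ᵥ z ≤ t + y ⬝ᵥ pOne} := by
    intro z hz w hw a b ha hb hab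
    simp only [mem_ofPred_eq, dotProduct_add, dotProduct_smul, smul_eq_mul] at *
    calc a * y ⬝ᵥ z + b * y ⬝ᵥ w ≤ a * (t + y ⬝ᵥ pOne) + b * (t + y ⬝ᵥ pOne) :=
          add_le_add (mul_le_mul_of_nonneg_left hz ha) (mul_le_mul_of_nonneg_left hw hb)
      _ = t + y ⬝ᵥ pOne := by rw [← add_mul, hab, one_mul]
  have hsub : P ⊆ {z : Fin 3 → ℝ | y ⬝ᵥ z ≤ t + y ⬝ᵥ pOne} := by
    rw [hP.2]
    refine convexHull_min ?_ hconv
    rintro z ⟨hz, hl⟩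
    choose n hn using hl
    have hzn : z = pOne + toReal (fun i => n i - 1) := by
      ext i; simp [pOne_apply, toReal, hn]
    rw [mem_ofPred_eq, hzn, dotProduct_add, add_comm]
    refine add_le_add_left ?_ _
    by_cases h0 : (fun i => n i - 1) = 0
    · rw [h0, toReal_zero, dotProduct_zero]; exact ht
    · exact hy _ ((mem_bdryPts hP.1).2 ⟨h0, by rw [hzn] at hz; exact hz⟩)
  have := hsub hx
  rw [mem_ofPred_eq, dotProduct_add] at this
  linarith

/-- The inclusion of the lattice points other than the center into `ℝ³`. -/
def bdryVec (P : Set (Fin 3 → ℝ)) (v : bdryPts P) : Fin 3 → ℝ := toReal v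

lemma Feasible.dotProduct_le (hP : IsSubpolytope P) {c : bdryPts P → ℝ} {y : Fin 3 → ℝ}
    (hy : Feasible (bdryVec P) c y) {t : ℝ} (ht : 0 ≤ t) (hc : ∀ v, c v ≤ t) :
    ∀ x ∈ centered P, y ⬝ᵥ x ≤ t :=
  dotProduct_le_of_bdryPts hP ht fun v hv => (hy ⟨v, hv⟩).trans (hc _)

lemma isBounded_feasible (hP : IsCanonicalSub P) (c : bdryPts P → ℝ) :
    Bornology.IsBounded {y | Feasible (bdryVec P) c y} := by
  obtain ⟨ε, hε, hball⟩ := exists_ball_subset_centered hP.2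
  set t := ∑ v, |c v|
  have ht : 0 ≤ t := Finset.sum_nonneg fun v _ => abs_nonneg _
  have hc : ∀ v, c v ≤ t := fun v => (le_abs_self _).trans
    (Finset.single_le_sum (f := fun v => |c v|) (fun v _ => abs_nonneg _) (Finset.mem_univ v))
  refine (Metric.isBounded_closedBall (x := (0 : Fin 3 → ℝ)) (r := 2 * t / ε)).subset
    fun y hy => ?_
  have hmem : ∀ (s : ℝ) (i : Fin 3), |s| < ε → Pi.single i s ∈ centered P := fun s i hs =>
    hball (by simpa [Pi.norm_single] using hs)
  rw [mem_closedBall_zero_iff, pi_norm_le_iff_of_nonneg (by positivity)]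
  intro i
  rw [Real.norm_eq_abs, le_div_iff₀ hε]
  have hlt : |ε / 2| < ε := by rw [abs_of_pos (by positivity)]; linarith
  have h1 := hy.dotProduct_le hP.1 ht hc _ (hmem (ε / 2) i hlt)
  have h2 := hy.dotProduct_le hP.1 ht hc _ (hmem (-(ε / 2)) i (by rwa [abs_neg]))
  rw [dotProduct_single] at h1 h2
  rcases abs_cases (y i) with ⟨h, -⟩ | ⟨h, -⟩ <;> rw [h] <;> linarith

lemma finrank_direction_eq_two {e : Fin 3 → ℝ}
    (he : Submodule.span ℝ (bdryVec P '' tightSet (bdryVec P) 1 e) = ⊤)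
    (hP : P ⊆ Delta4) :
    Module.finrank ℝ (affineSpan ℝ (P ∩ {x | dotp (-e) x = -(e ⬝ᵥ pOne) - 1})).direction = 2 := by
  set F := P ∩ {x | dotp (-e) x = -(e ⬝ᵥ pOne) - 1} with hF
  have hdot : ∀ x, dotp (-e) x = -(e ⬝ᵥ x) := fun x => neg_dotProduct e x
  rw [direction_affineSpan]
  obtain ⟨i, hi⟩ : (tightSet (bdryVec P) 1 e).Nonempty := by
    rw [Finset.nonempty_iff_ne_empty]
    intro h
    rw [h, Finset.coe_empty, image_empty, Submodule.span_empty] at he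
    exact bot_ne_top he
  have hmem : ∀ j ∈ tightSet (bdryVec P) 1 e, pOne + bdryVec P j ∈ F := fun j hj => by
    refine ⟨((mem_bdryPts hP).1 j.2).2, ?_⟩
    rw [mem_ofPred_eq, hdot, dotProduct_add, mem_tightSet.1 hj, Pi.one_apply]
    ring
  have hlt : vectorSpan ℝ F < ⊤ := by
    rw [lt_top_iff_ne_top]
    intro htop
    have hker : vectorSpan ℝ F ≤ LinearMap.ker (dotProductBilin ℝ ℝ e) := by
      refine Submodule.span_le.2 ?_
      rintro _ ⟨x, hx, y, hy, rfl⟩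
      have h1 := hx.2
      have h2 := hy.2
      rw [mem_ofPred_eq, hdot] at h1 h2
      simp only [vsub_eq_sub, SetLike.mem_coe, LinearMap.mem_ker, dotProductBilin_apply_apply,
        dotProduct_sub]
      linarith
    have h1 : bdryVec P i ∈ LinearMap.ker (dotProductBilin ℝ ℝ e) :=
      hker (htop ▸ Submodule.mem_top)
    rw [LinearMap.mem_ker, dotProductBilin_apply_apply, mem_tightSet.1 hi] at h1
    exact one_ne_zero h1
  have hsup : vectorSpan ℝ F ⊔ Submodule.span ℝ {bdryVec P i} = ⊤ := by
    rw [eq_top_iff, ← he, Submodule.span_le]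
    rintro _ ⟨j, hj, rfl⟩
    have : bdryVec P j = (pOne + bdryVec P j -ᵥ (pOne + bdryVec P i)) + bdryVec P i := by
      rw [vsub_eq_sub]; abel
    rw [this]
    exact add_mem (Submodule.mem_sup_left (vsub_mem_vectorSpan ℝ (hmem j hj) (hmem i hi)))
      (Submodule.mem_sup_right (Submodule.mem_span_singleton_self _))
  have h3 : Module.finrank ℝ (Fin 3 → ℝ) = 3 := by simp
  have h1 := Submodule.finrank_lt hlt.ne
  have h2 := Submodule.finrank_add_le_finrank_add_finrank (vectorSpan ℝ F)
    (Submodule.span ℝ {bdryVec P i})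
  have h4 : Module.finrank ℝ (Submodule.span ℝ {bdryVec P i}) ≤ 1 :=
    (finrank_span_le_card _).trans (by simp)
  rw [hsup, finrank_top] at h2
  omega

lemma exists_isDual_of_mem_extremePoints (hP : IsCanonicalSub P) (hr : IsReflexive P pOne)
    {e : Fin 3 → ℝ} (he : e ∈ extremePoints ℝ {y | Feasible (bdryVec P) 1 y}) :
    ∃ a, IsDual P a ∧ toReal a = e := by
  have hspan := span_tightSet_of_mem_extremePoints he
  have hle : ∀ x ∈ centered P, e ⬝ᵥ x ≤ 1 :=
    he.1.dotProduct_le hP.1 zero_le_one fun v => le_rfl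
  have hdot : ∀ x, dotp (-e) x = -(e ⬝ᵥ x) := fun x => neg_dotProduct e x
  obtain ⟨a, b, haF, -, hap⟩ := hr _ ⟨-e, -(e ⬝ᵥ pOne) - 1, fun x hx => by
    have := hle (x - pOne) (by simpa [centered] using hx)
    rw [dotProduct_sub] at this
    rw [hdot]; linarith, rfl, finrank_direction_eq_two hspan hP.1.1⟩
  have heq : toReal (-a) = e := by
    rw [← sub_eq_zero]
    by_contra hne
    have hker : (⊤ : Submodule ℝ (Fin 3 → ℝ)) ≤
        LinearMap.ker (dotProductBilin ℝ ℝ (toReal (-a) - e)) := by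
      rw [← hspan, Submodule.span_le]
      rintro _ ⟨j, hj, rfl⟩
      have h1 := haF (pOne + bdryVec P j) ⟨((mem_bdryPts hP.1.1).1 j.2).2, by
        rw [mem_ofPred_eq, hdot, dotProduct_add, mem_tightSet.1 hj, Pi.one_apply]; ring⟩
      have h2 : toReal a ⬝ᵥ (pOne + bdryVec P j) = b := h1
      have h3 : toReal a ⬝ᵥ pOne = b + 1 := hap
      rw [dotProduct_add] at h2
      rw [SetLike.mem_coe, LinearMap.mem_ker, dotProductBilin_apply_apply, sub_dotProduct,
        mem_tightSet.1 hj, toReal_neg, neg_dotProduct, Pi.one_apply]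
      linarith
    have := hker (Submodule.mem_top (x := toReal (-a) - e))
    rw [LinearMap.mem_ker, dotProductBilin_apply_apply, dotProduct_self_eq_zero] at this
    exact hne this
  exact ⟨-a, fun x hx => heq ▸ hle x hx, heq⟩

/-- A reflexive polytope is cut out by its integral dual functionals. -/
lemma mem_centered_of_isDual (hP : IsCanonicalSub P) (hr : IsReflexive P pOne) {x : Fin 3 → ℝ}
    (hx : ∀ a, IsDual P a → toReal a ⬝ᵥ x ≤ 1) : x ∈ centered P := by
  by_contra hmem
  obtain ⟨f, r, hf, hfx⟩ := geometric_hahn_banach_closed_point (convex_centered hP.1)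
    (isClosed_centered hP.1) hmem
  obtain ⟨d, hd⟩ := exists_dotProduct_eq f.toLinearMap
  have hr0 : 0 < r := by simpa using hf 0 (zero_mem_centered hP.2)
  have hb := isBounded_feasible hP 1
  have hcomp : IsCompact {y | Feasible (bdryVec P) 1 y} := by
    simpa using isCompact_feasible hb ∅
  have hconv : Convex ℝ {y : Fin 3 → ℝ | y ⬝ᵥ x ≤ 1} := by
    intro y hy z hz a b ha hb hab
    simp only [mem_ofPred_eq, add_dotProduct, smul_dotProduct, smul_eq_mul] at *
    nlinarith [mul_le_mul_of_nonneg_left hy ha, mul_le_mul_of_nonneg_left hz hb]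
  have hclosed : IsClosed {y : Fin 3 → ℝ | y ⬝ᵥ x ≤ 1} :=
    isClosed_le (by unfold dotProduct; fun_prop) continuous_const
  have hsub : {y | Feasible (bdryVec P) 1 y} ⊆ {y : Fin 3 → ℝ | y ⬝ᵥ x ≤ 1} := by
    rw [← closure_convexHull_extremePoints hcomp (convex_feasible _ _)]
    refine closure_minimal (convexHull_min (fun e he => ?_) hconv) hclosed
    obtain ⟨a, ha, rfl⟩ := exists_isDual_of_mem_extremePoints hP hr he
    exact hx a ha
  have h1 : (r⁻¹ • d) ⬝ᵥ x ≤ 1 := hsub fun v => by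
    have := hf _ ((mem_bdryPts hP.1.1).1 v.2).2
    have h2 : f (bdryVec P v) = d ⬝ᵥ bdryVec P v := hd _
    rw [smul_dotProduct, smul_eq_mul, inv_mul_le_iff₀ hr0, Pi.one_apply, mul_one, ← h2]
    exact this.le
  have h2 : f x = d ⬝ᵥ x := hd x
  rw [smul_dotProduct, smul_eq_mul, inv_mul_le_iff₀ hr0, mul_one, ← h2] at h1
  exact absurd hfx (not_lt.2 h1)

end Canonical

section Volume

variable {P : Set (Fin 3 → ℝ)}

lemma exists_isDual_dotProduct_eq_one (hP : P ⊆ Delta4) {v : Fin 3 → ℤ} (hv : v ∈ bdryPts P) :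
    ∃ a, IsDual P a ∧ a ⬝ᵥ v = 1 := by
  obtain ⟨hv0, hvP⟩ := (mem_bdryPts hP).1 hv
  obtain ⟨h, hs⟩ := lattice_bounds hP hvP
  by_cases hneg : ∃ i, v i = -1
  · obtain ⟨i, hi⟩ := hneg
    refine ⟨Pi.single i (-1), fun x hx => ?_, by rw [single_dotProduct, hi]; norm_num⟩
    have : toReal (Pi.single i (-1)) = Pi.single i (-1) := by
      ext j; by_cases hij : j = i
      · subst hij; simp [toReal]
      · simp [toReal, hij]
    rw [this, single_dotProduct]
    linarith [(centered_bounds hP hx).1 i]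
  · push Not at hneg
    refine ⟨fun _ => 1, fun x hx => ?_, ?_⟩
    · simpa [dotProduct, toReal, Fin.sum_univ_three] using (centered_bounds hP hx).2
    · have h0 : ∀ i, 0 ≤ v i := fun i => by have := h i; have := hneg i; omega
      have h1 := h0 0
      have h2 := h0 1
      have h3 := h0 2
      by_contra hne
      rw [dotProduct, Fin.sum_univ_three] at hne
      refine hv0 (funext fun i => ?_)
      fin_cases i <;> simp <;> omega

lemma dotProduct_self_le (hP : P ⊆ Delta4) {v : Fin 3 → ℤ} (hv : v ∈ bdryPts P) :
    v ⬝ᵥ v ≤ 11 := by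
  obtain ⟨h, hs⟩ := lattice_bounds hP ((mem_bdryPts hP).1 hv).2
  have h0 := h 0
  have h1 := h 1
  have h2 := h 2
  rw [dotProduct, Fin.sum_univ_three]
  nlinarith [mul_nonneg (neg_le_iff_add_nonneg.1 h0) (neg_le_iff_add_nonneg.1 h1),
    mul_nonneg (neg_le_iff_add_nonneg.1 h0) (neg_le_iff_add_nonneg.1 h2),
    mul_nonneg (neg_le_iff_add_nonneg.1 h1) (neg_le_iff_add_nonneg.1 h2)]

lemma dotProduct_sub_self (v w : Fin 3 → ℤ) :
    (v - w) ⬝ᵥ (v - w) = v ⬝ᵥ v + w ⬝ᵥ w - 2 * v ⬝ᵥ w := by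
  simp only [dotProduct, Fin.sum_univ_three, Pi.sub_apply]
  ring

lemma dotProduct_self_nonneg_int (v : Fin 3 → ℤ) : 0 ≤ v ⬝ᵥ v :=
  Finset.sum_nonneg fun _ _ => mul_self_nonneg _

lemma one_le_dotProduct_sub_self {v w : Fin 3 → ℤ} (h : v ≠ w) :
    1 ≤ (v - w) ⬝ᵥ (v - w) := by
  have h1 := dotProduct_self_nonneg_int (v - w)
  have h2 : (v - w) ⬝ᵥ (v - w) ≠ 0 := fun h0 => h (sub_eq_zero.1 (dotProduct_self_eq_zero.1 h0))
  omega

/-- For weights close to `1 + |v|² / 40`, the cells span unimodular triangles. -/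
lemma abs_det_eq_one_of_mem_cells [DecidableEq (bdryPts P)] (hP : IsSubpolytope P)
    {c : bdryPts P → ℝ}
    (hc : ∀ v, 1 + ((v.1 ⬝ᵥ v.1 : ℤ) : ℝ) / 40 < c v ∧
      c v < 1 + ((v.1 ⬝ᵥ v.1 : ℤ) : ℝ) / 40 + 1 / 80)
    (hind : ∀ y, LinearIndepOn ℝ (bdryVec P) (tightSet (bdryVec P) c y : Set (bdryPts P)))
    {i j k : bdryPts P} (hij : i ≠ j) (hik : i ≠ k) (hjk : j ≠ k)
    (hT : {i, j, k} ∈ cells (bdryVec P) c) {a : Fin 3 → ℤ}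
    (haT : ∀ v ∈ ({i, j, k} : Finset (bdryPts P)), a ⬝ᵥ v.1 = 1) :
    |(Matrix.of ![bdryVec P i, bdryVec P j, bdryVec P k]).det| = 1 := by
  have hD := hP.1
  obtain ⟨-, y, hy, hyT⟩ := mem_cells.1 hT
  let e : Fin 3 → bdryPts P := ![i, j, k]
  have he : Function.Injective e := by
    intro l m hlm
    fin_cases l <;> fin_cases m <;>
      first
      | rfl
      | exact absurd hlm hij
      | exact absurd hlm hik
      | exact absurd hlm hjk
      | exact absurd hlm.symm hij
      | exact absurd hlm.symm hik
      | exact absurd hlm.symm hjk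
  have heT : ∀ l, e l ∈ ({i, j, k} : Finset (bdryPts P)) := fun l => by
    fin_cases l <;> simp [e]
  have hmat : (Matrix.of ![bdryVec P i, bdryVec P j, bdryVec P k]) =
      Matrix.of fun l => toReal (e l).1 := by
    ext l m; fin_cases l <;> rfl
  rw [hmat]
  by_contra h1
  have hlin : LinearIndependent ℝ fun l => toReal (e l).1 := by
    have h := hind y
    rw [hyT] at h
    exact LinearIndependent.comp h (fun l => ⟨e l, heT l⟩) fun l m hlm =>
      he (congrArg Subtype.val hlm)
  have h0 : (Matrix.of fun l => toReal (e l).1).det ≠ 0 := by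
    rw [← isUnit_iff_ne_zero, ← Matrix.isUnit_iff_isUnit_det]
    exact Matrix.linearIndependent_rows_iff_isUnit.1 hlin
  obtain ⟨w, γ, hγ, hγ1, hw⟩ := exists_lattice_point_in_triangle (fun l => (e l).1)
    (fun l => haT _ (heT l)) h0 h1
  have haw : a ⬝ᵥ w = 1 := by
    have : toReal a ⬝ᵥ toReal w = 1 := by
      rw [hw, dotProduct_sum, ← hγ1]
      refine Finset.sum_congr rfl fun l _ => ?_
      rw [dotProduct_smul, toReal_dotProduct, haT _ (heT l), Int.cast_one, smul_eq_mul, mul_one]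
    rw [toReal_dotProduct] at this
    exact_mod_cast this
  have hwP : w ∈ bdryPts P := by
    refine (mem_bdryPts hD).2 ⟨fun h => ?_, ?_⟩
    · rw [h, dotProduct_zero] at haw; exact zero_ne_one haw
    · rw [hw]
      exact (convex_centered hP).sum_mem (fun l _ => (hγ l).1) hγ1
        fun l _ => ((mem_bdryPts hD).1 (e l).2).2
  have hdist : ∀ l, (1 : ℝ) ≤ (((e l).1 ⬝ᵥ (e l).1 : ℤ) : ℝ) + ((w ⬝ᵥ w : ℤ) : ℝ)
      - 2 * (((e l).1 ⬝ᵥ w : ℤ) : ℝ) := by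
    intro l
    have hne : (e l).1 ≠ w := by
      rintro rfl
      have hsum : ∑ m, (γ m - if m = l then 1 else 0) • toReal (e m).1 = 0 := by
        simp only [sub_smul, Finset.sum_sub_distrib, ite_smul, one_smul, zero_smul]
        rw [← hw]
        simp
      have := Fintype.linearIndependent_iff.1 hlin _ hsum l
      rw [if_pos rfl] at this
      linarith [(hγ l).2]
    have := one_le_dotProduct_sub_self hne
    rw [dotProduct_sub_self] at this
    exact_mod_cast this
  have hww : ∑ l, γ l * (((e l).1 ⬝ᵥ w : ℤ) : ℝ) = ((w ⬝ᵥ w : ℤ) : ℝ) := by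
    rw [← toReal_dotProduct w w]
    nth_rewrite 2 [hw]
    rw [dotProduct_sum]
    refine Finset.sum_congr rfl fun l _ => ?_
    rw [dotProduct_smul, toReal_dotProduct, dotProduct_comm w, smul_eq_mul]
  have hyw : y ⬝ᵥ toReal w = ∑ l, γ l * c (e l) := by
    rw [hw, dotProduct_sum]
    refine Finset.sum_congr rfl fun l _ => ?_
    rw [dotProduct_smul, smul_eq_mul]
    congr 1
    exact mem_tightSet.1 (hyT.symm ▸ heT l : e l ∈ tightSet (bdryVec P) c y)
  have hle : y ⬝ᵥ toReal w ≤ c ⟨w, hwP⟩ := hy ⟨w, hwP⟩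
  have hcw := (hc ⟨w, hwP⟩).2
  have hlow : ∀ l, γ l * (1 + (1 - ((w ⬝ᵥ w : ℤ) : ℝ) + 2 * (((e l).1 ⬝ᵥ w : ℤ) : ℝ)) / 40) ≤
      γ l * c (e l) := fun l =>
    mul_le_mul_of_nonneg_left (by linarith [hdist l, (hc (e l)).1]) (hγ l).1
  rw [Fin.sum_univ_three] at hww hyw hγ1
  have l0 := hlow 0
  have l1 := hlow 1
  have l2 := hlow 2
  rw [hyw] at hle
  simp only at hcw
  have key : γ 0 * (1 - ((w ⬝ᵥ w : ℤ) : ℝ)) + γ 1 * (1 - ((w ⬝ᵥ w : ℤ) : ℝ)) +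
      γ 2 * (1 - ((w ⬝ᵥ w : ℤ) : ℝ)) = 1 - ((w ⬝ᵥ w : ℤ) : ℝ) := by
    rw [← add_mul, ← add_mul, hγ1, one_mul]
  linarith

/-- Six times the volume of a reflexive polytope is determined by its number of lattice points. -/
theorem volume_eq_card_bdryPts (hP : IsCanonicalSub P) (hr : IsReflexive P pOne) :
    ∃ n : ℕ, n + 4 = 2 * (bdryPts P).card ∧ 4 ≤ (bdryPts P).card ∧ volume P * 6 = n := by
  classical
  have hD := hP.1.1
  obtain ⟨c, hc, hind⟩ := exists_generic_weights (bdryVec P)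
    (fun v => 1 + ((v.1 ⬝ᵥ v.1 : ℤ) : ℝ) / 40) (δ := 1 / 80) (by norm_num)
  have hb := isBounded_feasible hP c
  have hsq0 : ∀ v : bdryPts P, (0 : ℝ) ≤ ((v.1 ⬝ᵥ v.1 : ℤ) : ℝ) := fun v => by
    exact_mod_cast dotProduct_self_nonneg_int v.1
  have hsq : ∀ v : bdryPts P, ((v.1 ⬝ᵥ v.1 : ℤ) : ℝ) ≤ 11 := fun v => by
    exact_mod_cast dotProduct_self_le hD v.2
  have hc1 : ∀ v, 1 < c v := fun v => by have := (hc v).1; have := hsq0 v; linarith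
  have hc2 : ∀ v, c v ≤ 13 / 10 := fun v => by have := (hc v).2; have := hsq v; linarith
  have hne : ∃ y, Feasible (bdryVec P) c y := ⟨0, fun v => by
    rw [zero_dotProduct]; exact zero_le_one.trans (hc1 v).le⟩
  have huse : ∀ v, ∃ y, Feasible (bdryVec P) c y ∧ v ∈ tightSet (bdryVec P) c y := by
    intro v
    obtain ⟨a, ha, hav⟩ := exists_isDual_dotProduct_eq_one hD v.2
    set s : ℝ := c v - ((v.1 ⬝ᵥ v.1 : ℤ) : ℝ) / 20 with hs
    have hval : ∀ w : bdryPts P, (s • toReal a + (1 / 20 : ℝ) • toReal v) ⬝ᵥ bdryVec P w =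
        s * ((a ⬝ᵥ w.1 : ℤ) : ℝ) + ((v.1 ⬝ᵥ w.1 : ℤ) : ℝ) / 20 := fun w => by
      rw [add_dotProduct, smul_dotProduct, smul_dotProduct, bdryVec, toReal_dotProduct,
        toReal_dotProduct, smul_eq_mul, smul_eq_mul]
      ring
    have hvv : (s • toReal a + (1 / 20 : ℝ) • toReal v) ⬝ᵥ bdryVec P v = c v := by
      rw [hval, hav]; push_cast; ring
    refine ⟨_, fun w => ?_, mem_tightSet.2 hvv⟩
    by_cases hwv : w = v
    · rw [hwv, hvv]
    · have hle : a ⬝ᵥ w.1 ≤ 1 := by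
        have := ha _ ((mem_bdryPts hD).1 w.2).2
        rw [toReal_dotProduct] at this
        exact_mod_cast this
      have hd := one_le_dotProduct_sub_self fun h : v.1 = w.1 => hwv (Subtype.ext h.symm)
      rw [dotProduct_sub_self] at hd
      have hd' : (1 : ℝ) ≤ ((v.1 ⬝ᵥ v.1 : ℤ) : ℝ) + ((w.1 ⬝ᵥ w.1 : ℤ) : ℝ)
          - 2 * ((v.1 ⬝ᵥ w.1 : ℤ) : ℝ) := by exact_mod_cast hd
      have hv := hc v
      have hw := hc w
      have hv11 := hsq v
      have hw11 := hsq w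
      rw [hval]
      obtain h1 | h0 : a ⬝ᵥ w.1 = 1 ∨ a ⬝ᵥ w.1 ≤ 0 := by omega
      · rw [h1]; push_cast; linarith
      · have h0' : ((a ⬝ᵥ w.1 : ℤ) : ℝ) ≤ 0 := by exact_mod_cast h0
        have hs0 : 0 ≤ s := by have := hsq0 v; linarith
        have := mul_nonpos_of_nonneg_of_nonpos hs0 h0'
        have := hsq0 w
        linarith
  obtain ⟨hcard, h4⟩ := card_cells_add_four hb hind hne huse
  rw [Fintype.card_coe] at hcard h4
  have hdual : ∀ T ∈ cells (bdryVec P) c, ∃ a, IsDual P a ∧ ∀ v ∈ T, a ⬝ᵥ v.1 = 1 := by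
    intro T hT
    obtain ⟨hT3, y, hy, hyT⟩ := mem_cells.1 hT
    by_contra! hno
    have hmem : (1 / 2 : ℝ) • ∑ v ∈ T, bdryVec P v ∈ centered P := by
      refine mem_centered_of_isDual hP hr fun a ha => ?_
      obtain ⟨v, hv, hne⟩ := hno a ha
      have hle : ∀ w : bdryPts P, a ⬝ᵥ w.1 ≤ 1 := fun w => by
        have := ha _ ((mem_bdryPts hD).1 w.2).2
        rw [toReal_dotProduct] at this
        exact_mod_cast this
      have hv0 : a ⬝ᵥ v.1 ≤ 0 := by have := hle v; omega
      have hsum : ∑ w ∈ T, a ⬝ᵥ w.1 ≤ 2 := by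
        rw [← Finset.add_sum_erase _ _ hv]
        have := Finset.sum_le_card_nsmul (T.erase v) (fun w => a ⬝ᵥ w.1) 1 fun w _ => hle w
        rw [Finset.card_erase_of_mem hv, hT3] at this
        simp only [nsmul_eq_mul, mul_one] at this
        norm_num at this
        linarith
      have : toReal a ⬝ᵥ ∑ v ∈ T, bdryVec P v = ((∑ w ∈ T, a ⬝ᵥ w.1 : ℤ) : ℝ) := by
        rw [dotProduct_sum, Int.cast_sum]
        exact Finset.sum_congr rfl fun w _ => toReal_dotProduct _ _
      rw [dotProduct_smul, this, smul_eq_mul]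
      have : ((∑ w ∈ T, a ⬝ᵥ w.1 : ℤ) : ℝ) ≤ 2 := by exact_mod_cast hsum
      linarith
    have h1 := hy.dotProduct_le hP.1 (by norm_num) hc2 _ hmem
    rw [dotProduct_smul, dotProduct_sum, smul_eq_mul] at h1
    have h2 : ∑ v ∈ T, (1 : ℝ) ≤ ∑ v ∈ T, y ⬝ᵥ bdryVec P v :=
      Finset.sum_le_sum fun v hv => by
        rw [mem_tightSet.1 (hyT.symm ▸ hv : v ∈ tightSet (bdryVec P) c y)]
        exact (hc1 v).le
    rw [Finset.sum_const, hT3, nsmul_eq_mul, mul_one] at h2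
    push_cast at h2
    linarith
  refine ⟨(cells (bdryVec P) c).card, hcard, h4, ?_⟩
  rw [← volume_centered]
  refine volume_mul_six_eq_card_cells hb hind hne (convex_centered hP.1) (zero_mem_centered hP.2)
    (fun v => ((mem_bdryPts hD).1 v.2).2) (fun T hT => ?_) fun i j k hij hik hjk hT => ?_
  · obtain ⟨a, ha, haT⟩ := hdual T hT
    exact ⟨toReal a, fun v hv => by rw [bdryVec, toReal_dotProduct, haT v hv, Int.cast_one], ha⟩
  · obtain ⟨a, -, haT⟩ := hdual _ hT
    exact abs_det_eq_one_of_mem_cells hP.1 hc hind hij hik hjk hT haT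

end Volume

/-! ### Lattice points removed by a half-space -/

/-- The barycentric coordinates of the lattice points of the tetrahedron. -/
def exponents : Finset (Fin 4 → ℕ) := Finset.Nat.antidiagonalTuple 4 4

lemma mem_exponents {m : Fin 4 → ℕ} : m ∈ exponents ↔ m 0 + m 1 + m 2 + m 3 = 4 := by
  rw [exponents, Finset.Nat.mem_antidiagonalTuple, Fin.sum_univ_four]

/-- The lattice points at which a linear form in barycentric coordinates is negative. -/
def negPts (F : Fin 4 → ℤ) : Finset (Fin 4 → ℕ) :=
  exponents.filter fun m => F 0 * m 0 + F 1 * m 1 + F 2 * m 2 + F 3 * m 3 < 0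

/-- The lattice points on the edge `ij`, or those near the vertex `i` if `i = j`. -/
def corner (i j : Fin 4) : Finset (Fin 4 → ℕ) :=
  exponents.filter fun m => if i = j then 3 ≤ m i else m i + m j = 4

lemma mem_negPts {F : Fin 4 → ℤ} {m : Fin 4 → ℕ} : m ∈ negPts F ↔ m 0 + m 1 + m 2 + m 3 = 4 ∧
    F 0 * m 0 + F 1 * m 1 + F 2 * m 2 + F 3 * m 3 < 0 := by
  rw [negPts, Finset.mem_filter, mem_exponents]

lemma card_corner : ∀ i j : Fin 4, (corner i j).card = if i = j then 4 else 5 := by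
  decide +kernel

lemma seven_le_card_corner_union :
    ∀ i j k l : Fin 4, corner i j = corner k l ∨ 7 ≤ (corner i j ∪ corner k l).card := by
  decide +kernel

lemma seven_le_card_negPts {F : Fin 4 → ℤ} (l : List (Fin 4 → ℕ)) (hl : l.toFinset.card = 7)
    (h : ∀ m ∈ l, m 0 + m 1 + m 2 + m 3 = 4 ∧
      F 0 * m 0 + F 1 * m 1 + F 2 * m 2 + F 3 * m 3 < 0) : 7 ≤ (negPts F).card := by
  rw [← hl]
  exact Finset.card_le_card fun m hm => mem_negPts.2 (h m (List.mem_toFinset.1 hm))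

lemma negPts_of_monotone {F : Fin 4 → ℤ} (h01 : F 0 ≤ F 1) (h12 : F 1 ≤ F 2) (h23 : F 2 ≤ F 3)
    (hsum : F 0 + F 1 + F 2 + F 3 = 4) (hdvd : ∀ i, (4 : ℤ) ∣ F i - F 0)
    (hne : (negPts F).Nonempty) :
    negPts F = corner 0 0 ∨ negPts F = corner 0 1 ∨ 7 ≤ (negPts F).card := by
  have d1 := hdvd 1
  have d2 := hdvd 2
  have d3 := hdvd 3
  obtain ⟨m, hm⟩ := hne
  obtain ⟨hm4, hmneg⟩ := mem_negPts.1 hm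
  have h0 : F 0 < 0 := by
    by_contra hcon
    have := mul_nonneg (show 0 ≤ F 0 by omega) (Int.natCast_nonneg (m 0))
    have := mul_nonneg (show 0 ≤ F 1 by omega) (Int.natCast_nonneg (m 1))
    have := mul_nonneg (show 0 ≤ F 2 by omega) (Int.natCast_nonneg (m 2))
    have := mul_nonneg (show 0 ≤ F 3 by omega) (Int.natCast_nonneg (m 3))
    omega
  by_cases h1 : F 1 < 0
  · right
    by_cases h2 : 3 * F 0 + F 2 < 0
    · right
      by_cases h3 : 2 * F 0 + F 1 + F 2 < 0
      · refine seven_le_card_negPts [![4, 0, 0, 0], ![3, 1, 0, 0], ![2, 2, 0, 0], ![1, 3, 0, 0],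
          ![0, 4, 0, 0], ![3, 0, 1, 0], ![2, 1, 1, 0]] (by decide) ?_
        simp
        omega
      · refine seven_le_card_negPts [![4, 0, 0, 0], ![3, 1, 0, 0], ![2, 2, 0, 0], ![1, 3, 0, 0],
          ![0, 4, 0, 0], ![3, 0, 1, 0], ![3, 0, 0, 1]] (by decide) ?_
        simp
        omega
    · left
      ext n
      rw [mem_negPts, corner, Finset.mem_filter, mem_exponents, if_neg (by decide)]
      refine and_congr_right fun hn => ⟨fun hneg => ?_, fun hedge => ?_⟩
      · by_contra hcon
        have ht : (1 : ℤ) ≤ n 2 + n 3 := by omega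
        have hn' : (n 0 : ℤ) + n 1 = 4 - (n 2 + n 3) := by omega
        have e1 := mul_le_mul_of_nonneg_right h01 (Int.natCast_nonneg (n 1))
        have e2 := mul_le_mul_of_nonneg_right h23 (Int.natCast_nonneg (n 3))
        have e3 : 0 ≤ (F 2 - F 0) * ((n 2 + n 3 : ℤ) - 1) :=
          mul_nonneg (by omega) (by omega)
        have e4 : F 0 * ((n 0 : ℤ) + n 1) = F 0 * (4 - (n 2 + n 3)) := by rw [hn']
        linarith
      · have hn2 : n 2 = 0 := by omega
        have hn3 : n 3 = 0 := by omega
        rw [hn2, hn3]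
        have e1 := mul_le_mul_of_nonneg_right (show F 0 ≤ -1 by omega) (Int.natCast_nonneg (n 0))
        have e2 := mul_le_mul_of_nonneg_right (show F 1 ≤ -1 by omega) (Int.natCast_nonneg (n 1))
        push_cast
        omega
  · obtain h2 | h3 | h4 : F 0 = -2 ∨ F 0 = -3 ∨ F 0 ≤ -4 := by omega
    · left
      have e1 : F 1 = 2 := by omega
      have e2 : F 2 = 2 := by omega
      have e3 : F 3 = 2 := by omega
      ext n
      rw [mem_negPts, corner, Finset.mem_filter, mem_exponents, if_pos rfl, h2, e1, e2, e3]
      omega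
    · right; right
      refine seven_le_card_negPts [![4, 0, 0, 0], ![3, 1, 0, 0], ![3, 0, 1, 0], ![3, 0, 0, 1],
        ![2, 2, 0, 0], ![2, 1, 1, 0], ![2, 0, 2, 0]] (by decide) ?_
      simp
      omega
    · right; right
      by_cases h5 : F 0 + F 2 < 0
      · refine seven_le_card_negPts [![4, 0, 0, 0], ![3, 1, 0, 0], ![3, 0, 1, 0], ![3, 0, 0, 1],
          ![2, 2, 0, 0], ![2, 1, 1, 0], ![2, 0, 2, 0]] (by decide) ?_
        simp
        omega
      · refine seven_le_card_negPts [![4, 0, 0, 0], ![3, 1, 0, 0], ![3, 0, 1, 0], ![3, 0, 0, 1],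
          ![2, 2, 0, 0], ![2, 1, 1, 0], ![2, 1, 0, 1]] (by decide) ?_
        simp
        omega

lemma comp_mem_negPts {F : Fin 4 → ℤ} {m : Fin 4 → ℕ} (σ : Equiv.Perm (Fin 4)) :
    m ∘ σ ∈ negPts (F ∘ σ) ↔ m ∈ negPts F := by
  have h1 := Equiv.sum_comp σ m
  have h2 := Equiv.sum_comp σ fun i => F i * m i
  simp only [Fin.sum_univ_four] at h1 h2
  simp only [mem_negPts, Function.comp_apply, h1, h2]

lemma comp_mem_corner {m : Fin 4 → ℕ} (σ : Equiv.Perm (Fin 4)) (i j : Fin 4) :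
    m ∘ σ ∈ corner i j ↔ m ∈ corner (σ i) (σ j) := by
  have h1 := Equiv.sum_comp σ m
  simp only [Fin.sum_univ_four] at h1
  simp only [corner, Finset.mem_filter, mem_exponents, Function.comp_apply, h1,
    σ.injective.eq_iff]

lemma negPts_eq_corner_or {F : Fin 4 → ℤ} (hsum : F 0 + F 1 + F 2 + F 3 = 4)
    (hdvd : ∀ i j, (4 : ℤ) ∣ F i - F j) (hne : (negPts F).Nonempty) :
    (∃ i j, negPts F = corner i j) ∨ 7 ≤ (negPts F).card := by
  set σ := Tuple.sort F
  have hmono : Monotone (F ∘ σ) := Tuple.monotone_sort F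
  have hs := Equiv.sum_comp σ F
  simp only [Fin.sum_univ_four] at hs
  have heq : ∀ {i j}, negPts (F ∘ σ) = corner i j → ∃ i j, negPts F = corner i j :=
    fun {i j} h => ⟨σ i, σ j, by
      ext m; rw [← comp_mem_negPts σ, h, comp_mem_corner]⟩
  obtain ⟨m, hm⟩ := hne
  rcases negPts_of_monotone (F := F ∘ σ) (hmono (by decide)) (hmono (by decide))
    (hmono (by decide)) (hs.trans hsum) (fun i => hdvd _ _) ⟨_, (comp_mem_negPts σ).2 hm⟩
    with h | h | h
  · exact Or.inl (heq h)
  · exact Or.inl (heq h)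
  · refine Or.inr (h.trans (Finset.card_le_card_of_injOn (fun m => m ∘ σ.symm) ?_ ?_))
    · intro m hm
      have : (m ∘ σ.symm) ∘ σ = m := by ext i; simp
      exact (comp_mem_negPts σ).1 (this.symm ▸ hm)
    · intro m _ n _ h
      exact σ.symm.surjective.injective_comp_right h

/-- A union of sets cut out by reflexive half-spaces never has `1`, `2`, `3` or `6` elements. -/
lemma card_of_forall_exists_negPts {M : Finset (Fin 4 → ℕ)}
    (h : ∀ m ∈ M, ∃ F : Fin 4 → ℤ, F 0 + F 1 + F 2 + F 3 = 4 ∧ (∀ i j, (4 : ℤ) ∣ F i - F j) ∧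
      m ∈ negPts F ∧ negPts F ⊆ M) :
    M.card = 0 ∨ M.card = 4 ∨ M.card = 5 ∨ 7 ≤ M.card := by
  by_contra! hcon
  have hcorner : ∀ m ∈ M, ∃ i j, m ∈ corner i j ∧ corner i j ⊆ M := by
    intro m hm
    obtain ⟨F, hsum, hdvd, hmF, hFM⟩ := h m hm
    obtain ⟨i, j, hij⟩ | h7 := negPts_eq_corner_or hsum hdvd ⟨m, hmF⟩
    · exact ⟨i, j, hij ▸ hmF, hij ▸ hFM⟩
    · have := h7.trans (Finset.card_le_card hFM)
      omega
  obtain ⟨m, hm⟩ := Finset.card_ne_zero.1 hcon.1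
  obtain ⟨i, j, hmij, hij⟩ := hcorner m hm
  have heq : M = corner i j := by
    refine Finset.Subset.antisymm (fun n hn => ?_) hij
    obtain ⟨k, l, hnkl, hkl⟩ := hcorner n hn
    obtain h1 | h7 := seven_le_card_corner_union i j k l
    · rwa [h1]
    · have := h7.trans (Finset.card_le_card (Finset.union_subset hij hkl))
      omega
  have := card_corner i j
  rw [← heq] at this
  split_ifs at this <;> omega

section Missing

variable {P : Set (Fin 3 → ℝ)}

/-- The lattice point with the given barycentric coordinates, relative to `(1,1,1)`. -/
def latticePoint (m : Fin 4 → ℕ) : Fin 3 → ℤ := ![m 1 - 1, m 2 - 1, m 3 - 1]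

lemma latticePoint_injOn : InjOn latticePoint exponents := by
  intro m hm n hn h
  have hm := mem_exponents.1 hm
  have hn := mem_exponents.1 hn
  have h0 := congrFun h 0
  have h1 := congrFun h 1
  have h2 := congrFun h 2
  simp only [latticePoint, Matrix.cons_val] at h0 h1 h2
  ext i
  fin_cases i <;> simp <;> omega

/-- The linear form in barycentric coordinates that is `4 * (1 - a ⬝ᵥ v)` at `v`. -/
def slackForm (a : Fin 3 → ℤ) : Fin 4 → ℤ :=
  ![1 + a 0 + a 1 + a 2, 1 - 3 * a 0 + a 1 + a 2, 1 + a 0 - 3 * a 1 + a 2,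
    1 + a 0 + a 1 - 3 * a 2]

lemma mem_negPts_slackForm {a : Fin 3 → ℤ} {m : Fin 4 → ℕ} (hm : m ∈ exponents) :
    m ∈ negPts (slackForm a) ↔ 1 < a ⬝ᵥ latticePoint m := by
  have h := mem_exponents.1 hm
  have h' : (m 0 : ℤ) = 4 - m 1 - m 2 - m 3 := by omega
  rw [mem_negPts, and_iff_right h, ← sub_neg (a := (1 : ℤ))]
  have : slackForm a 0 * m 0 + slackForm a 1 * m 1 + slackForm a 2 * m 2 + slackForm a 3 * m 3 =
      4 * (1 - a ⬝ᵥ latticePoint m) := by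
    simp only [slackForm, latticePoint, dotProduct, Fin.sum_univ_three, Matrix.cons_val, h']
    ring
  rw [this]
  omega

open Classical in
/-- The lattice points of the tetrahedron that do not lie in `P`. -/
def missing (P : Set (Fin 3 → ℝ)) : Finset (Fin 4 → ℕ) :=
  exponents.filter fun m => toReal (latticePoint m) ∉ centered P

lemma card_exponents : exponents.card = 35 := by decide +kernel

lemma card_bdryPts_add_card_missing (hP : IsCanonicalSub P) :
    (bdryPts P).card + (missing P).card = 34 := by
  classical
  have h0 : (0 : Fin 3 → ℤ) ∉ bdryPts P := fun h => ((mem_bdryPts hP.1.1).1 h).1 rfl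
  have himage : insert 0 (bdryPts P) =
      (exponents.filter fun m => toReal (latticePoint m) ∈ centered P).image latticePoint := by
    ext v
    rw [Finset.mem_insert, mem_bdryPts hP.1.1, Finset.mem_image]
    constructor
    · intro h
      have hv : toReal v ∈ centered P := by
        rcases h with rfl | h
        · rw [toReal_zero]; exact zero_mem_centered hP.2
        · exact h.2
      obtain ⟨hb, hs⟩ := lattice_bounds hP.1.1 hv
      have hb0 := hb 0
      have hb1 := hb 1
      have hb2 := hb 2
      have hvm : latticePoint ![(1 - v 0 - v 1 - v 2).toNat, (v 0 + 1).toNat, (v 1 + 1).toNat,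
          (v 2 + 1).toNat] = v := by
        ext i
        fin_cases i <;> simp [latticePoint] <;> omega
      refine ⟨_, Finset.mem_filter.2 ⟨mem_exponents.2 ?_, ?_⟩, hvm⟩
      · simp
        omega
      · rwa [hvm]
    · rintro ⟨m, hm, rfl⟩
      have := (Finset.mem_filter.1 hm).2
      by_cases hz : latticePoint m = 0
      · exact Or.inl hz
      · exact Or.inr ⟨hz, this⟩
  have h1 := Finset.card_insert_of_notMem h0
  rw [himage, Finset.card_image_of_injOn
    (latticePoint_injOn.mono (Finset.coe_subset.2 (Finset.filter_subset _ _)))] at h1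
  have h2 := Finset.card_filter_add_card_filter_not (s := exponents)
    fun m => toReal (latticePoint m) ∈ centered P
  rw [card_exponents] at h2
  have h3 : (missing P).card =
      (exponents.filter fun m => ¬ toReal (latticePoint m) ∈ centered P).card := rfl
  omega

lemma card_missing (hP : IsCanonicalSub P) (hr : IsReflexive P pOne) :
    (missing P).card = 0 ∨ (missing P).card = 4 ∨ (missing P).card = 5 ∨
      7 ≤ (missing P).card := by
  classical
  refine card_of_forall_exists_negPts fun m hm => ?_
  obtain ⟨hm4, hmP⟩ := Finset.mem_filter.1 hm
  obtain ⟨a, ha, ham⟩ : ∃ a, IsDual P a ∧ 1 < toReal a ⬝ᵥ toReal (latticePoint m) := by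
    by_contra! hall
    exact hmP (mem_centered_of_isDual hP hr hall)
  rw [toReal_dotProduct] at ham
  refine ⟨slackForm a, ?_, fun i j => ?_, ?_, fun n hn => ?_⟩
  · simp only [slackForm, Matrix.cons_val]
    ring
  · fin_cases i <;> fin_cases j <;> simp [slackForm] <;> omega
  · exact (mem_negPts_slackForm hm4).2 (by exact_mod_cast ham)
  · have hn4 : n ∈ exponents := (Finset.mem_filter.1 hn).1
    refine Finset.mem_filter.2 ⟨hn4, fun hnP => ?_⟩
    have h1 := ha _ hnP
    rw [toReal_dotProduct] at h1
    have h2 := (mem_negPts_slackForm hn4).1 hn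
    have h3 : a ⬝ᵥ latticePoint n ≤ 1 := by exact_mod_cast h1
    omega

lemma volume_mem_of_isReflexive (hP : IsCanonicalSub P) (hr : IsReflexive P pOne) {v : ℕ}
    (hv : volume P * 6 = v) : Even v ∧ 4 ≤ v ∧ v ≤ 50 ∨ v = 54 ∨ v = 56 ∨ v = 64 := by
  obtain ⟨n, hn, h4, hvol⟩ := volume_eq_card_bdryPts hP hr
  have hnv : n = v := by
    rw [hv] at hvol
    exact_mod_cast hvol.symm
  subst hnv
  have h1 := card_bdryPts_add_card_missing hP
  have h2 := card_missing hP hr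
  by_cases h : n ≤ 50
  · exact Or.inl ⟨⟨(bdryPts P).card - 2, by omega⟩, by omega, h⟩
  · right; omega

end Missing

/-! ### Polytopes cut out by integral functionals -/

/-- The determinant of three integral vectors. -/
def det3 (a b c : Fin 3 → ℤ) : ℤ :=
  a 0 * (b 1 * c 2 - b 2 * c 1) + a 1 * (b 2 * c 0 - b 0 * c 2) + a 2 * (b 0 * c 1 - b 1 * c 0)

/-- The functionals of the facets of the tetrahedron, together with `L`. -/
def functionals (L : List (Fin 3 → ℤ)) : List (Fin 3 → ℤ) :=
  [![-1, 0, 0], ![0, -1, 0], ![0, 0, -1], ![1, 1, 1]] ++ L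

/-- The points of the tetrahedron at which all functionals in `L`, relative to `(1,1,1)`, are at
most `1`. -/
def cutPolytope (L : List (Fin 3 → ℤ)) : Set (Fin 3 → ℝ) :=
  {x | ∀ a ∈ functionals L, toReal a ⬝ᵥ (x - pOne) ≤ 1}

/-- The common solution of `a ⬝ᵥ x = b ⬝ᵥ x = c ⬝ᵥ x = 1`, if it is unique, is either integral or
cut off by a functional in `L`. -/
def VertexIntegral (L : List (Fin 3 → ℤ)) (a b c : Fin 3 → ℤ) : Prop :=
  det3 a b c = 0 ∨
    (∃ e ∈ L, 0 < det3 a b c * (det3 e b c + det3 a e c + det3 a b e - det3 a b c)) ∨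
    ∀ i, det3 a b c ∣
      det3 (Pi.single i 1) b c + det3 a (Pi.single i 1) c + det3 a b (Pi.single i 1)

instance (L : List (Fin 3 → ℤ)) (a b c : Fin 3 → ℤ) : Decidable (VertexIntegral L a b c) := by
  unfold VertexIntegral; infer_instance

/-- All vertices of the polytope cut out by `functionals L` are integral. -/
def HasIntegralVertices (L : List (Fin 3 → ℤ)) : Prop :=
  ∀ i j k : Fin (functionals L).length, i < j → j < k →
    VertexIntegral (functionals L) (functionals L)[i] (functionals L)[j] (functionals L)[k]

instance (L : List (Fin 3 → ℤ)) : Decidable (HasIntegralVertices L) := by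
  unfold HasIntegralVertices; infer_instance

/-- Functionals that cut out a reflexive polytope with `n` lattice points. -/
def exampleFunctionals : ℕ → List (Fin 3 → ℤ)
  | 5 => [![1, 1, -3], ![1, -3, 1], ![-3, 1, 1]]
  | 6 => [![1, 2, -4], ![1, 2, 2], ![1, -4, 2]]
  | 7 => [![1, -2, 0], ![1, 2, 4], ![1, 2, -4]]
  | 8 => [![1, 1, -3], ![1, 1, 2], ![1, -4, 2]]
  | 9 => [![2, 3, -6], ![2, 3, 6]]
  | 10 => [![0, 2, 1], ![2, -6, 3], ![2, 4, 3]]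
  | 11 => [![1, -3, 1], ![1, 1, -3]]
  | 12 => [![0, -3, -1], ![-2, 1, 1]]
  | 13 => [![-3, 1, 1], ![1, -1, -1]]
  | 14 => [![1, 1, -2], ![1, -2, 1]]
  | 15 => [![-3, 0, -1], ![2, 0, 1]]
  | 16 => [![1, 0, 2], ![-3, -1, -3]]
  | 17 => [![-1, 2, 0], ![1, -1, 1]]
  | 18 => [![2, -1, 0], ![0, 2, 1]]
  | 19 => [![-2, 0, -1], ![2, 2, 1]]
  | 20 => [![1, 0, 0], ![-3, -1, -3]]
  | 21 => [![-3, 1, 1]]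
  | 22 => [![0, 1, 2], ![2, 1, 2]]
  | 23 => [![-3, -1, 0]]
  | 24 => [![-3, -3, -1]]
  | 25 => [![2, 1, 2], ![1, 0, 0]]
  | 26 => [![-3, -2, -2]]
  | 27 => [![-2, -2, -1]]
  | 28 => [![1, 0, 0], ![1, 1, 0]]
  | 30 => [![-1, -1, 0]]
  | 31 => [![-1, -1, -1]]
  | _ => []

lemma hasIntegralVertices_exampleFunctionals : ∀ n ∈ Finset.Icc 5 28 ∪ {30, 31, 35},
    HasIntegralVertices (exampleFunctionals n) := by
  decide +kernel

lemma card_removed_exampleFunctionals : ∀ n ∈ Finset.Icc 5 28 ∪ {30, 31, 35},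
    (exponents.filter fun m => ∃ a ∈ functionals (exampleFunctionals n),
      1 < a ⬝ᵥ latticePoint m).card + n = 35 := by
  decide +kernel

lemma det3_mul_dotProduct (a b c v : Fin 3 → ℤ) (x : Fin 3 → ℝ) :
    (det3 a b c : ℝ) * toReal v ⬝ᵥ x = det3 v b c * toReal a ⬝ᵥ x + det3 a v c * toReal b ⬝ᵥ x +
      det3 a b v * toReal c ⬝ᵥ x := by
  simp only [det3, dotProduct, Fin.sum_univ_three, toReal_apply]
  push_cast
  ring

lemma det3_ne_zero {a b c : Fin 3 → ℤ}
    (h : LinearIndependent ℝ ![toReal a, toReal b, toReal c]) : det3 a b c ≠ 0 := by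
  have hdet : (Matrix.of ![toReal a, toReal b, toReal c]).det ≠ 0 := by
    rw [← isUnit_iff_ne_zero, ← Matrix.isUnit_iff_isUnit_det]
    exact Matrix.linearIndependent_rows_iff_isUnit.1 h
  intro h0
  apply hdet
  rw [Matrix.det_fin_three]
  have : (det3 a b c : ℝ) = 0 := by exact_mod_cast h0
  rw [← this]
  simp [det3, toReal]
  ring

lemma VertexIntegral.exists_toReal_eq {L : List (Fin 3 → ℤ)} {a b c : Fin 3 → ℤ}
    (h : VertexIntegral L a b c) (h0 : det3 a b c ≠ 0) {x : Fin 3 → ℝ}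
    (hx : ∀ e ∈ L, toReal e ⬝ᵥ x ≤ 1) (ha : toReal a ⬝ᵥ x = 1) (hb : toReal b ⬝ᵥ x = 1)
    (hc : toReal c ⬝ᵥ x = 1) : ∃ v, x = toReal v := by
  have key : ∀ v, (det3 a b c : ℝ) * toReal v ⬝ᵥ x =
      ((det3 v b c + det3 a v c + det3 a b v : ℤ) : ℝ) := fun v => by
    rw [det3_mul_dotProduct, ha, hb, hc]; push_cast; ring
  have h0' : (det3 a b c : ℝ) ≠ 0 := by exact_mod_cast h0
  rcases h with h | ⟨e, he, hlt⟩ | hdvd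
  · exact absurd h h0
  · exfalso
    have hlt' : (0 : ℝ) < det3 a b c *
        (((det3 e b c + det3 a e c + det3 a b e : ℤ) : ℝ) - det3 a b c) := by exact_mod_cast hlt
    rw [← key e] at hlt'
    nlinarith [hx e he, mul_self_nonneg (det3 a b c : ℝ),
      mul_nonneg (mul_self_nonneg (det3 a b c : ℝ)) (sub_nonneg.2 (hx e he))]
  · choose q hq using hdvd
    refine ⟨q, funext fun i => ?_⟩
    have := key (Pi.single i 1)
    have hs : toReal (Pi.single i 1) ⬝ᵥ x = x i := by
      have : toReal (Pi.single i 1) = Pi.single i 1 := by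
        ext j; by_cases hij : j = i
        · subst hij; simp [toReal]
        · simp [toReal, hij]
      rw [this, single_one_dotProduct]
    rw [hq, hs, Int.cast_mul] at this
    exact mul_left_cancel₀ h0' this

lemma HasIntegralVertices.exists_toReal_eq {L : List (Fin 3 → ℤ)} (h : HasIntegralVertices L)
    {a b c : Fin 3 → ℤ} (haL : a ∈ functionals L) (hbL : b ∈ functionals L)
    (hcL : c ∈ functionals L) (h0 : det3 a b c ≠ 0) {x : Fin 3 → ℝ}
    (hx : ∀ e ∈ functionals L, toReal e ⬝ᵥ x ≤ 1) (ha : toReal a ⬝ᵥ x = 1)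
    (hb : toReal b ⬝ᵥ x = 1) (hc : toReal c ⬝ᵥ x = 1) : ∃ v, x = toReal v := by
  obtain ⟨i, hi⟩ := List.get_of_mem haL
  obtain ⟨j, hj⟩ := List.get_of_mem hbL
  obtain ⟨k, hk⟩ := List.get_of_mem hcL
  rw [List.get_eq_getElem] at hi hj hk
  have hij : i ≠ j := by
    rintro rfl; apply h0; rw [← hi, ← hj]; simp only [det3]; ring
  have hik : i ≠ k := by
    rintro rfl; apply h0; rw [← hi, ← hk]; simp only [det3]; ring
  have hjk : j ≠ k := by
    rintro rfl; apply h0; rw [← hj, ← hk]; simp only [det3]; ring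
  have e1 : det3 a c b = -det3 a b c := by simp only [det3]; ring
  have e2 : det3 b a c = -det3 a b c := by simp only [det3]; ring
  have e3 : det3 c b a = -det3 a b c := by simp only [det3]; ring
  have e4 : det3 b c a = det3 a b c := by simp only [det3]; ring
  have e5 : det3 c a b = det3 a b c := by simp only [det3]; ring
  subst hi hj hk
  rcases lt_or_gt_of_ne hij with h1 | h1 <;> rcases lt_or_gt_of_ne hik with h2 | h2 <;>
    rcases lt_or_gt_of_ne hjk with h3 | h3
  · exact (h i j k h1 h3).exists_toReal_eq h0 hx ha hb hc
  · exact (h i k j h2 h3).exists_toReal_eq (e1 ▸ neg_ne_zero.2 h0) hx ha hc hb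
  · exact absurd (h1.trans h3) h2.asymm
  · exact (h k i j h2 h1).exists_toReal_eq (e5 ▸ h0) hx hc ha hb
  · exact (h j i k h1 h2).exists_toReal_eq (e2 ▸ neg_ne_zero.2 h0) hx hb ha hc
  · exact absurd (h2.trans h3) h1.asymm
  · exact (h j k i h3 h2).exists_toReal_eq (e4 ▸ h0) hx hb hc ha
  · exact (h k j i h3 h1).exists_toReal_eq (e3 ▸ neg_ne_zero.2 h0) hx hc hb ha

section CutPolytope

variable {L : List (Fin 3 → ℤ)}

/-- The functionals that cut out the polytope, as vectors in `ℝ³`. -/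
def functionalVec (L : List (Fin 3 → ℤ)) (i : Fin (functionals L).length) : Fin 3 → ℝ :=
  toReal (functionals L)[i]

lemma mem_centered_cutPolytope {x : Fin 3 → ℝ} :
    x ∈ centered (cutPolytope L) ↔ ∀ a ∈ functionals L, toReal a ⬝ᵥ x ≤ 1 := by
  simp only [centered, cutPolytope, mem_ofPred_eq, add_sub_cancel_left]

lemma centered_cutPolytope :
    centered (cutPolytope L) = {x | Feasible (functionalVec L) 1 x} := by
  ext x
  rw [mem_centered_cutPolytope]
  constructor
  · intro h i
    rw [dotProduct_comm]
    exact h _ (List.getElem_mem _)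
  · intro h a ha
    obtain ⟨i, rfl⟩ := List.get_of_mem ha
    rw [dotProduct_comm]
    exact h i

lemma cutPolytope_subset_Delta4 : cutPolytope L ⊆ Delta4 := by
  intro x hx
  have h : ∀ a ∈ functionals [], toReal a ⬝ᵥ (x - pOne) ≤ 1 := fun a ha =>
    hx a (List.mem_append_left _ (by simpa [functionals] using ha))
  simp [functionals, toReal, dotProduct, Fin.sum_univ_three, pOne_apply] at h
  refine mem_Delta4.2 ⟨fun i => ?_, by linarith⟩
  fin_cases i <;> simp <;> linarith

lemma mem_interior_cutPolytope_of_forall_lt {z : Fin 3 → ℝ}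
    (hz : ∀ a ∈ functionals L, toReal a ⬝ᵥ (z - pOne) < 1) : z ∈ interior (cutPolytope L) := by
  rw [mem_interior_iff_mem_nhds]
  have : ∀ᶠ x in nhds z, ∀ a ∈ {a | a ∈ functionals L}, toReal a ⬝ᵥ (x - pOne) ≤ 1 := by
    rw [Filter.eventually_all_finite (List.finite_toSet _)]
    intro a ha
    have hcont : Continuous fun x : Fin 3 → ℝ => toReal a ⬝ᵥ (x - pOne) := by
      unfold dotProduct; fun_prop
    exact (hcont.continuousAt.eventually_lt_const (hz a ha)).mono fun x hx => hx.le
  exact this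

lemma pOne_mem_interior_cutPolytope : pOne ∈ interior (cutPolytope L) :=
  mem_interior_cutPolytope_of_forall_lt fun a _ => by simp

lemma exists_toReal_eq_of_mem_extremePoints (h : HasIntegralVertices L) {e : Fin 3 → ℝ}
    (he : e ∈ extremePoints ℝ {x | Feasible (functionalVec L) 1 x}) : ∃ v, e = toReal v := by
  have hspan := span_tightSet_of_mem_extremePoints he
  obtain ⟨s, hs, hs_span, hli⟩ := exists_linearIndependent ℝ
    (functionalVec L '' tightSet (functionalVec L) 1 e)
  rw [hspan] at hs_span
  have hfin : s.Finite := (Set.toFinite _).subset hs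
  have hcard : s.ncard = 3 := by
    have := hfin.fintype
    have h1 := finrank_span_set_eq_card (R := ℝ) (s := s) hli
    rw [hs_span, finrank_top, Module.finrank_fin_fun] at h1
    rw [Set.ncard_eq_toFinset_card', ← h1]
  obtain ⟨x, y, z, hxy, hxz, hyz, rfl⟩ := Set.ncard_eq_three.1 hcard
  have htight : ∀ w ∈ ({x, y, z} : Set (Fin 3 → ℝ)),
      ∃ a ∈ functionals L, toReal a = w ∧ toReal a ⬝ᵥ e = 1 := fun w hw => by
    obtain ⟨i, hi, rfl⟩ := hs hw
    exact ⟨_, List.getElem_mem _, rfl, by rw [dotProduct_comm]; exact mem_tightSet.1 hi⟩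
  obtain ⟨a, haL, rfl, ha⟩ := htight x (by simp)
  obtain ⟨b, hbL, rfl, hb⟩ := htight y (by simp)
  obtain ⟨c, hcL, rfl, hc⟩ := htight z (by simp)
  have hli3 : LinearIndependent ℝ ![toReal a, toReal b, toReal c] := by
    have := hli.comp (fun l : Fin 3 => ⟨![toReal a, toReal b, toReal c] l, by
      fin_cases l <;> simp⟩) fun l m hlm => ?_
    · exact this
    · have hlm := congrArg Subtype.val hlm
      fin_cases l <;> fin_cases m <;>
      first
      | rfl
      | exact absurd hlm hxy
      | exact absurd hlm hxz
      | exact absurd hlm hyz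
      | exact absurd hlm.symm hxy
      | exact absurd hlm.symm hxz
      | exact absurd hlm.symm hyz
  have heK : e ∈ centered (cutPolytope L) := by rw [centered_cutPolytope]; exact he.1
  exact h.exists_toReal_eq haL hbL hcL (det3_ne_zero hli3) (mem_centered_cutPolytope.1 heK)
    ha hb hc

lemma isBounded_functionalVec (L : List (Fin 3 → ℤ)) :
    Bornology.IsBounded {x | Feasible (functionalVec L) 1 x} := by
  refine (Metric.isBounded_Icc (fun _ => -1 : Fin 3 → ℝ) fun _ => 3).subset fun x hx => ?_
  rw [← centered_cutPolytope] at hx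
  obtain ⟨h, hs⟩ := centered_bounds cutPolytope_subset_Delta4 hx
  have h0 := h 0
  have h1 := h 1
  have h2 := h 2
  refine ⟨h, fun i => ?_⟩
  fin_cases i <;> simp <;> linarith

lemma isCanonicalSub_cutPolytope (h : HasIntegralVertices L) : IsCanonicalSub (cutPolytope L) := by
  refine ⟨⟨cutPolytope_subset_Delta4, ?_⟩, pOne_mem_interior_cutPolytope⟩
  have hcomp : IsCompact {x | Feasible (functionalVec L) 1 x} := by
    simpa using isCompact_feasible (isBounded_functionalVec L) ∅
  have hconv := convex_feasible (functionalVec L) 1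
  have hle : ∀ a ∈ functionals L, Convex ℝ {x : Fin 3 → ℝ | toReal a ⬝ᵥ (x - pOne) ≤ 1} := by
    intro a _ y hy z hz s t hs ht hst
    simp only [mem_ofPred_eq, dotProduct_sub, dotProduct_add, dotProduct_smul, smul_eq_mul] at *
    have hp : toReal a ⬝ᵥ pOne = s * toReal a ⬝ᵥ pOne + t * toReal a ⬝ᵥ pOne := by
      rw [← add_mul, hst, one_mul]
    nlinarith [mul_le_mul_of_nonneg_left hy hs, mul_le_mul_of_nonneg_left hz ht]
  refine Subset.antisymm (fun x hx => ?_) (convexHull_min inter_subset_left ?_)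
  · set H := convexHull ℝ (cutPolytope L ∩ latticePts)
    have hHc : IsClosed {y | pOne + y ∈ H} :=
      ((finite_lattice cutPolytope_subset_Delta4).isClosed_convexHull ℝ).preimage
        (continuous_const.add continuous_id)
    have hHconv : Convex ℝ {y | pOne + y ∈ H} :=
      (convex_convexHull ℝ _).translate_preimage_right pOne
    have hsub : centered (cutPolytope L) ⊆ {y | pOne + y ∈ H} := by
      rw [centered_cutPolytope, ← closure_convexHull_extremePoints hcomp hconv]
      refine closure_minimal (convexHull_min (fun e he => ?_) hHconv) hHc
      obtain ⟨v, rfl⟩ := exists_toReal_eq_of_mem_extremePoints h he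
      have : toReal v ∈ centered (cutPolytope L) := by rw [centered_cutPolytope]; exact he.1
      exact subset_convexHull ℝ _ ⟨this, fun i => ⟨1 + v i, by simp [pOne_apply, toReal]⟩⟩
    have : x - pOne ∈ centered (cutPolytope L) := by simpa [centered] using hx
    simpa using hsub this
  · intro y hy z hz s t hs ht hst a ha
    exact hle a ha (hy a ha) (hz a ha) hs ht hst

lemma isReflexive_cutPolytope : IsReflexive (cutPolytope L) pOne := by
  rintro F ⟨f, b, hf, rfl, hdim⟩
  have hcoord : ∀ x, dotp f x = f ⬝ᵥ x := fun x => rfl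
  obtain ⟨a, haL, ha⟩ : ∃ a ∈ functionals L, ∀ x ∈ cutPolytope L ∩ {x | dotp f x = b},
      toReal a ⬝ᵥ (x - pOne) = 1 := by
    by_contra! hno
    have hslack : ∀ i : Fin (functionals L).length, ∃ x ∈ cutPolytope L ∩ {x | dotp f x = b},
        functionalVec L i ⬝ᵥ (x - pOne) < 1 := fun i => by
      obtain ⟨x, hx, hne⟩ := hno _ (List.getElem_mem i.2)
      exact ⟨x, hx, lt_of_le_of_ne (hx.1 _ (List.getElem_mem i.2)) hne⟩
    choose x hx hlt using hslack
    set n : ℝ := (((functionals L).length : ℕ) : ℝ) with hn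
    have hn0 : 0 < n := by rw [hn]; simp [functionals]; positivity
    have hw : ∑ _i : Fin (functionals L).length, n⁻¹ = 1 := by
      rw [Finset.sum_const, Finset.card_univ, Fintype.card_fin, nsmul_eq_mul,
        mul_inv_cancel₀ hn0.ne']
    set z := ∑ i, n⁻¹ • x i with hz
    have hzb : f ⬝ᵥ z = b := by
      rw [hz, dotProduct_sum, ← one_mul b, ← hw, Finset.sum_mul]
      refine Finset.sum_congr rfl fun i _ => ?_
      rw [dotProduct_smul, smul_eq_mul]
      congr 1
      exact (hx i).2
    have hzlt : ∀ a ∈ functionals L, toReal a ⬝ᵥ (z - pOne) < 1 := by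
      intro a ha
      obtain ⟨j, rfl⟩ := List.get_of_mem ha
      have hzp : z - pOne = ∑ i, n⁻¹ • (x i - pOne) := by
        simp only [smul_sub, Finset.sum_sub_distrib, ← Finset.sum_smul, hw, one_smul, hz]
      rw [hzp, dotProduct_sum, ← hw]
      refine Finset.sum_lt_sum (fun i _ => ?_) ⟨j, Finset.mem_univ _, ?_⟩
      · rw [dotProduct_smul, smul_eq_mul]
        exact mul_le_of_le_one_right (inv_nonneg.2 hn0.le) ((hx i).1 _ ha)
      · rw [dotProduct_smul, smul_eq_mul]
        exact mul_lt_of_lt_one_right (inv_pos.2 hn0) (hlt j)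
    have hint := mem_interior_cutPolytope_of_forall_lt hzlt
    have hf0 : f = 0 := by
      have hc : Continuous fun t : ℝ => z - t • f := by fun_prop
      have hev : ∀ᶠ t : ℝ in nhds 0, z - t • f ∈ cutPolytope L :=
        hc.continuousAt.eventually (by simpa using mem_interior_iff_mem_nhds.1 hint)
      obtain ⟨t, ht, ht0⟩ := ((hev.filter_mono nhdsWithin_le_nhds).and
        (self_mem_nhdsWithin (s := Ioi (0 : ℝ)))).exists
      have h1 := hf _ ht
      rw [hcoord, dotProduct_sub, hzb, dotProduct_smul, smul_eq_mul] at h1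
      have h2 : 0 ≤ f ⬝ᵥ f := Finset.sum_nonneg fun i _ => mul_self_nonneg _
      have h3 : (0 : ℝ) < t := ht0
      exact dotProduct_self_eq_zero.1 (le_antisymm (by nlinarith) h2)
    have hb : b = 0 := by rw [← hzb, hf0, zero_dotProduct]
    have hall : cutPolytope L ∩ {x | dotp f x = b} = cutPolytope L :=
      inter_eq_left.2 fun y _ => by rw [mem_ofPred_eq, hcoord, hf0, hb, zero_dotProduct]
    rw [hall, affineSpan_eq_top_of_nonempty_interior, AffineSubspace.direction_top, finrank_top,
      Module.finrank_fin_fun] at hdim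
    · omega
    · exact ⟨z, interior_mono (subset_convexHull ℝ _) hint⟩
  have hneg : ∀ x, dotp (fun i => ((-a) i : ℝ)) x = -(toReal a ⬝ᵥ x) := fun x => by
    rw [← neg_dotProduct, ← toReal_neg]; rfl
  have hp : toReal a ⬝ᵥ pOne = ((∑ i, a i : ℤ) : ℝ) := by
    simp [dotProduct, toReal, pOne_apply]
  refine ⟨-a, -(∑ i, a i) - 1, fun x hx => ?_, fun x hx => ?_, ?_⟩
  · have := ha x hx
    rw [dotProduct_sub, hp] at this
    rw [hneg]; push_cast at *; linarith
  · have := hx a haL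
    rw [dotProduct_sub, hp] at this
    rw [hneg]; push_cast at *; linarith
  · rw [hneg, hp]; push_cast; ring

lemma missing_cutPolytope : missing (cutPolytope L) =
    exponents.filter fun m => ∃ a ∈ functionals L, 1 < a ⬝ᵥ latticePoint m := by
  classical
  refine Finset.filter_congr fun m _ => ?_
  rw [mem_centered_cutPolytope]
  push Not
  simp only [toReal_dotProduct]
  norm_cast

end CutPolytope

lemma exists_isReflexive_of_card {n v : ℕ} (hn : n ∈ Finset.Icc 5 28 ∪ {30, 31, 35})
    (hv : v + 6 = 2 * n) : ∃ P : Set (Fin 3 → ℝ), IsCanonicalSub P ∧ IsReflexive P pOne ∧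
      volume P * 6 = (v : ENNReal) := by
  have hcan := isCanonicalSub_cutPolytope (hasIntegralVertices_exampleFunctionals n hn)
  obtain ⟨k, hk, -, hvol⟩ := volume_eq_card_bdryPts hcan isReflexive_cutPolytope
  have h1 := card_bdryPts_add_card_missing hcan
  rw [missing_cutPolytope] at h1
  have h2 := card_removed_exampleFunctionals n hn
  have hkv : k = v := by omega
  exact ⟨_, hcan, isReflexive_cutPolytope, hkv ▸ hvol⟩

theorem stmt2 :
    {v : ℕ | ∃ P : Set (Fin 3 → ℝ), IsCanonicalSub P ∧ IsReflexive P pOne ∧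
        volume P * 6 = (v : ENNReal)} =
      {v : ℕ | Even v ∧ 4 ≤ v ∧ v ≤ 50} ∪ {54, 56, 64} := by
  ext v
  constructor
  · rintro ⟨P, hP, hr, hv⟩
    have := volume_mem_of_isReflexive hP hr hv
    simp only [mem_union, mem_ofPred_eq, mem_insert_iff, mem_singleton_iff] at this ⊢
    exact this
  · intro hv
    have hv' : Even v ∧ 4 ≤ v ∧ v ≤ 50 ∨ v = 54 ∨ v = 56 ∨ v = 64 := hv
    have heven : Even v := by
      rcases hv' with h | rfl | rfl | rfl
      · exact h.1
      all_goals decide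
    obtain ⟨k, hk⟩ := heven
    refine exists_isReflexive_of_card (n := k + 3) ?_ (by omega)
    simp only [Finset.mem_union, Finset.mem_Icc, Finset.mem_insert, Finset.mem_singleton]
    omega
end
end

section
/- A 3-dimensional canonical lattice polytope P (with unique interior lattice point p) is reflexive if and only if every central fine triangulation of P is unimodular. -/
open Set MeasureTheory

noncomputable section

/-- `T` is a triangulation of `P`: a finite collection of simplices (given by their
vertex sets, which are affinely independent sets of lattice points of `P`) whose union
is `P`, closed under taking faces, any two meeting in a common face. -/
def IsTriangulationOf (P : Set (Fin 3 → ℝ)) (T : Set (Finset (Fin 3 → ℝ))) : Prop :=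
  T.Finite ∧
  (∀ S ∈ T, (S : Set (Fin 3 → ℝ)) ⊆ P ∩ latticePts ∧
    AffineIndependent ℝ (fun v : (S : Set (Fin 3 → ℝ)) => (v : Fin 3 → ℝ))) ∧
  (⋃ S ∈ T, convexHull ℝ (S : Set (Fin 3 → ℝ))) = P ∧
  (∀ S ∈ T, ∀ S' : Finset (Fin 3 → ℝ), S' ⊆ S → S' ∈ T) ∧
  (∀ S ∈ T, ∀ S' ∈ T, ∃ F : Finset (Fin 3 → ℝ), F ∈ T ∧ F ⊆ S ∧ F ⊆ S' ∧
    convexHull ℝ (S : Set (Fin 3 → ℝ)) ∩ convexHull ℝ (S' : Set (Fin 3 → ℝ)) =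
      convexHull ℝ (F : Set (Fin 3 → ℝ)))

/-- `T` is central: every `3`-simplex of `T` contains `p`. -/
def IsCentral (p : Fin 3 → ℝ) (T : Set (Finset (Fin 3 → ℝ))) : Prop :=
  ∀ S ∈ T, S.card = 4 → p ∈ convexHull ℝ (S : Set (Fin 3 → ℝ))

/-- `T` is unimodular: every `3`-simplex of `T` has Euclidean volume `1/6`. -/
def IsUnimodular (T : Set (Finset (Fin 3 → ℝ))) : Prop :=
  ∀ S ∈ T, S.card = 4 →
    volume (convexHull ℝ (S : Set (Fin 3 → ℝ))) = ENNReal.ofReal (1 / 6)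

/-- `T` is fine: every lattice point of `P` is a vertex of a simplex of `T`. -/
def IsFine (P : Set (Fin 3 → ℝ)) (T : Set (Finset (Fin 3 → ℝ))) : Prop :=
  ∀ x ∈ P ∩ latticePts, ∃ S ∈ T, x ∈ S

/-- The weight function `w` induces the triangulation `T` of `P`
(it is a regularity certificate for `T`). -/
def Induces (P : Set (Fin 3 → ℝ)) (T : Set (Finset (Fin 3 → ℝ))) (w : (Fin 3 → ℝ) → ℝ) :
    Prop :=
  ∀ S ∈ T, S.card = 4 → ∃ ℓ : (Fin 3 → ℝ) →ᵃ[ℝ] ℝ,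
    (∀ v ∈ S, ℓ v = w v) ∧ ∀ v ∈ P ∩ latticePts, v ∉ S → ℓ v < w v

/-- `T` is a regular triangulation of `P`. -/
def IsRegularTriang (P : Set (Fin 3 → ℝ)) (T : Set (Finset (Fin 3 → ℝ))) : Prop :=
  ∃ w : (Fin 3 → ℝ) → ℝ, Induces P T w

/-- A canonical lattice polytope in `ℝ³` with interior lattice point `p`:
a lattice polytope whose interior contains exactly one lattice point, namely `p`
(in particular it is `3`-dimensional). -/
def IsCanonicalPoly (P : Set (Fin 3 → ℝ)) (p : Fin 3 → ℝ) : Prop :=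
  (∃ F : Set (Fin 3 → ℝ), F.Finite ∧ F ⊆ latticePts ∧ P = convexHull ℝ F) ∧
  p ∈ latticePts ∧ interior P ∩ latticePts = {p}

section LiftedTriangulation

variable {E : Type*} [NormedAddCommGroup E] [NormedSpace ℝ E]

/-- A weight is generic on `B` if every subset of `B` on which it is affine is affinely
independent. -/
def IsGenericWeight (w : E → ℝ) (B : Finset E) : Prop :=
  ∀ S ⊆ B, ∀ ℓ : E →ᵃ[ℝ] ℝ, (∀ v ∈ S, ℓ v = w v) →
    AffineIndependent ℝ (fun v : (S : Set E) => (v : E))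

/-- The values at `a` forced by affine interpolation of `w` on subsets of `B` whose affine span
contains `a`. -/
def forcedValues (w : E → ℝ) (B : Finset E) (a : E) : Set ℝ :=
  {y | ∃ S ⊆ B, a ∈ affineSpan ℝ (S : Set E) ∧
    ∃ ℓ : E →ᵃ[ℝ] ℝ, (∀ v ∈ S, ℓ v = w v) ∧ ℓ a = y}

lemma forcedValues_finite (w : E → ℝ) (B : Finset E) (a : E) : (forcedValues w B a).Finite := by
  have h : forcedValues w B a ⊆ ⋃ S ∈ (B.powerset : Set (Finset E)),
      {y | a ∈ affineSpan ℝ (S : Set E) ∧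
        ∃ ℓ : E →ᵃ[ℝ] ℝ, (∀ v ∈ S, ℓ v = w v) ∧ ℓ a = y} := by
    rintro y ⟨S, hS, h⟩
    simp only [mem_iUnion]
    exact ⟨S, by simpa using hS, h⟩
  refine ((B.powerset.finite_toSet).biUnion fun S _ => Set.Subsingleton.finite ?_).subset h
  rintro _ ⟨ha, ℓ, hℓ, rfl⟩ _ ⟨-, ℓ', hℓ', rfl⟩
  exact AffineMap.eqOn_affineSpan (s := (S : Set E))
    (fun v hv => (hℓ v hv).trans (hℓ' v hv).symm) ha

lemma IsGenericWeight.congr {w w' : E → ℝ} {B : Finset E} (h : IsGenericWeight w B)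
    (hw : ∀ v ∈ B, w v = w' v) : IsGenericWeight w' B :=
  fun S hS ℓ hℓ => h S hS ℓ fun v hv => (hℓ v hv).trans (hw v (hS hv)).symm

lemma forcedValues_congr {w w' : E → ℝ} {B : Finset E} (a : E)
    (hw : ∀ v ∈ B, w v = w' v) : forcedValues w B a = forcedValues w' B a := by
  ext y
  constructor
  · rintro ⟨S, hS, ha, ℓ, hℓ, hy⟩
    exact ⟨S, hS, ha, ℓ, fun v hv => (hℓ v hv).trans (hw v (hS hv)), hy⟩
  · rintro ⟨S, hS, ha, ℓ, hℓ, hy⟩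
    exact ⟨S, hS, ha, ℓ, fun v hv => (hℓ v hv).trans (hw v (hS hv)).symm, hy⟩

lemma affineIndependent_of_erase [DecidableEq E] {S : Finset E} {a : E} (ha : a ∈ S)
    (h : AffineIndependent ℝ (fun v : ((S.erase a : Finset E) : Set E) => (v : E)))
    (hspan : a ∉ affineSpan ℝ ((S.erase a : Finset E) : Set E)) :
    AffineIndependent ℝ (fun v : (S : Set E) => (v : E)) := by
  refine AffineIndependent.affineIndependent_of_notMem_span (i := ⟨a, ha⟩) ?_ ?_
  · let e : {y : (S : Set E) // y ≠ ⟨a, ha⟩} ↪ ((S.erase a : Finset E) : Set E) :=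
      ⟨fun y => ⟨y.1.1, by
        have h1 := y.2
        have h2 := y.1.2
        simp only [Finset.coe_erase, Set.mem_sdiff, Set.mem_singleton_iff]
        exact ⟨h2, fun h3 => h1 (Subtype.ext h3)⟩⟩, by
        intro y z hyz
        simp only [Subtype.mk.injEq] at hyz
        exact Subtype.ext (Subtype.ext hyz)⟩
    exact h.comp_embedding e
  · refine fun hmem => hspan (affineSpan_mono ℝ ?_ hmem)
    rintro _ ⟨⟨y, hy⟩, hne, rfl⟩
    simp only [Finset.coe_erase, Set.mem_sdiff, Set.mem_singleton_iff]
    exact ⟨hy, fun h3 => hne (Subtype.ext h3)⟩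

lemma IsGenericWeight.insert [DecidableEq E] {w : E → ℝ} {B : Finset E}
    (h : IsGenericWeight w B) {a : E}
    (ha : w a ∉ forcedValues w B a) : IsGenericWeight w (insert a B) := by
  intro S hS ℓ hℓ
  by_cases haS : a ∈ S
  · have hsub : S.erase a ⊆ B := by
      intro v hv
      rw [Finset.mem_erase] at hv
      exact (Finset.mem_insert.1 (hS hv.2)).resolve_left hv.1
    refine affineIndependent_of_erase haS
      (h _ hsub ℓ fun v hv => hℓ v (Finset.mem_of_mem_erase hv)) fun hspan => ha ?_
    exact ⟨S.erase a, hsub, hspan, ℓ, fun v hv => hℓ v (Finset.mem_of_mem_erase hv), hℓ a haS⟩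
  · refine h S (fun v hv => (Finset.mem_insert.1 (hS hv)).resolve_left ?_) ℓ hℓ
    rintro rfl
    exact haS hv

lemma exists_isGenericWeight (B : Finset E) (f : E → ℝ) :
    ∃ w, IsGenericWeight w B ∧ ∀ v ∈ B, |w v - f v| < 1 / 2 := by
  classical
  induction B using Finset.induction_on with
  | empty =>
    refine ⟨f, fun S hS ℓ _ => ?_, by simp⟩
    rw [Finset.subset_empty] at hS
    subst hS
    have : Subsingleton ((∅ : Finset E) : Set E) := by simp
    exact affineIndependent_of_subsingleton ℝ _
  | insert a B haB ih =>
    obtain ⟨w, hw, hwf⟩ := ih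
    obtain ⟨y, hy, hbad⟩ := ((Set.Ioo_infinite (show f a - 1 / 2 < f a + 1 / 2 by linarith)).sdiff
      (forcedValues_finite w B a)).nonempty
    have hag : ∀ v ∈ B, w v = Function.update w a y v := by
      intro v hv
      rw [Function.update_of_ne]
      rintro rfl
      exact haB hv
    refine ⟨Function.update w a y, (hw.congr hag).insert ?_, ?_⟩
    · rw [← forcedValues_congr a hag, Function.update_self]
      exact hbad
    · intro v hv
      rcases Finset.mem_insert.1 hv with rfl | hv
      · rw [Function.update_self, abs_lt]
        constructor <;> linarith [hy.1, hy.2]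
      · rw [← hag v hv]
        exact hwf v hv

/-- The projections to `E` of the lower faces of the lifted configuration `(a, w a)`, `a ∈ A`. -/
def lowerFaces (A : Finset E) (w : E → ℝ) : Set (Finset E) :=
  {S | S ⊆ A ∧ ∃ ℓ : E →ᵃ[ℝ] ℝ, (∀ v ∈ S, ℓ v = w v) ∧ ∀ v ∈ A, v ∉ S → ℓ v < w v}

lemma lowerFaces_finite (A : Finset E) (w : E → ℝ) : (lowerFaces A w).Finite :=
  A.powerset.finite_toSet.subset fun S hS => by simpa using hS.1

/-- A strict inequality on a finite set survives small perturbations. -/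
lemma exists_pos_forall_add_mul_lt {α : Type*} (A : Finset α) (p : α → Prop) (f g h : α → ℝ)
    (hfg : ∀ v ∈ A, p v → f v < h v) :
    ∃ ε : ℝ, 0 < ε ∧ ∀ v ∈ A, p v → f v + ε * g v < h v := by
  have key : ∀ᶠ ε : ℝ in nhdsWithin 0 (Ioi 0), ∀ v ∈ A, p v → f v + ε * g v < h v := by
    rw [Filter.eventually_all_finset]
    intro v hv
    by_cases hp : p v
    · have hc : Continuous fun ε : ℝ => f v + ε * g v := by fun_prop
      have h1 : ∀ᶠ ε : ℝ in nhds 0, f v + ε * g v < h v :=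
        hc.continuousAt.eventually_lt continuousAt_const (by simpa using hfg v hv hp)
      exact (h1.filter_mono nhdsWithin_le_nhds).mono fun ε hε _ => hε
    · exact Filter.Eventually.of_forall fun ε hp' => absurd hp' hp
  obtain ⟨ε, hε, hε0⟩ := (key.and self_mem_nhdsWithin).exists
  exact ⟨ε, hε0, hε⟩

lemma exists_affineMap_eq_indicator {S S' : Finset E}
    (h : AffineIndependent ℝ (fun v : (S : Set E) => (v : E))) :
    ∃ g : E →ᵃ[ℝ] ℝ, (∀ v ∈ S, v ∈ S' → g v = 0) ∧ ∀ v ∈ S, v ∉ S' → g v < 0 := by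
  classical
  obtain ⟨t, hst, hind, htop⟩ := exists_subset_affineIndependent_affineSpan_eq_top h
  let b : AffineBasis t ℝ E := ⟨((↑) : t → E), hind, by simpa using htop⟩
  let c : E → E →ᵃ[ℝ] ℝ := fun v => if hv : v ∈ t then b.coord ⟨v, hv⟩ else 0
  have hb : ∀ v (hv : v ∈ t), b ⟨v, hv⟩ = v := fun v hv => rfl
  have hc : ∀ u ∈ S, ∀ v ∈ S, c u v = if u = v then 1 else 0 := by
    intro u hu v hv
    have h1 : c u = b.coord ⟨u, hst hu⟩ := dif_pos (hst hu)
    conv_lhs => rw [h1, ← hb v (hst hv), b.coord_apply]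
    simp
  have hsum : ∀ v, (-∑ u ∈ S \ S', c u : E →ᵃ[ℝ] ℝ) v = -∑ u ∈ S \ S', c u v := by
    intro v
    have : ∀ F : Finset E, (∑ u ∈ F, c u : E →ᵃ[ℝ] ℝ) v = ∑ u ∈ F, c u v := by
      intro F
      induction F using Finset.induction_on with
      | empty => simp
      | insert a F ha ih => simp [Finset.sum_insert ha, ih]
    simp [this]
  refine ⟨-∑ u ∈ S \ S', c u, fun v hv hv' => ?_, fun v hv hv' => ?_⟩
  · rw [hsum, neg_eq_zero]
    refine Finset.sum_eq_zero fun u hu => ?_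
    rw [Finset.mem_sdiff] at hu
    rw [hc u hu.1 v hv, if_neg]
    rintro rfl
    exact hu.2 hv'
  · rw [hsum, Finset.sum_eq_single_of_mem v (by simp [hv, hv'])]
    · simp [hc v hv v hv]
    · intro u hu hne
      rw [Finset.mem_sdiff] at hu
      rw [hc u hu.1 v hv, if_neg hne]

lemma mem_lowerFaces_of_subset {A : Finset E} {w : E → ℝ} (hw : IsGenericWeight w A)
    {S S' : Finset E} (hS : S ∈ lowerFaces A w) (hS' : S' ⊆ S) : S' ∈ lowerFaces A w := by
  obtain ⟨hSA, ℓ, hℓ, hlt⟩ := hS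
  obtain ⟨g, hg0, hg⟩ := exists_affineMap_eq_indicator (S' := S') (hw S hSA ℓ hℓ)
  obtain ⟨ε, hε, h⟩ := exists_pos_forall_add_mul_lt A (fun v => v ∉ S) ℓ g w hlt
  refine ⟨hS'.trans hSA, ℓ + ε • g, fun v hv => ?_, fun v hv hvS' => ?_⟩
  · simp [hℓ v (hS' hv), hg0 v (hS' hv) hv]
  · by_cases hvS : v ∈ S
    · have := mul_neg_of_pos_of_neg hε (hg v hvS hvS')
      simp only [AffineMap.coe_add, AffineMap.coe_smul, Pi.add_apply, Pi.smul_apply, smul_eq_mul,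
        hℓ v hvS]
      linarith
    · simpa using h v hv hvS

lemma inter_mem_lowerFaces [DecidableEq E] {A : Finset E} {w : E → ℝ} {S S' : Finset E}
    (hS : S ∈ lowerFaces A w) (hS' : S' ∈ lowerFaces A w) : S ∩ S' ∈ lowerFaces A w := by
  obtain ⟨hSA, ℓ, hℓ, hlt⟩ := hS
  obtain ⟨hSA', ℓ', hℓ', hlt'⟩ := hS'
  have hle : ∀ v ∈ A, ℓ v ≤ w v := fun v hv => by
    by_cases h : v ∈ S
    exacts [(hℓ v h).le, (hlt v hv h).le]
  have hle' : ∀ v ∈ A, ℓ' v ≤ w v := fun v hv => by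
    by_cases h : v ∈ S'
    exacts [(hℓ' v h).le, (hlt' v hv h).le]
  refine ⟨Finset.inter_subset_left.trans hSA, (1 / 2 : ℝ) • (ℓ + ℓ'), fun v hv => ?_,
    fun v hv hvn => ?_⟩
  · rw [Finset.mem_inter] at hv
    simp only [AffineMap.coe_add, AffineMap.coe_smul, Pi.add_apply, Pi.smul_apply, smul_eq_mul,
      hℓ v hv.1, hℓ' v hv.2]
    ring
  · simp only [AffineMap.coe_add, AffineMap.coe_smul, Pi.add_apply, Pi.smul_apply, smul_eq_mul]
    by_cases h : v ∈ S
    · have h' : v ∉ S' := fun h' => hvn (Finset.mem_inter.2 ⟨h, h'⟩)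
      linarith [hle v hv, hlt' v hv h']
    · linarith [hle' v hv, hlt v hv h]

lemma affineMap_sum_smul {ι : Type*} (ℓ : E →ᵃ[ℝ] ℝ) (S : Finset ι) (c : ι → ℝ) (v : ι → E)
    (hc : ∑ i ∈ S, c i = 1) : ℓ (∑ i ∈ S, c i • v i) = ∑ i ∈ S, c i * ℓ (v i) := by
  have h : ∀ x, ℓ x = ℓ.linear x + ℓ 0 := fun x => congrFun ℓ.decomp x
  rw [h, map_sum]
  simp only [map_smul, smul_eq_mul, h (v _), mul_add, Finset.sum_add_distrib, ← Finset.sum_mul, hc]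
  ring

lemma lowerFaces_convexHull_inter [DecidableEq E] {A : Finset E} {w : E → ℝ} {S S' : Finset E}
    (hS : S ∈ lowerFaces A w) (hS' : S' ∈ lowerFaces A w) :
    convexHull ℝ (S : Set E) ∩ convexHull ℝ (S' : Set E) =
      convexHull ℝ ((S ∩ S' : Finset E) : Set E) := by
  refine Subset.antisymm ?_ (subset_inter (convexHull_mono (by simp)) (convexHull_mono (by simp)))
  obtain ⟨hSA, ℓ, hℓ, hlt⟩ := hS
  obtain ⟨hSA', ℓ', hℓ', hlt'⟩ := hS'
  have hle : ∀ v ∈ A, ℓ v ≤ w v := fun v hv => by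
    by_cases h : v ∈ S
    exacts [(hℓ v h).le, (hlt v hv h).le]
  have hle' : ∀ v ∈ A, ℓ' v ≤ w v := fun v hv => by
    by_cases h : v ∈ S'
    exacts [(hℓ' v h).le, (hlt' v hv h).le]
  rintro x ⟨hx, hx'⟩
  rw [Finset.mem_convexHull'] at hx hx'
  obtain ⟨c, hc0, hc1, hcx⟩ := hx
  obtain ⟨c', hc0', hc1', hcx'⟩ := hx'
  have e1 : ℓ x = ∑ v ∈ S, c v * w v := by
    rw [← hcx, affineMap_sum_smul _ _ _ _ hc1]
    exact Finset.sum_congr rfl fun v hv => by rw [hℓ v hv]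
  have e2 : ℓ' x = ∑ v ∈ S, c v * ℓ' v := by
    rw [← hcx, affineMap_sum_smul _ _ _ _ hc1]
  have e3 : ℓ' x = ∑ v ∈ S', c' v * w v := by
    rw [← hcx', affineMap_sum_smul _ _ _ _ hc1']
    exact Finset.sum_congr rfl fun v hv => by rw [hℓ' v hv]
  have e4 : ℓ x = ∑ v ∈ S', c' v * ℓ v := by
    rw [← hcx', affineMap_sum_smul _ _ _ _ hc1']
  have h1 : ℓ x ≤ ℓ' x := by
    rw [e4, e3]
    exact Finset.sum_le_sum fun v hv => mul_le_mul_of_nonneg_left (hle v (hSA' hv)) (hc0' v hv)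
  have h2 : ∀ v ∈ S, c v * ℓ' v ≤ c v * w v := fun v hv =>
    mul_le_mul_of_nonneg_left (hle' v (hSA hv)) (hc0 v hv)
  have h3 : ∑ v ∈ S, c v * ℓ' v = ∑ v ∈ S, c v * w v :=
    le_antisymm (Finset.sum_le_sum h2) (by rw [← e1, ← e2]; exact h1)
  have h4 := (Finset.sum_eq_sum_iff_of_le h2).1 h3
  have h5 : ∀ v ∈ S, v ∉ S ∩ S' → c v = 0 := by
    intro v hv hvn
    have hvS' : v ∉ S' := fun h => hvn (Finset.mem_inter.2 ⟨hv, h⟩)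
    have := hlt' v (hSA hv) hvS'
    by_contra hne
    exact this.ne (mul_left_cancel₀ hne (h4 v hv))
  rw [Finset.mem_convexHull']
  refine ⟨c, fun v hv => hc0 v (Finset.mem_inter.1 hv).1, ?_, ?_⟩
  · rw [← hc1]
    exact Finset.sum_subset Finset.inter_subset_left h5
  · rw [← hcx]
    exact Finset.sum_subset Finset.inter_subset_left fun v hv hvn => by simp [h5 v hv hvn]

lemma interior_convexHull_subset_lowerFaces [FiniteDimensional ℝ E] (A : Finset E) (w : E → ℝ) :
    interior (convexHull ℝ (A : Set E)) ⊆
      ⋃ S ∈ lowerFaces A w, convexHull ℝ (S : Set E) := by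
  classical
  intro x hx
  have hA : A.Nonempty := by
    rw [Finset.nonempty_iff_ne_empty]
    rintro rfl
    simp at hx
  obtain ⟨c, hc⟩ : ∃ c, ∀ a ∈ A, c ≤ w a :=
    ⟨A.inf' hA w, fun a ha => Finset.inf'_le w ha⟩
  obtain ⟨M, hM⟩ : ∃ M, ∀ a ∈ A, w a ≤ M :=
    ⟨A.sup' hA w, fun a ha => Finset.le_sup' w ha⟩
  obtain ⟨r, hr, hball⟩ := Metric.nhds_basis_closedBall.mem_iff.1 (mem_interior_iff_mem_nhds.1 hx)
  let K : Set (ℝ × StrongDual ℝ E) := {q | c ≤ q.1 ∧ ∀ a ∈ A, q.1 + q.2 (a - x) ≤ w a}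
  have hKc : IsClosed K := by
    have : K = {q | c ≤ q.1} ∩ ⋂ a ∈ A, {q | q.1 + q.2 (a - x) ≤ w a} := by
      ext q
      simp [K]
    rw [this]
    refine (isClosed_le continuous_const continuous_fst).inter
      (isClosed_biInter fun a _ => isClosed_le (by fun_prop) continuous_const)
  have hup : ∀ q ∈ K, ∀ y ∈ convexHull ℝ (A : Set E), q.1 + q.2 (y - x) ≤ M := by
    intro q hq y hy
    have hconv : Convex ℝ {y | q.2 y ≤ M - q.1 + q.2 x} :=
      convex_halfSpace_le q.2.isLinear _
    have := convexHull_min (s := (A : Set E)) (fun a ha => ?_) hconv hy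
    · simp only [mem_ofPred_eq] at this
      rw [map_sub]
      linarith
    · have h1 := hq.2 a ha
      have h2 := hM a ha
      rw [map_sub] at h1
      simp only [mem_ofPred_eq]
      linarith
  have hKb : Bornology.IsBounded K := by
    refine (isBounded_iff_forall_norm_le).2 ⟨max (max |c| |M|) ((M - c) / r), fun q hq => ?_⟩
    rw [Prod.norm_def]
    refine max_le_max ?_ ?_
    · have := hup q hq x (interior_subset hx)
      simp only [sub_self, map_zero, add_zero] at this
      exact abs_le_max_abs_abs hq.1 this
    · refine ContinuousLinearMap.opNorm_bound_of_ball_bound hr _ _ fun z hz => ?_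
      have hz' : ‖z‖ ≤ r := by simpa using hz
      have h1 := hup q hq (x + z) (hball (by simpa using hz'))
      have h2 := hup q hq (x - z) (hball (by simpa [dist_eq_norm] using hz'))
      have h3 := hq.1
      simp only [add_sub_cancel_left, sub_sub_cancel_left, map_neg] at h1 h2
      rw [Real.norm_eq_abs, abs_le]
      constructor <;> linarith
  have hKne : K.Nonempty := ⟨(c, 0), le_rfl, fun a ha => by simpa using hc a ha⟩
  obtain ⟨q, hqK, hqmax⟩ := (Metric.isCompact_of_isClosed_isBounded hKc hKb).exists_isMaxOn hKne
    continuous_fst.continuousOn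
  let ℓ : E →ᵃ[ℝ] ℝ := (q.2 : E →ₗ[ℝ] ℝ).toAffineMap + AffineMap.const ℝ E (q.1 - q.2 x)
  have hℓ : ∀ y, ℓ y = q.1 + q.2 (y - x) := by
    intro y
    simp [ℓ]
    ring
  let S := A.filter fun a => ℓ a = w a
  have hlt : ∀ v ∈ A, v ∉ S → q.1 + q.2 (v - x) < w v := by
    intro v hv hvS
    refine lt_of_le_of_ne (hqK.2 v hv) fun h => hvS ?_
    rw [Finset.mem_filter, hℓ]
    exact ⟨hv, h⟩
  refine mem_biUnion (x := S) ⟨Finset.filter_subset _ _, ℓ, ?_, ?_⟩ ?_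
  · intro v hv
    exact (Finset.mem_filter.1 hv).2
  · intro v hv hvS
    rw [hℓ]
    exact hlt v hv hvS
  by_contra hxS
  obtain ⟨f, u, hfu, hux⟩ := geometric_hahn_banach_closed_point (convex_convexHull ℝ (S : Set E))
    (S.finite_toSet.isCompact_convexHull (𝕜 := ℝ)).isClosed hxS
  obtain ⟨ε, hε, h⟩ := exists_pos_forall_add_mul_lt A (fun v => v ∉ S)
    (fun v => q.1 + q.2 (v - x)) (fun v => f v - u) w hlt
  have hmem : (q.1 + ε * (f x - u), q.2 + ε • f) ∈ K := by
    have hpos : 0 < ε * (f x - u) := mul_pos hε (by linarith)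
    refine ⟨by have := hqK.1; simp only; linarith, fun a ha => ?_⟩
    have e : q.1 + ε * (f x - u) + (q.2 + ε • f) (a - x)
        = q.1 + q.2 (a - x) + ε * (f a - u) := by
      simp [map_sub]
      ring
    simp only
    rw [e]
    by_cases haS : a ∈ S
    · have h1 := hfu a (subset_convexHull ℝ _ haS)
      have h2 : ε * (f a - u) < 0 := mul_neg_of_pos_of_neg hε (by linarith)
      linarith [hqK.2 a ha]
    · exact (h a ha haS).le
  have := hqmax hmem
  simp only [mem_ofPred_eq] at this
  nlinarith

lemma biUnion_lowerFaces_eq [FiniteDimensional ℝ E] (A : Finset E) (w : E → ℝ)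
    (hA : (interior (convexHull ℝ (A : Set E))).Nonempty) :
    ⋃ S ∈ lowerFaces A w, convexHull ℝ (S : Set E) = convexHull ℝ (A : Set E) := by
  refine Subset.antisymm (iUnion₂_subset fun S hS => convexHull_mono (by simpa using hS.1)) ?_
  have hclosed : IsClosed (⋃ S ∈ lowerFaces A w, convexHull ℝ (S : Set E)) :=
    (lowerFaces_finite A w).isClosed_biUnion fun S _ =>
      (S.finite_toSet.isCompact_convexHull (𝕜 := ℝ)).isClosed
  have h := closure_minimal (interior_convexHull_subset_lowerFaces A w) hclosed
  rw [(convex_convexHull ℝ _).closure_interior_eq_closure_of_nonempty_interior hA] at h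
  exact subset_closure.trans h

end LiftedTriangulation

section Existence

/-- `dotp a` as a linear map. -/
def dotpLin {n : ℕ} (a : Fin n → ℝ) : (Fin n → ℝ) →ₗ[ℝ] ℝ where
  toFun := dotp a
  map_add' x y := by simp [dotp, mul_add, Finset.sum_add_distrib]
  map_smul' c x := by
    simp only [dotp, Pi.smul_apply, smul_eq_mul, RingHom.id_apply, Finset.mul_sum]
    exact Finset.sum_congr rfl fun i _ => by ring

@[simp] lemma dotpLin_apply {n : ℕ} (a x : Fin n → ℝ) : dotpLin a x = dotp a x := rfl

lemma mem_latticePts_iff {x : Fin 3 → ℝ} :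
    x ∈ latticePts ↔ ∃ z : Fin 3 → ℤ, x = fun i => (z i : ℝ) := by
  constructor
  · intro h
    choose z hz using h
    exact ⟨z, funext hz⟩
  · rintro ⟨z, rfl⟩ i
    exact ⟨z i, rfl⟩

lemma finite_inter_latticePts {K : Set (Fin 3 → ℝ)} (hK : Bornology.IsBounded K) :
    (K ∩ latticePts).Finite := by
  obtain ⟨R, hR⟩ := isBounded_iff_forall_norm_le.1 hK
  obtain ⟨N, hN⟩ := exists_nat_ge R
  refine ((Set.finite_Icc (fun _ : Fin 3 => -(N : ℤ)) (fun _ => (N : ℤ))).image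
    (fun z i => (z i : ℝ))).subset ?_
  rintro x ⟨hx, hxl⟩
  obtain ⟨z, rfl⟩ := mem_latticePts_iff.1 hxl
  have h : ∀ i, |(z i : ℝ)| ≤ N := fun i =>
    (norm_le_pi_norm (fun i => (z i : ℝ)) i).trans ((hR _ hx).trans hN)
  refine ⟨z, ⟨fun i => ?_, fun i => ?_⟩, rfl⟩
  · have := (abs_le.1 (h i)).1
    exact_mod_cast this
  · have := (abs_le.1 (h i)).2
    exact_mod_cast this

lemma one_le_dotp_sub_self {x y : Fin 3 → ℝ} (hx : x ∈ latticePts) (hy : y ∈ latticePts)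
    (hne : x ≠ y) : 1 ≤ dotp (x - y) (x - y) := by
  obtain ⟨a, rfl⟩ := mem_latticePts_iff.1 hx
  obtain ⟨b, rfl⟩ := mem_latticePts_iff.1 hy
  obtain ⟨i, hi⟩ : ∃ i, a i ≠ b i := by
    by_contra! h
    exact hne (by ext i; simp [h i])
  have h1 : (1 : ℤ) ≤ (a i - b i) * (a i - b i) := by
    have : a i - b i ≠ 0 := sub_ne_zero.2 hi
    have := mul_self_pos.2 this
    omega
  have h2 : (1 : ℝ) ≤ ((a i : ℝ) - b i) * (a i - b i) := by exact_mod_cast h1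
  refine h2.trans ?_
  unfold dotp
  exact Finset.single_le_sum (f := fun i => ((a i : ℝ) - b i) * (a i - b i))
    (fun j _ => mul_self_nonneg _) (Finset.mem_univ i)

lemma exists_supporting_functional {E : Type*} [NormedAddCommGroup E] [NormedSpace ℝ E]
    {P : Set E} (hP : Convex ℝ P) (hne : (interior P).Nonempty) {x : E} (hx : x ∉ interior P) :
    ∃ f : StrongDual ℝ E, (∀ y ∈ P, f x ≤ f y) ∧ ∀ y ∈ interior P, f x < f y := by
  obtain ⟨f, hf⟩ := geometric_hahn_banach_point_open hP.interior isOpen_interior hx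
  refine ⟨f, fun y hy => ?_, hf⟩
  have h : closure (interior P) ⊆ {y | f x ≤ f y} :=
    closure_minimal (fun y hy => (hf y hy).le) (isClosed_le continuous_const f.continuous)
  rw [hP.closure_interior_eq_closure_of_nonempty_interior hne] at h
  exact h (subset_closure hy)

lemma IsCanonicalPoly.convex {P : Set (Fin 3 → ℝ)} {p : Fin 3 → ℝ} (hP : IsCanonicalPoly P p) :
    Convex ℝ P := by
  obtain ⟨⟨F, -, -, rfl⟩, -, -⟩ := hP
  exact convex_convexHull ℝ F

lemma IsCanonicalPoly.isCompact {P : Set (Fin 3 → ℝ)} {p : Fin 3 → ℝ}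
    (hP : IsCanonicalPoly P p) : IsCompact P := by
  obtain ⟨⟨F, hF, -, rfl⟩, -, -⟩ := hP
  exact hF.isCompact_convexHull (𝕜 := ℝ)

lemma IsCanonicalPoly.mem_interior {P : Set (Fin 3 → ℝ)} {p : Fin 3 → ℝ}
    (hP : IsCanonicalPoly P p) : p ∈ interior P :=
  (hP.2.2.symm.subset rfl).1

lemma IsCanonicalPoly.notMem_interior {P : Set (Fin 3 → ℝ)} {p x : Fin 3 → ℝ}
    (hP : IsCanonicalPoly P p) (hx : x ∈ latticePts) (hne : x ≠ p) : x ∉ interior P :=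
  fun h => hne (hP.2.2.subset ⟨h, hx⟩)

lemma IsCanonicalPoly.exists_triangulation {P : Set (Fin 3 → ℝ)} {p : Fin 3 → ℝ}
    (hP : IsCanonicalPoly P p) :
    ∃ T, IsTriangulationOf P T ∧ IsCentral p T ∧ IsFine P T := by
  classical
  have hfin := finite_inter_latticePts hP.isCompact.isBounded
  obtain ⟨A, hA⟩ := hfin.exists_finset_coe
  have hmemA : ∀ v, v ∈ A ↔ v ∈ P ∩ latticePts := fun v => by rw [← hA]; simp
  have hpP : p ∈ P := interior_subset hP.mem_interior
  have hpA : p ∈ A := (hmemA p).2 ⟨hpP, hP.2.1⟩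
  have hconv : convexHull ℝ (A : Set (Fin 3 → ℝ)) = P := by
    refine Subset.antisymm (convexHull_min (by rw [hA]; exact inter_subset_left) hP.convex) ?_
    obtain ⟨⟨F, -, hF, hPF⟩, -, -⟩ := hP
    conv_lhs => rw [hPF]
    refine convexHull_mono fun v hv => ?_
    rw [hA]
    exact ⟨by rw [hPF]; exact subset_convexHull ℝ F hv, hF hv⟩
  set B := A.erase p with hB
  obtain ⟨w₀, hw₀, hw₀f⟩ := exists_isGenericWeight B (fun v => dotp v v)
  obtain ⟨m, hm⟩ := (forcedValues_finite w₀ B p).bddBelow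
  set w := Function.update w₀ p (min (m - 1) (dotp p p)) with hw
  have hwp : w p = min (m - 1) (dotp p p) := Function.update_self ..
  have hwB : ∀ v ∈ B, w₀ v = w v := fun v hv => by
    rw [hw, Function.update_of_ne (Finset.ne_of_mem_erase hv)]
  have hforced : ∀ y ∈ forcedValues w B p, w p < y := by
    intro y hy
    rw [← forcedValues_congr p hwB] at hy
    have h1 := hm hy
    have h2 := min_le_left (m - 1) (dotp p p)
    rw [hwp]
    linarith
  have hgen : IsGenericWeight w A := by
    have h := (hw₀.congr hwB).insert (a := p) fun h => (hforced _ h).false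
    rwa [hB, Finset.insert_erase hpA] at h
  have hwBf : ∀ v ∈ B, dotp v v - 1 / 2 < w v ∧ w v < dotp v v + 1 / 2 := by
    intro v hv
    have := abs_lt.1 (hw₀f v hv)
    rw [hwB v hv] at this
    constructor <;> linarith [this.1, this.2]
  have hAB : ∀ v ∈ A, v ≠ p → v ∈ B := fun v hv hne => Finset.mem_erase.2 ⟨hne, hv⟩
  have hquad : ∀ v ∈ A, ∀ a ∈ A, v ≠ a → 2 * dotp a v - dotp a a + 1 ≤ dotp v v := by
    intro v hv a ha hne
    have h := one_le_dotp_sub_self ((hmemA v).1 hv).2 ((hmemA a).1 ha).2 hne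
    have e : dotp (v - a) (v - a) = dotp v v - 2 * dotp a v + dotp a a := by
      simp only [dotp, Finset.mul_sum, ← Finset.sum_sub_distrib, ← Finset.sum_add_distrib]
      exact Finset.sum_congr rfl fun i _ => by simp; ring
    linarith
  refine ⟨lowerFaces A w, ⟨lowerFaces_finite A w, ?_, ?_, ?_, ?_⟩, ?_, ?_⟩
  · rintro S ⟨hSA, ℓ, hℓ, -⟩
    exact ⟨fun v hv => (hmemA v).1 (hSA hv), hgen S hSA ℓ hℓ⟩
  · rw [biUnion_lowerFaces_eq A w, hconv]
    rw [hconv]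
    exact ⟨p, hP.mem_interior⟩
  · exact fun S hS S' hS' => mem_lowerFaces_of_subset hgen hS hS'
  · exact fun S hS S' hS' => ⟨S ∩ S', inter_mem_lowerFaces hS hS', Finset.inter_subset_left,
      Finset.inter_subset_right, lowerFaces_convexHull_inter hS hS'⟩
  · rintro S ⟨hSA, ℓ, hℓ, hlt⟩ hcard
    by_cases hpS : p ∈ S
    · exact subset_convexHull ℝ _ hpS
    · have hind := hgen S hSA ℓ hℓ
      have htop : affineSpan ℝ (S : Set (Fin 3 → ℝ)) = ⊤ := by
        have := (hind.affineSpan_eq_top_iff_card_eq_finrank_add_one).2 (by simp [hcard])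
        simpa using this
      refine absurd (hlt p hpA hpS) (hforced _ ?_).not_gt
      refine ⟨S, fun v hv => hAB v (hSA hv) ?_, by rw [htop]; trivial, ℓ, hℓ, rfl⟩
      rintro rfl
      exact hpS hv
  · intro a ha
    have haA := (hmemA a).2 ha
    refine ⟨{a}, ⟨by simpa using haA, ?_⟩, by simp⟩
    by_cases hap : a = p
    · subst hap
      refine ⟨((2 : ℝ) • dotpLin a).toAffineMap + AffineMap.const ℝ _ (w a - 2 * dotp a a), ?_, ?_⟩
      · simp
      · intro v hv hva
        have hne : v ≠ a := by simpa using hva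
        have h1 := hquad v hv a haA hne
        have h2 := (hwBf v (hAB v hv hne)).1
        have h3 := min_le_right (m - 1) (dotp a a)
        rw [← hwp] at h3
        simp
        linarith
    · obtain ⟨f, hf, hf'⟩ := exists_supporting_functional hP.convex ⟨p, hP.mem_interior⟩
        (hP.notMem_interior ha.2 hap)
      have hfp := sub_pos.2 (hf' p hP.mem_interior)
      obtain ⟨K, hK⟩ := exists_nat_gt (|2 * dotp a p - 2 * dotp a a + w a - w p| / (f p - f a))
      rw [div_lt_iff₀ hfp] at hK
      refine ⟨((2 : ℝ) • dotpLin a - (K : ℝ) • (f : (Fin 3 → ℝ) →ₗ[ℝ] ℝ)).toAffineMap +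
        AffineMap.const ℝ _ (w a - 2 * dotp a a + K * f a), ?_, ?_⟩
      · simp
      · intro v hv hva
        have hne : v ≠ a := by simpa using hva
        simp
        by_cases hvp : v = p
        · subst hvp
          have := le_abs_self (2 * dotp a v - 2 * dotp a a + w a - w v)
          linarith
        · have h1 := hquad v hv a haA hne
          have h2 := (hwBf v (hAB v hv hvp)).1
          have h3 := (hwBf a (hAB a haA hap)).2
          have h4 : 0 ≤ (K : ℝ) * (f v - f a) :=
            mul_nonneg K.cast_nonneg (sub_nonneg.2 (hf v ((hmemA v).1 hv).1))
          linarith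

end Existence

section Simplex

/-- The affine parametrization of `ℝ³` by coordinates relative to the apex `p` and the points
`s i`. -/
def simplexMap (p : Fin 3 → ℝ) (s : Fin 3 → Fin 3 → ℝ) (c : Fin 3 → ℝ) : Fin 3 → ℝ :=
  p + ∑ i, c i • (s i - p)

/-- The solid standard simplex. -/
def solidSimplex : Set (Fin 3 → ℝ) := {c | (∀ i, 0 ≤ c i) ∧ ∑ i, c i ≤ 1}

variable {p : Fin 3 → ℝ} {s : Fin 3 → Fin 3 → ℝ}

@[simp] lemma simplexMap_zero : simplexMap p s 0 = p := by simp [simplexMap]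

@[simp] lemma simplexMap_single (k : Fin 3) : simplexMap p s (Pi.single k 1) = s k := by
  simp [simplexMap, Pi.single_apply]

lemma simplexMap_smul (t : ℝ) (c : Fin 3 → ℝ) :
    simplexMap p s (t • c) = p + t • (simplexMap p s c - p) := by
  simp [simplexMap, Finset.smul_sum, smul_smul]

lemma map_simplexMap (f : (Fin 3 → ℝ) →ₗ[ℝ] ℝ) (c : Fin 3 → ℝ) :
    f (simplexMap p s c) = f p + ∑ i, c i * (f (s i) - f p) := by
  simp [simplexMap, map_sum]

lemma simplexMap_combo (c d : Fin 3 → ℝ) {α β : ℝ} (h : α + β = 1) :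
    simplexMap p s (α • c + β • d) = α • simplexMap p s c + β • simplexMap p s d := by
  obtain rfl : β = 1 - α := by linarith
  ext j
  simp [simplexMap, Fin.sum_univ_three]
  ring

lemma convex_simplexMap_image {K : Set (Fin 3 → ℝ)} (hK : Convex ℝ K) :
    Convex ℝ (simplexMap p s '' K) := by
  rintro _ ⟨c, hc, rfl⟩ _ ⟨d, hd, rfl⟩ α β hα hβ h
  exact ⟨_, hK hc hd hα hβ h, simplexMap_combo c d h⟩

lemma simplexMap_eq (c : Fin 3 → ℝ) :
    simplexMap p s c = p + Matrix.toLin' (Matrix.of fun i => s i - p).transpose c := by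
  ext j
  simp [simplexMap, Matrix.mulVec, dotProduct, Fin.sum_univ_three]
  ring

lemma simplexMap_mem {K : Set (Fin 3 → ℝ)} (hK : Convex ℝ K) (hp : p ∈ K) {c : Fin 3 → ℝ}
    (hc : c ∈ solidSimplex) (hs : ∀ i, c i ≠ 0 → s i ∈ K) : simplexMap p s c ∈ K := by
  classical
  let s' : Fin 3 → Fin 3 → ℝ := fun i => if c i = 0 then p else s i
  have hs' : ∀ i, s' i ∈ K := fun i => by
    by_cases h : c i = 0
    · simpa [s', h] using hp
    · simpa [s', h] using hs i h
  have e : simplexMap p s c =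
      ∑ i : Fin 4, (Fin.cons (1 - ∑ i, c i) c : Fin 4 → ℝ) i •
        (Fin.cons p s' : Fin 4 → Fin 3 → ℝ) i := by
    have h : ∀ i, c i • s' i = c i • s i := fun i => by
      by_cases h : c i = 0 <;> simp [s', h]
    rw [Fin.sum_univ_succ]
    simp only [Fin.cons_zero, Fin.cons_succ, h, simplexMap, smul_sub, Finset.sum_sub_distrib,
      ← Finset.sum_smul, sub_smul, one_smul]
    abel
  rw [e]
  refine hK.sum_mem (fun i _ => ?_) ?_ (fun i _ => ?_)
  · refine Fin.cases ?_ (fun j => ?_) i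
    · simpa using hc.2
    · simpa using hc.1 j
  · rw [Fin.sum_univ_succ]
    simp
  · refine Fin.cases ?_ (fun j => ?_) i
    · simpa using hp
    · simpa using hs' j

lemma convex_solidSimplex : Convex ℝ solidSimplex := by
  rintro c ⟨hc, hc'⟩ d ⟨hd, hd'⟩ α β hα hβ h
  refine ⟨fun i => ?_, ?_⟩
  · have := hc i
    have := hd i
    simp only [Pi.add_apply, Pi.smul_apply, smul_eq_mul]
    positivity
  · simp only [Pi.add_apply, Pi.smul_apply, smul_eq_mul, Finset.sum_add_distrib,
      ← Finset.mul_sum]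
    nlinarith

lemma single_mem_solidSimplex (k : Fin 3) : (Pi.single k 1 : Fin 3 → ℝ) ∈ solidSimplex := by
  refine ⟨fun i => ?_, by simp⟩
  by_cases h : i = k
  · subst h
    simp
  · simp [h]

lemma convexHull_eq_simplexMap_image :
    convexHull ℝ (insert p (range s)) = simplexMap p s '' solidSimplex := by
  refine Subset.antisymm (convexHull_min ?_ (convex_simplexMap_image convex_solidSimplex)) ?_
  · rintro x (rfl | ⟨k, rfl⟩)
    · exact ⟨0, ⟨fun i => le_rfl, by simp⟩, simplexMap_zero⟩
    · exact ⟨Pi.single k 1, single_mem_solidSimplex k, simplexMap_single k⟩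
  · rintro _ ⟨c, hc, rfl⟩
    exact simplexMap_mem (convex_convexHull ℝ _) (subset_convexHull ℝ _ (mem_insert _ _)) hc
      fun i _ => subset_convexHull ℝ _ (mem_insert_of_mem _ (mem_range_self i))

lemma simplexMap_injective (hs : LinearIndependent ℝ fun i => s i - p) :
    Function.Injective (simplexMap p s) := by
  intro c d h
  have h1 : ∑ i, (c i - d i) • (s i - p) = 0 := by
    simp only [simplexMap, add_right_inj] at h
    simp [sub_smul, Finset.sum_sub_distrib, h]
  ext i
  exact sub_eq_zero.1 (Fintype.linearIndependent_iff.1 hs _ h1 i)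

/-- `simplexMap` as a homeomorphism. -/
def simplexHomeomorph (hs : LinearIndependent ℝ fun i => s i - p) :
    (Fin 3 → ℝ) ≃ₜ (Fin 3 → ℝ) :=
  (LinearEquiv.ofInjectiveEndo (Matrix.toLin' (Matrix.of fun i => s i - p).transpose) (by
    intro c d h
    refine simplexMap_injective hs ?_
    rw [simplexMap_eq, simplexMap_eq, h])).toContinuousLinearEquiv.toHomeomorph.trans
    (Homeomorph.addLeft p)

lemma coe_simplexHomeomorph (hs : LinearIndependent ℝ fun i => s i - p) :
    ⇑(simplexHomeomorph hs) = simplexMap p s := by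
  ext1 c
  rw [simplexMap_eq]
  rfl

lemma simplexMap_surjective (hs : LinearIndependent ℝ fun i => s i - p) :
    Function.Surjective (simplexMap p s) := by
  rw [← coe_simplexHomeomorph hs]
  exact (simplexHomeomorph hs).surjective

lemma simplexMap_isOpenMap (hs : LinearIndependent ℝ fun i => s i - p) :
    IsOpenMap (simplexMap p s) := by
  rw [← coe_simplexHomeomorph hs]
  exact (simplexHomeomorph hs).isOpenMap

lemma continuous_simplexMap : Continuous (simplexMap p s) := by
  unfold simplexMap
  fun_prop

lemma volume_simplexMap_image (K : Set (Fin 3 → ℝ)) :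
    volume (simplexMap p s '' K) =
      ENNReal.ofReal |(Matrix.of fun i => s i - p).det| * volume K := by
  have h : simplexMap p s '' K =
      (fun x => p + x) '' (Matrix.toLin' (Matrix.of fun i => s i - p).transpose '' K) := by
    rw [image_image]
    simp only [simplexMap_eq]
  rw [h, image_add_left, measure_preimage_add, Measure.addHaar_image_linearMap,
    LinearMap.det_toLin', Matrix.det_transpose]

lemma mem_of_simplexMap_mem_convexHull (hs : LinearIndependent ℝ fun i => s i - p)
    {F : Set (Fin 3 → ℝ)} (hF : F ⊆ insert p (range s)) {c : Fin 3 → ℝ}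
    (hc : simplexMap p s c ∈ convexHull ℝ F) {k : Fin 3} (hk : c k ≠ 0) : s k ∈ F := by
  by_contra hkF
  have hconv : Convex ℝ {d : Fin 3 → ℝ | d k = 0} := by
    intro x hx y hy α β _ _ _
    simp only [mem_ofPred_eq] at hx hy
    simp [hx, hy]
  have h := convexHull_min (s := F) (t := simplexMap p s '' {d | d k = 0}) ?_
    (convex_simplexMap_image hconv) hc
  · obtain ⟨d, hd, hdc⟩ := h
    rw [simplexMap_injective hs hdc] at hd
    exact hk hd
  · intro x hx
    rcases hF hx with rfl | ⟨j, rfl⟩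
    · exact ⟨0, rfl, simplexMap_zero⟩
    · refine ⟨Pi.single j 1, ?_, simplexMap_single j⟩
      have : k ≠ j := by
        rintro rfl
        exact hkF hx
      simp [this]

lemma apex_mem_of_simplexMap_mem_convexHull (hs : LinearIndependent ℝ fun i => s i - p)
    {F : Set (Fin 3 → ℝ)} (hF : F ⊆ insert p (range s)) {c : Fin 3 → ℝ}
    (hc : simplexMap p s c ∈ convexHull ℝ F) (hsum : ∑ i, c i ≠ 1) : p ∈ F := by
  by_contra hpF
  have hconv : Convex ℝ {d : Fin 3 → ℝ | ∑ i, d i = 1} := by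
    intro x hx y hy α β _ _ h
    simp only [mem_ofPred_eq] at hx hy
    simp [Finset.sum_add_distrib, ← Finset.mul_sum, hx, hy, h]
  have h := convexHull_min (s := F) (t := simplexMap p s '' {d | ∑ i, d i = 1}) ?_
    (convex_simplexMap_image hconv) hc
  · obtain ⟨d, hd, hdc⟩ := h
    rw [simplexMap_injective hs hdc] at hd
    exact hsum hd
  · intro x hx
    rcases hF hx with rfl | ⟨j, rfl⟩
    · exact absurd hx hpF
    · exact ⟨Pi.single j 1, by simp, simplexMap_single j⟩

lemma exists_vertices_of_card_eq_four {S : Finset (Fin 3 → ℝ)}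
    (hind : AffineIndependent ℝ (fun v : (S : Set (Fin 3 → ℝ)) => (v : Fin 3 → ℝ)))
    (hcard : S.card = 4) (hp : p ∈ S) :
    ∃ s : Fin 3 → Fin 3 → ℝ, (S : Set (Fin 3 → ℝ)) = insert p (range s) ∧
      LinearIndependent ℝ fun i => s i - p := by
  classical
  have hc3 : (S.erase p).card = 3 := by rw [Finset.card_erase_of_mem hp, hcard]
  let e := (S.erase p).equivFinOfCardEq hc3
  refine ⟨fun i => (e.symm i : Fin 3 → ℝ), ?_, ?_⟩
  · have : range (fun i => (e.symm i : Fin 3 → ℝ)) = ((S.erase p : Finset _) : Set _) := by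
      ext x
      constructor
      · rintro ⟨i, rfl⟩
        exact (e.symm i).2
      · intro hx
        exact ⟨e ⟨x, hx⟩, by simp⟩
    rw [this, ← Finset.coe_insert, Finset.insert_erase hp]
  · rw [affineIndependent_iff_linearIndependent_vsub ℝ _ (⟨p, hp⟩ : (S : Set (Fin 3 → ℝ)))] at hind
    have hmem : ∀ i, (e.symm i : Fin 3 → ℝ) ∈ S ∧ (e.symm i : Fin 3 → ℝ) ≠ p := fun i =>
      ⟨Finset.mem_of_mem_erase (e.symm i).2, Finset.ne_of_mem_erase (e.symm i).2⟩
    refine hind.comp (fun i : Fin 3 => (⟨⟨(e.symm i : Fin 3 → ℝ), (hmem i).1⟩, fun h =>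
      (hmem i).2 (congrArg Subtype.val h)⟩ : {x : (S : Set (Fin 3 → ℝ)) // x ≠ ⟨p, hp⟩})) ?_
    intro i j hij
    simp only [Subtype.mk.injEq] at hij
    exact e.symm.injective (Subtype.ext hij)

/-- A set invariant under the reflection in the `i`-th coordinate has twice the volume of its
part in the corresponding half-space. -/
lemma volume_eq_two_mul_of_reflection {K : Set (Fin 3 → ℝ)} (hK : MeasurableSet K) (i : Fin 3)
    (hsymm : ∀ x, Function.update x i (-x i) ∈ K ↔ x ∈ K) :
    volume K = 2 * volume (K ∩ {x | 0 ≤ x i}) := by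
  classical
  have hmp : MeasurePreserving (fun x : Fin 3 → ℝ => Function.update x i (-x i)) := by
    have h := volume_preserving_pi (α' := fun _ : Fin 3 => ℝ) (β' := fun _ : Fin 3 => ℝ)
      (f := fun j x => if j = i then -x else x) (fun j => by
        by_cases h : j = i
        · simpa [h] using Measure.measurePreserving_neg (volume : Measure ℝ)
        · simp only [h, if_false]
          exact MeasurePreserving.id (volume : Measure ℝ))
    convert h using 1
    ext x j
    by_cases hj : j = i
    · subst hj
      simp
    · simp [hj]
  have hpos : MeasurableSet {x : Fin 3 → ℝ | 0 ≤ x i} :=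
    measurableSet_le measurable_const (measurable_pi_apply i)
  have hneg : MeasurableSet {x : Fin 3 → ℝ | x i ≤ 0} :=
    measurableSet_le (measurable_pi_apply i) measurable_const
  have hnull : volume {x : Fin 3 → ℝ | x i = 0} = 0 := by
    have h := Measure.addHaar_submodule (volume : Measure (Fin 3 → ℝ))
      (LinearMap.ker (LinearMap.proj i : (Fin 3 → ℝ) →ₗ[ℝ] ℝ)) (by
        intro h
        have : (Pi.single i 1 : Fin 3 → ℝ) ∈
          LinearMap.ker (LinearMap.proj i : (Fin 3 → ℝ) →ₗ[ℝ] ℝ) := by rw [h]; trivial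
        simp at this)
    exact h
  have h1 : volume (K ∩ {x | x i ≤ 0}) = volume (K ∩ {x | 0 ≤ x i}) := by
    rw [← hmp.measure_preimage (hK.inter hpos).nullMeasurableSet]
    congr 1
    ext x
    simp [hsymm]
  have h2 : K = (K ∩ {x | 0 ≤ x i}) ∪ (K ∩ {x | x i ≤ 0}) := by
    ext x
    have := le_total 0 (x i)
    simp only [mem_union, mem_inter_iff, mem_ofPred_eq]
    tauto
  have h3 : AEDisjoint volume (K ∩ {x | 0 ≤ x i}) (K ∩ {x | x i ≤ 0}) := by
    refine measure_mono_null ?_ hnull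
    rintro x ⟨⟨-, hx⟩, -, hx'⟩
    exact le_antisymm hx' hx
  conv_lhs => rw [h2]
  rw [measure_union₀ (hK.inter hneg).nullMeasurableSet h3, h1, two_mul]

lemma volume_solidSimplex : volume solidSimplex = ENNReal.ofReal (1 / 6) := by
  have h0 := volume_sum_rpow_le (ι := Fin 3) (p := 1) le_rfl 1
  have hmeas : MeasurableSet {x : Fin 3 → ℝ | ∑ i, |x i| ≤ 1} :=
    measurableSet_le (by fun_prop) measurable_const
  have hpos : ∀ i, MeasurableSet {x : Fin 3 → ℝ | 0 ≤ x i} := fun i =>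
    measurableSet_le measurable_const (measurable_pi_apply i)
  have e1 := volume_eq_two_mul_of_reflection hmeas 0 fun x => by
    simp [Fin.sum_univ_three]
  have e2 := volume_eq_two_mul_of_reflection (hmeas.inter (hpos 0)) 1 fun x => by
    simp [Fin.sum_univ_three]
  have e3 := volume_eq_two_mul_of_reflection ((hmeas.inter (hpos 0)).inter (hpos 1)) 2
    fun x => by simp [Fin.sum_univ_three]
  have e4 : {x : Fin 3 → ℝ | ∑ i, |x i| ≤ 1} ∩ {x | 0 ≤ x 0} ∩ {x | 0 ≤ x 1} ∩ {x | 0 ≤ x 2}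
      = solidSimplex := by
    ext x
    simp only [mem_inter_iff, mem_ofPred_eq, solidSimplex, Fin.forall_fin_succ, Fin.sum_univ_three]
    constructor
    · rintro ⟨⟨⟨h, h0⟩, h1⟩, h2⟩
      rw [abs_of_nonneg h0, abs_of_nonneg h1, abs_of_nonneg h2] at h
      exact ⟨⟨h0, h1, h2, fun i => i.elim0⟩, h⟩
    · rintro ⟨⟨h0, h1, h2, -⟩, h⟩
      change 0 ≤ x 1 at h1
      change 0 ≤ x 2 at h2
      rw [abs_of_nonneg h0, abs_of_nonneg h1, abs_of_nonneg h2]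
      exact ⟨⟨⟨h, h0⟩, h1⟩, h2⟩
  rw [e2, e3, e4] at e1
  have hG : Real.Gamma (3 + 1) = 6 := by
    have := Real.Gamma_nat_eq_factorial 3
    norm_num [Nat.factorial] at this ⊢
  have hG2 : Real.Gamma 2 = 1 := Real.Gamma_two
  simp only [Real.rpow_one, div_one, ENNReal.ofReal_one, one_pow, one_mul, Fintype.card_fin,
    Nat.cast_ofNat, hG] at h0
  rw [show (1 : ℝ) + 1 = 2 by norm_num, hG2, e1] at h0
  have hfin : volume solidSimplex ≠ ⊤ := by
    intro h
    rw [h] at h0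
    simp [ENNReal.mul_top] at h0
  rw [← ENNReal.ofReal_toReal hfin]
  congr 1
  have h5 := congrArg ENNReal.toReal h0
  rw [ENNReal.toReal_ofReal (by norm_num)] at h5
  simp only [ENNReal.toReal_mul, ENNReal.toReal_ofNat] at h5
  linarith

lemma volume_convexHull_simplex :
    volume (convexHull ℝ (insert p (range s))) =
      ENNReal.ofReal (|(Matrix.of fun i => s i - p).det| / 6) := by
  rw [convexHull_eq_simplexMap_image, volume_simplexMap_image, volume_solidSimplex,
    ← ENNReal.ofReal_mul (abs_nonneg _)]
  congr 1
  ring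

end Simplex

section Triangulations

variable {P : Set (Fin 3 → ℝ)} {p : Fin 3 → ℝ} {T : Set (Finset (Fin 3 → ℝ))}

lemma IsTriangulationOf.mem_of_mem_convexHull (hT : IsTriangulationOf P T) (hf : IsFine P T)
    {S : Finset (Fin 3 → ℝ)} (hS : S ∈ T) {x : Fin 3 → ℝ} (hx : x ∈ latticePts)
    (hxS : x ∈ convexHull ℝ (S : Set (Fin 3 → ℝ))) : x ∈ S := by
  obtain ⟨-, -, hU, hdown, hinter⟩ := hT
  have hxP : x ∈ P := by
    rw [← hU]
    exact mem_biUnion hS hxS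
  obtain ⟨S', hS', hxS'⟩ := hf x ⟨hxP, hx⟩
  obtain ⟨F, -, hFx, hFS, h⟩ := hinter {x} (hdown S' hS' {x} (by simpa using hxS')) S hS
  have hxF : x ∈ convexHull ℝ (F : Set (Fin 3 → ℝ)) := by
    rw [← h]
    exact ⟨subset_convexHull ℝ _ (by simp), hxS⟩
  have hFne : F.Nonempty := by
    rw [Finset.nonempty_iff_ne_empty]
    rintro rfl
    simp at hxF
  obtain ⟨y, hy⟩ := hFne
  have hyx : y = x := by simpa using hFx hy
  exact hyx ▸ hFS hy

lemma IsTriangulationOf.exists_generic_mem (hT : IsTriangulationOf P T)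
    {U : Set (Fin 3 → ℝ)} (hU : IsOpen U) (hne : U.Nonempty) (hUP : U ⊆ P) :
    ∃ x ∈ U, ∃ S ∈ T, S.card = 4 ∧ x ∈ convexHull ℝ (S : Set (Fin 3 → ℝ)) ∧
      ∀ S' ∈ T, S'.card ≠ 4 → x ∉ convexHull ℝ (S' : Set (Fin 3 → ℝ)) := by
  obtain ⟨hfin, hind, hcov, -, -⟩ := hT
  have hnull : volume (⋃ S ∈ {S ∈ T | S.card ≠ 4}, convexHull ℝ (S : Set (Fin 3 → ℝ))) = 0 := by
    refine (measure_biUnion_null_iff (hfin.subset (sep_subset _ _)).countable).2 ?_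
    rintro S ⟨hS, hcard⟩
    refine measure_mono_null (convexHull_subset_affineSpan _)
      (Measure.addHaar_affineSubspace _ _ fun htop => hcard ?_)
    have h := ((hind S hS).2.affineSpan_eq_top_iff_card_eq_finrank_add_one).1 (by simpa using htop)
    simpa using h
  obtain ⟨x, hxU, hx⟩ : ∃ x ∈ U, x ∉ ⋃ S ∈ {S ∈ T | S.card ≠ 4},
      convexHull ℝ (S : Set (Fin 3 → ℝ)) := by
    by_contra! h
    exact (hU.measure_pos volume hne).ne' (measure_mono_null h hnull)
  have hx' : ∀ S' ∈ T, S'.card ≠ 4 → x ∉ convexHull ℝ (S' : Set (Fin 3 → ℝ)) :=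
    fun S' hS' hc hmem => hx (mem_biUnion (show S' ∈ {S ∈ T | S.card ≠ 4} from ⟨hS', hc⟩) hmem)
  have hxP := hUP hxU
  rw [← hcov] at hxP
  obtain ⟨S, hS, hxS⟩ := mem_iUnion₂.1 hxP
  exact ⟨x, hxU, S, hS, by_contra fun hc => hx' S hS hc hxS, hxS, hx'⟩

lemma IsTriangulationOf.exists_vertices (hP : IsCanonicalPoly P p) (hT : IsTriangulationOf P T)
    (hc : IsCentral p T) (hf : IsFine P T) {S : Finset (Fin 3 → ℝ)} (hS : S ∈ T)
    (hcard : S.card = 4) :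
    ∃ s : Fin 3 → Fin 3 → ℝ, (S : Set (Fin 3 → ℝ)) = insert p (range s) ∧
      LinearIndependent ℝ fun i => s i - p :=
  exists_vertices_of_card_eq_four (hT.2.1 S hS).2 hcard
    (hT.mem_of_mem_convexHull hf hS hP.2.1 (hc S hS hcard))

/-- The face opposite to `p` of a tetrahedron of a central fine triangulation lies in the
boundary of the polytope. -/
lemma IsTriangulationOf.exists_supporting (hP : IsCanonicalPoly P p)
    (hT : IsTriangulationOf P T) (hc : IsCentral p T)
    {S : Finset (Fin 3 → ℝ)} (hS : S ∈ T) (hcard : S.card = 4) {s : Fin 3 → Fin 3 → ℝ}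
    (hSs : (S : Set (Fin 3 → ℝ)) = insert p (range s))
    (hs : LinearIndependent ℝ fun i => s i - p) :
    ∃ (f : StrongDual ℝ (Fin 3 → ℝ)) (b : ℝ),
      (∀ y ∈ P, b ≤ f y) ∧ (∀ i, f (s i) = b) ∧ b < f p := by
  have hsP : ∀ i, s i ∈ P := fun i =>
    ((hT.2.1 S hS).1 (by rw [hSs]; exact mem_insert_of_mem _ (mem_range_self i))).1
  by_cases hq : simplexMap p s (fun _ => 1 / 3) ∈ interior P
  · exfalso
    let V : Set (Fin 3 → ℝ) := {c | (∀ i, 0 < c i) ∧ 1 < ∑ i, c i} ∩ simplexMap p s ⁻¹' interior P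
    have hV : IsOpen V := by
      refine IsOpen.inter ?_ (isOpen_interior.preimage continuous_simplexMap)
      have : {c : Fin 3 → ℝ | (∀ i, 0 < c i) ∧ 1 < ∑ i, c i}
          = (⋂ i, {c | 0 < c i}) ∩ {c | 1 < ∑ i, c i} := by
        ext c
        simp
      rw [this]
      exact (isOpen_iInter_of_finite fun i =>
        isOpen_lt continuous_const (continuous_apply i)).inter
        (isOpen_lt continuous_const (by fun_prop))
    have hVne : V.Nonempty := by
      have hcont : Continuous fun t : ℝ => simplexMap p s (fun _ => t) :=
        continuous_simplexMap.comp (by fun_prop)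
      have h1 : ∀ᶠ t in nhdsWithin (1 / 3 : ℝ) (Ioi (1 / 3)),
          simplexMap p s (fun _ => t) ∈ interior P :=
        nhdsWithin_le_nhds (hcont.continuousAt.preimage_mem_nhds (isOpen_interior.mem_nhds hq))
      obtain ⟨t, ht, ht'⟩ := (h1.and self_mem_nhdsWithin).exists
      have ht'' : (1 / 3 : ℝ) < t := ht'
      refine ⟨fun _ => t, ⟨fun _ => by linarith, ?_⟩, ht⟩
      simp
      linarith
    obtain ⟨x, ⟨c, ⟨⟨hc0, hc1⟩, -⟩, rfl⟩, S', hS', hcard', hxS', -⟩ := hT.exists_generic_mem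
      (simplexMap_isOpenMap hs V hV) (hVne.image _)
      (by rintro _ ⟨c, hc, rfl⟩; exact interior_subset hc.2)
    have hpos : 0 < ∑ i, c i := by linarith
    set t : ℝ := (2 * ∑ i, c i)⁻¹ with ht
    have ht0 : 0 < t := by positivity
    have hsum : ∑ i, (t • c) i = 1 / 2 := by
      simp only [Pi.smul_apply, smul_eq_mul, ← Finset.mul_sum, ht]
      field_simp
    have ht1 : t ≤ 1 := by
      simp only [Pi.smul_apply, smul_eq_mul, ← Finset.mul_sum] at hsum
      nlinarith
    have hpS' := hc S' hS' hcard'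
    have hy' : simplexMap p s (t • c) ∈ convexHull ℝ (S' : Set (Fin 3 → ℝ)) := by
      have h := convex_convexHull ℝ (S' : Set (Fin 3 → ℝ)) hpS' hxS'
        (sub_nonneg.2 ht1) ht0.le (by ring)
      convert h using 1
      rw [simplexMap_smul, smul_sub, sub_smul, one_smul]
      abel
    have hy : simplexMap p s (t • c) ∈ convexHull ℝ (S : Set (Fin 3 → ℝ)) := by
      rw [hSs, convexHull_eq_simplexMap_image]
      refine mem_image_of_mem _ ⟨fun i => ?_, by rw [hsum]; norm_num⟩
      exact (mul_pos ht0 (hc0 i)).le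
    obtain ⟨F, -, hFS, hFS', hF⟩ := hT.2.2.2.2 S hS S' hS'
    have hyF : simplexMap p s (t • c) ∈ convexHull ℝ (F : Set (Fin 3 → ℝ)) := by
      rw [← hF]
      exact ⟨hy, hy'⟩
    have hFs : (F : Set (Fin 3 → ℝ)) ⊆ insert p (range s) := by
      rw [← hSs]
      exact_mod_cast hFS
    have hSF : S ⊆ F := by
      intro v hv
      have hv' : v ∈ (S : Set (Fin 3 → ℝ)) := hv
      rw [hSs] at hv'
      rcases hv' with rfl | ⟨k, rfl⟩
      · exact apex_mem_of_simplexMap_mem_convexHull hs hFs hyF (by rw [hsum]; norm_num)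
      · exact mem_of_simplexMap_mem_convexHull hs hFs hyF (mul_pos ht0 (hc0 k)).ne'
    have hSS' : S = S' := Finset.eq_of_subset_of_card_le (hSF.trans hFS') (by rw [hcard, hcard'])
    rw [← hSS', hSs, convexHull_eq_simplexMap_image] at hxS'
    obtain ⟨d, hd, hdc⟩ := hxS'
    rw [simplexMap_injective hs hdc] at hd
    exact hd.2.not_gt hc1
  · obtain ⟨f, hf1, hf2⟩ := exists_supporting_functional hP.convex ⟨p, hP.mem_interior⟩ hq
    refine ⟨f, _, hf1, ?_, hf2 p hP.mem_interior⟩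
    have h := map_simplexMap (p := p) (s := s) (f : (Fin 3 → ℝ) →ₗ[ℝ] ℝ) (fun _ => 1 / 3)
    simp only [ContinuousLinearMap.coe_coe, Fin.sum_univ_three] at h
    have h0 := hf1 _ (hsP 0)
    have h1 := hf1 _ (hsP 1)
    have h2 := hf1 _ (hsP 2)
    intro i
    fin_cases i <;> simp only [Fin.zero_eta, Fin.mk_one, Fin.reduceFinMk] <;> linarith

lemma isFacetOf_supporting {s : Fin 3 → Fin 3 → ℝ}
    (hs : LinearIndependent ℝ fun i => s i - p) (hsP : ∀ i, s i ∈ P)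
    {f : StrongDual ℝ (Fin 3 → ℝ)} {b : ℝ} (hle : ∀ y ∈ P, b ≤ f y) (hfs : ∀ i, f (s i) = b)
    (hp : b < f p) : IsFacetOf (P ∩ {x | f x = b}) P := by
  have hdot : ∀ x, dotp (fun i => f (Pi.single i 1)) x = f x := by
    intro x
    conv_rhs => rw [← Finset.univ_sum_single x, map_sum]
    unfold dotp
    refine Finset.sum_congr rfl fun i _ => ?_
    have : (Pi.single i (x i) : Fin 3 → ℝ) = x i • Pi.single i 1 := by
      rw [← Pi.single_smul, smul_eq_mul, mul_one]
    rw [this, map_smul, smul_eq_mul, mul_comm]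
  refine ⟨fun i => f (Pi.single i 1), b, fun x hx => by rw [hdot]; exact hle x hx, ?_, ?_⟩
  · simp only [hdot]
  · rw [direction_affineSpan]
    apply le_antisymm
    · have hlt : vectorSpan ℝ (P ∩ {x | f x = b}) < ⊤ := by
        rw [lt_top_iff_ne_top]
        intro htop
        have hker : vectorSpan ℝ (P ∩ {x | f x = b}) ≤
            LinearMap.ker (f : (Fin 3 → ℝ) →ₗ[ℝ] ℝ) := by
          rw [vectorSpan_def, Submodule.span_le]
          rintro _ ⟨x, hx, y, hy, rfl⟩
          have hx' : f x = b := hx.2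
          have hy' : f y = b := hy.2
          simp [hx', hy']
        have h0 : p - s 0 ∈ LinearMap.ker (f : (Fin 3 → ℝ) →ₗ[ℝ] ℝ) :=
          hker (by rw [htop]; trivial)
        simp [hfs] at h0
        linarith
      have := Submodule.finrank_lt hlt.ne
      simp at this
      omega
    · have hind : AffineIndependent ℝ s := by
        rw [affineIndependent_iff]
        intro t w hw hws
        have h1 : ∑ i ∈ t, w i • (s i - p) = 0 := by
          simp [smul_sub, Finset.sum_sub_distrib, ← Finset.sum_smul, hw, hws]
        exact linearIndependent_iff'.1 hs t w h1
      have h2 := hind.finrank_vectorSpan (n := 2) (by simp)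
      rw [← h2]
      refine Submodule.finrank_mono (vectorSpan_mono ℝ ?_)
      rintro _ ⟨i, rfl⟩
      exact ⟨hsP i, hfs i⟩

lemma lt_dotp_of_isFacet (hp : p ∈ interior P) {a : Fin 3 → ℝ} {b : ℝ}
    (hle : ∀ x ∈ P, b ≤ dotp a x)
    (hfin : Module.finrank ℝ (affineSpan ℝ (P ∩ {x | dotp a x = b})).direction = 2) :
    b < dotp a p := by
  refine lt_of_le_of_ne (hle p (interior_subset hp)) fun hpb => ?_
  have hall : P ⊆ P ∩ {x | dotp a x = b} := by
    intro y hy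
    refine ⟨hy, le_antisymm ?_ (hle y hy)⟩
    have hcont : Continuous fun t : ℝ => p + t • (p - y) := by fun_prop
    have h1 : ∀ᶠ t in nhdsWithin (0 : ℝ) (Ioi 0), p + t • (p - y) ∈ P := by
      refine nhdsWithin_le_nhds (hcont.continuousAt.preimage_mem_nhds ?_)
      simpa using mem_interior_iff_mem_nhds.1 hp
    obtain ⟨t, ht, ht0⟩ := (h1.and self_mem_nhdsWithin).exists
    have ht0' : (0 : ℝ) < t := ht0
    have h2 := hle _ ht
    rw [← dotpLin_apply, map_add, map_smul, map_sub] at h2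
    simp only [dotpLin_apply, smul_eq_mul, ← hpb] at h2
    nlinarith
  have htop : affineSpan ℝ (P ∩ {x | dotp a x = b}) = ⊤ := by
    rw [eq_top_iff, ← isOpen_interior.affineSpan_eq_top ⟨p, hp⟩]
    exact affineSpan_mono ℝ (interior_subset.trans hall)
  rw [htop, AffineSubspace.direction_top] at hfin
  simp at hfin

lemma exists_linearIndependent_of_finrank {F : Set (Fin 3 → ℝ)}
    (hfin : Module.finrank ℝ (affineSpan ℝ F).direction = 2) {a : Fin 3 → ℝ} {b : ℝ}
    (hF : ∀ x ∈ F, dotp a x = b) (hp : b < dotp a p) :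
    ∃ v : Fin 3 → Fin 3 → ℝ, (∀ i, v i ∈ F) ∧ LinearIndependent ℝ fun i => v i - p := by
  obtain ⟨t, htF, hspan, hind⟩ := exists_affineIndependent ℝ (Fin 3 → ℝ) F
  have htf : t.Finite := finite_set_of_fin_dim_affineIndependent ℝ hind
  have := htf.fintype
  have hne : Nonempty t := by
    rw [nonempty_coe_sort, nonempty_iff_ne_empty]
    rintro rfl
    rw [← hspan, AffineSubspace.span_empty, AffineSubspace.direction_bot, finrank_bot] at hfin
    omega
  have hcard : Fintype.card t = 3 := by
    rw [← hind.finrank_vectorSpan_add_one, Subtype.range_coe, ← direction_affineSpan, hspan, hfin]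
  let e := (Fintype.equivFinOfCardEq hcard).symm
  refine ⟨fun i => e i, fun i => htF (e i).2, ?_⟩
  have hind' := hind.comp_embedding e.toEmbedding
  rw [Fintype.linearIndependent_iff]
  intro c hc
  have h1 : (∑ i, c i) * (b - dotp a p) = 0 := by
    have := congrArg (dotpLin a) hc
    simp only [map_sum, map_smul, map_sub, dotpLin_apply, map_zero, smul_eq_mul,
      hF _ (htF (e _).2)] at this
    rw [Finset.sum_mul, this]
  have h2 : ∑ i, c i = 0 := (mul_eq_zero.1 h1).resolve_right (by linarith)
  have h3 : ∑ i, c i • (e i : Fin 3 → ℝ) = 0 := by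
    simpa [smul_sub, Finset.sum_sub_distrib, ← Finset.sum_smul, h2] using hc
  exact fun i => (affineIndependent_iff.1 hind') Finset.univ c h2 h3 i (Finset.mem_univ i)

/-- Every facet contains the face opposite to `p` of some tetrahedron of a central fine
triangulation. -/
lemma IsTriangulationOf.exists_simplex_in_facet (hP : IsCanonicalPoly P p)
    (hT : IsTriangulationOf P T) (hc : IsCentral p T) (hf : IsFine P T)
    {a : Fin 3 → ℝ} {b : ℝ} (hle : ∀ x ∈ P, b ≤ dotp a x)
    (hfin : Module.finrank ℝ (affineSpan ℝ (P ∩ {x | dotp a x = b})).direction = 2) :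
    ∃ S ∈ T, S.card = 4 ∧ ∃ s : Fin 3 → Fin 3 → ℝ, (S : Set (Fin 3 → ℝ)) = insert p (range s) ∧
      LinearIndependent ℝ (fun i => s i - p) ∧ ∀ i, dotp a (s i) = b := by
  classical
  have hpb := lt_dotp_of_isFacet hP.mem_interior hle hfin
  obtain ⟨v, hvF, hv⟩ := exists_linearIndependent_of_finrank hfin (fun x hx => hx.2) hpb
  let V : Set (Fin 3 → ℝ) := {c | (∀ i, 0 < c i) ∧ ∑ i, c i < 1}
  have hV : IsOpen V := by
    have : V = (⋂ i, {c | 0 < c i}) ∩ {c | ∑ i, c i < 1} := by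
      ext c
      simp [V]
    rw [this]
    exact (isOpen_iInter_of_finite fun i =>
      isOpen_lt continuous_const (continuous_apply i)).inter
      (isOpen_lt (by fun_prop) continuous_const)
  have hVne : V.Nonempty := ⟨fun _ => 1 / 4, fun _ => by norm_num, by norm_num⟩
  have hpP := interior_subset hP.mem_interior
  have hVP : simplexMap p v '' V ⊆ P := by
    rintro _ ⟨c, hc, rfl⟩
    exact simplexMap_mem hP.convex hpP ⟨fun i => (hc.1 i).le, hc.2.le⟩ fun i _ => (hvF i).1
  obtain ⟨x, ⟨d, ⟨hd0, hd1⟩, hdx⟩, S, hS, hcard, hxS, hgen⟩ :=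
    hT.exists_generic_mem (simplexMap_isOpenMap hv V hV) (hVne.image _) hVP
  obtain ⟨s, hSs, hs⟩ := hT.exists_vertices hP hc hf hS hcard
  refine ⟨S, hS, hcard, s, hSs, hs, ?_⟩
  have hxS' := hxS
  rw [hSs, convexHull_eq_simplexMap_image] at hxS'
  obtain ⟨c, hcm, hcx⟩ := hxS'
  have hsS : ∀ i, s i ∈ S := fun i => by
    have : s i ∈ (S : Set (Fin 3 → ℝ)) := by
      rw [hSs]
      exact mem_insert_of_mem _ (mem_range_self i)
    exact this
  have hpS : p ∈ S := by
    have : p ∈ (S : Set (Fin 3 → ℝ)) := by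
      rw [hSs]
      exact mem_insert _ _
    exact this
  have hcpos : ∀ i, 0 < c i := by
    intro i
    refine lt_of_le_of_ne (hcm.1 i) fun h0 => ?_
    refine hgen (S.erase (s i)) (hT.2.2.2.1 S hS _ (Finset.erase_subset _ _)) ?_ ?_
    · rw [Finset.card_erase_of_mem (hsS i), hcard]
      norm_num
    · rw [← hcx]
      refine simplexMap_mem (convex_convexHull ℝ _) (subset_convexHull ℝ _ ?_) hcm fun j hj => ?_
      · refine Finset.mem_coe.2 (Finset.mem_erase.2 ⟨fun h => hs.ne_zero i ?_, hpS⟩)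
        rw [← h, sub_self]
      · refine subset_convexHull ℝ _ (Finset.mem_coe.2 (Finset.mem_erase.2 ⟨fun h => ?_, hsS j⟩))
        have hij : j = i := hs.injective (by simp only [h])
        subst hij
        exact hj h0.symm
  have hsP : ∀ i, s i ∈ P := fun i => ((hT.2.1 S hS).1 (hsS i)).1
  obtain ⟨f, b', hf1, hf2, hf3⟩ := hT.exists_supporting hP hc hS hcard hSs hs
  have hdpos : 0 < ∑ i, d i := Finset.sum_pos (fun i _ => hd0 i) Finset.univ_nonempty
  set t : ℝ := (∑ i, d i)⁻¹ with ht
  have ht0 : 0 < t := inv_pos.2 hdpos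
  have htd : ∑ i, (t • d) i = 1 := by
    simp only [Pi.smul_apply, smul_eq_mul, ← Finset.mul_sum, ht]
    exact inv_mul_cancel₀ hdpos.ne'
  have hy : simplexMap p v (t • d) = simplexMap p s (t • c) := by
    rw [simplexMap_smul, simplexMap_smul, hdx, hcx]
  have hyP : simplexMap p v (t • d) ∈ P :=
    simplexMap_mem hP.convex hpP ⟨fun i => (mul_pos ht0 (hd0 i)).le, htd.le⟩ fun i _ => (hvF i).1
  have hyb : dotp a (simplexMap p v (t • d)) = b := by
    have hvb : ∀ i, dotp a (v i) = b := fun i => (hvF i).2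
    rw [← dotpLin_apply, map_simplexMap]
    simp only [dotpLin_apply, hvb, ← Finset.sum_mul, htd]
    ring
  have htc : ∑ i, (t • c) i ≤ 1 := by
    have h1 := hf1 _ hyP
    rw [hy] at h1
    have h2 := map_simplexMap (p := p) (s := s) (f : (Fin 3 → ℝ) →ₗ[ℝ] ℝ) (t • c)
    simp only [ContinuousLinearMap.coe_coe, hf2, ← Finset.sum_mul] at h2
    rw [h2] at h1
    nlinarith
  rw [hy, ← dotpLin_apply, map_simplexMap] at hyb
  simp only [dotpLin_apply] at hyb
  have hnn : ∀ i ∈ Finset.univ, 0 ≤ (t • c) i * (dotp a (s i) - b) := fun i _ =>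
    mul_nonneg (mul_pos ht0 (hcpos i)).le (sub_nonneg.2 (hle _ (hsP i)))
  have hzero : ∑ i, (t • c) i * (dotp a (s i) - b) = 0 := by
    refine le_antisymm ?_ (Finset.sum_nonneg hnn)
    have e : ∑ i, (t • c) i * (dotp a (s i) - b) =
        ∑ i, (t • c) i * (dotp a (s i) - dotp a p) + (∑ i, (t • c) i) * (dotp a p - b) := by
      rw [Finset.sum_mul, ← Finset.sum_add_distrib]
      exact Finset.sum_congr rfl fun i _ => by ring
    rw [e]
    nlinarith
  intro i
  have h := (Finset.sum_eq_zero_iff_of_nonneg hnn).1 hzero i (Finset.mem_univ i)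
  exact sub_eq_zero.1 ((mul_eq_zero.1 h).resolve_left (mul_pos ht0 (hcpos i)).ne')

end Triangulations

section Lattice

variable {P : Set (Fin 3 → ℝ)} {p : Fin 3 → ℝ} {s : Fin 3 → Fin 3 → ℝ}

lemma add_zsmul_sub_mem_latticePts {x y z : Fin 3 → ℝ} (hx : x ∈ latticePts)
    (hy : y ∈ latticePts) (hz : z ∈ latticePts) (n : ℤ) :
    x + (n : ℝ) • (y - z) ∈ latticePts := by
  intro i
  obtain ⟨k, hk⟩ := hx i
  obtain ⟨l, hl⟩ := hy i
  obtain ⟨m, hm⟩ := hz i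
  exact ⟨k + n * (l - m), by simp [hk, hl, hm]⟩

lemma simplexMap_add_intCast_mem_latticePts (hpL : p ∈ latticePts) (hsL : ∀ i, s i ∈ latticePts)
    {c : Fin 3 → ℝ} (hc : simplexMap p s c ∈ latticePts) (n : Fin 3 → ℤ) :
    simplexMap p s (fun i => c i + n i) ∈ latticePts := by
  have e : simplexMap p s (fun i => c i + n i) = simplexMap p s c + (n 0 : ℝ) • (s 0 - p) +
      (n 1 : ℝ) • (s 1 - p) + (n 2 : ℝ) • (s 2 - p) := by
    ext j
    simp [simplexMap, Fin.sum_univ_three]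
    ring
  rw [e]
  exact add_zsmul_sub_mem_latticePts (add_zsmul_sub_mem_latticePts
    (add_zsmul_sub_mem_latticePts hc (hsL 0) hpL _) (hsL 1) hpL _) (hsL 2) hpL _

lemma simplexMap_neg_mem_latticePts (hpL : p ∈ latticePts)
    {c : Fin 3 → ℝ} (hc : simplexMap p s c ∈ latticePts) :
    simplexMap p s (-c) ∈ latticePts := by
  have e : simplexMap p s (-c) = p + ((-1 : ℤ) : ℝ) • (simplexMap p s c - p) := by
    rw [← simplexMap_smul]
    simp
  rw [e]
  exact add_zsmul_sub_mem_latticePts hpL hc hpL _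

/-- In a lattice tetrahedron containing no lattice points except its vertices, a lattice point
of the facet opposite to `p` is a vertex. -/
lemma exists_eq_single_of_empty (hs : LinearIndependent ℝ fun i => s i - p)
    (hempty : ∀ x ∈ latticePts, x ∈ convexHull ℝ (insert p (range s)) → x ∈ insert p (range s))
    {d : Fin 3 → ℝ} (hd : ∀ i, 0 ≤ d i) (hsum : ∑ i, d i = 1)
    (hL : simplexMap p s d ∈ latticePts) : ∃ k, d = Pi.single k 1 := by
  have hmem : simplexMap p s d ∈ convexHull ℝ (insert p (range s)) := by
    rw [convexHull_eq_simplexMap_image]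
    exact mem_image_of_mem _ ⟨hd, hsum.le⟩
  rcases hempty _ hL hmem with h | ⟨k, hk⟩
  · have : d = 0 := simplexMap_injective hs (by rw [h, simplexMap_zero])
    simp [this] at hsum
  · exact ⟨k, simplexMap_injective hs (by rw [simplexMap_single, hk])⟩

/-- If `p` has lattice distance one from the opposite facet of an empty lattice tetrahedron, then
all lattice points have integral coordinates with respect to the tetrahedron. -/
lemma fract_eq_zero_of_empty (hs : LinearIndependent ℝ fun i => s i - p)
    (hpL : p ∈ latticePts) (hsL : ∀ i, s i ∈ latticePts)
    (hempty : ∀ x ∈ latticePts, x ∈ convexHull ℝ (insert p (range s)) → x ∈ insert p (range s))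
    {a : Fin 3 → ℤ} (ha : ∀ i, dotp (fun j => (a j : ℝ)) (s i) = dotp (fun j => (a j : ℝ)) p - 1)
    {c : Fin 3 → ℝ} (hc : simplexMap p s c ∈ latticePts) (i : Fin 3) : Int.fract (c i) = 0 := by
  have hint : ∀ x ∈ latticePts, ∃ n : ℤ, dotp (fun j => (a j : ℝ)) x = n := by
    intro x hx
    obtain ⟨z, rfl⟩ := mem_latticePts_iff.1 hx
    exact ⟨∑ j, a j * z j, by simp [dotp]⟩
  have hfr : simplexMap p s (fun i => Int.fract (c i)) ∈ latticePts := by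
    convert simplexMap_add_intCast_mem_latticePts hpL hsL hc (fun i => -⌊c i⌋) using 3
    push_cast
    rw [← sub_eq_add_neg, Int.self_sub_floor]
  obtain ⟨m, hm⟩ : ∃ m : ℤ, ∑ i, Int.fract (c i) = m := by
    obtain ⟨k, hk⟩ := hint _ hfr
    obtain ⟨l, hl⟩ := hint _ hpL
    rw [← dotpLin_apply, map_simplexMap] at hk
    simp only [dotpLin_apply, ha, sub_sub_cancel_left, ← Finset.sum_mul, hl] at hk
    exact ⟨l - k, by push_cast; linarith⟩
  have h0 : ∀ i, 0 ≤ Int.fract (c i) := fun i => Int.fract_nonneg _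
  have h1 : ∀ i, Int.fract (c i) < 1 := fun i => Int.fract_lt_one _
  have hm0 : 0 ≤ m := by
    have : (0 : ℝ) ≤ m := by
      rw [← hm]
      exact Finset.sum_nonneg fun i _ => h0 i
    exact_mod_cast this
  have hm3 : m < 3 := by
    have : (m : ℝ) < 3 := by
      rw [← hm, Fin.sum_univ_three]
      linarith [h1 0, h1 1, h1 2]
    exact_mod_cast this
  interval_cases m
  · exact (Finset.sum_eq_zero_iff_of_nonneg fun i _ => h0 i).1 (by simpa using hm) i
      (Finset.mem_univ i)
  · obtain ⟨k, hk⟩ := exists_eq_single_of_empty hs hempty h0 (by simpa using hm) hfr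
    have := congrFun hk k
    simp only [Pi.single_eq_same] at this
    exact absurd this (h1 k).ne
  · have hL := simplexMap_add_intCast_mem_latticePts hpL hsL
      (simplexMap_neg_mem_latticePts hpL hfr) (fun _ => 1)
    obtain ⟨k, hk⟩ := exists_eq_single_of_empty hs hempty
      (fun i => by simpa using (h1 i).le)
      (by
        simp only [Fin.sum_univ_three] at hm
        simp [Fin.sum_univ_three]
        push_cast at hm
        linarith) hL
    obtain ⟨j, hj⟩ := exists_ne k
    have := congrFun hk j
    simp only [Pi.single_eq_of_ne hj, Pi.neg_apply, Int.cast_one] at this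
    linarith [h1 j]

/-- The edge vectors from `p` as an integer matrix. -/
lemma exists_int_matrix (hpL : p ∈ latticePts) (hsL : ∀ i, s i ∈ latticePts) :
    ∃ Z : Matrix (Fin 3) (Fin 3) ℤ, ∀ i j, s i j - p j = Z i j := by
  choose z hz using hsL
  choose q hq using hpL
  exact ⟨Matrix.of fun i j => z i j - q j, fun i j => by simp [hz, hq]⟩

lemma det_eq_intCast_det {Z : Matrix (Fin 3) (Fin 3) ℤ} (hZ : ∀ i j, s i j - p j = Z i j) :
    (Matrix.of fun i => s i - p).det = (Z.det : ℝ) := by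
  have h : (Matrix.of fun i => s i - p) = (Int.castRingHom ℝ).mapMatrix Z := by
    ext i j
    simp [hZ]
  rw [h, ← RingHom.map_det]
  rfl

lemma abs_det_eq_one_of_empty (hs : LinearIndependent ℝ fun i => s i - p)
    (hpL : p ∈ latticePts) (hsL : ∀ i, s i ∈ latticePts)
    (hempty : ∀ x ∈ latticePts, x ∈ convexHull ℝ (insert p (range s)) → x ∈ insert p (range s))
    {a : Fin 3 → ℤ}
    (ha : ∀ i, dotp (fun j => (a j : ℝ)) (s i) = dotp (fun j => (a j : ℝ)) p - 1) :
    |(Matrix.of fun i => s i - p).det| = 1 := by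
  obtain ⟨Z, hZ⟩ := exists_int_matrix hpL hsL
  have hC : ∀ k : Fin 3, ∃ n : Fin 3 → ℤ, ∀ j, ∑ i, n i * Z i j = (1 : Matrix _ _ ℤ) k j := by
    intro k
    have hx : p + Pi.single k 1 ∈ latticePts := by
      intro i
      obtain ⟨m, hm⟩ := hpL i
      exact ⟨m + (1 : Matrix _ _ ℤ) k i, by
        by_cases h : i = k
        · subst h
          simp [hm]
        · simp [hm, h, Ne.symm h]⟩
    obtain ⟨c, hc⟩ := simplexMap_surjective hs (p + Pi.single k 1)
    have hfr := fract_eq_zero_of_empty hs hpL hsL hempty ha (hc ▸ hx)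
    refine ⟨fun i => ⌊c i⌋, fun j => ?_⟩
    have hfl : ∀ i, (⌊c i⌋ : ℝ) = c i := fun i => by
      have := Int.floor_add_fract (c i)
      rw [hfr i, add_zero] at this
      exact this
    have h := congrFun hc j
    simp only [simplexMap, Pi.add_apply, Finset.sum_apply, Pi.smul_apply, Pi.sub_apply,
      smul_eq_mul, hZ, add_right_inj] at h
    have h' : ((∑ i, ⌊c i⌋ * Z i j : ℤ) : ℝ) = ((1 : Matrix (Fin 3) (Fin 3) ℤ) k j : ℤ) := by
      push_cast
      simp only [hfl, h]
      by_cases hjk : j = k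
      · subst hjk
        simp
      · simp [hjk, Ne.symm hjk]
    exact_mod_cast h'
  choose C hC using hC
  have hmul : Matrix.of C * Z = 1 := by
    ext k j
    exact hC k j
  have hdet : IsUnit Z.det := by
    refine IsUnit.of_mul_eq_one_right (Matrix.of C).det ?_
    rw [← Matrix.det_mul, hmul, Matrix.det_one]
  rw [det_eq_intCast_det hZ, ← Int.cast_abs, Int.isUnit_iff_abs_eq.1 hdet, Int.cast_one]

lemma exists_dotp_eq_of_abs_det_eq_one (hpL : p ∈ latticePts) (hsL : ∀ i, s i ∈ latticePts)
    (hdet : |(Matrix.of fun i => s i - p).det| = 1) :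
    ∃ (a : Fin 3 → ℤ) (b : ℤ), (∀ i, dotp (fun j => (a j : ℝ)) (s i) = b) ∧
      dotp (fun j => (a j : ℝ)) p = b + 1 := by
  obtain ⟨Z, hZ⟩ := exists_int_matrix hpL hsL
  have hunit : IsUnit Z.det := by
    rw [det_eq_intCast_det hZ, ← Int.cast_abs] at hdet
    exact Int.isUnit_iff_abs_eq.2 (by exact_mod_cast hdet)
  let a : Fin 3 → ℤ := Z⁻¹.mulVec fun _ => -1
  have ha : ∀ i, ∑ j, Z i j * a j = -1 := by
    have h : Z.mulVec a = fun _ => -1 := by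
      rw [Matrix.mulVec_mulVec, Matrix.mul_nonsing_inv _ hunit, Matrix.one_mulVec]
    exact fun i => congrFun h i
  obtain ⟨q, rfl⟩ := mem_latticePts_iff.1 hpL
  refine ⟨a, ∑ j, a j * q j - 1, fun i => ?_, by simp [dotp]⟩
  have h : (∑ j, (Z i j : ℝ) * a j) = -1 := by exact_mod_cast ha i
  simp only [← hZ, sub_mul, Finset.sum_sub_distrib] at h
  push_cast
  simp only [dotp, mul_comm (a _ : ℝ)]
  linarith

end Lattice

theorem stmt4 (P : Set (Fin 3 → ℝ)) (p : Fin 3 → ℝ) (hP : IsCanonicalPoly P p) :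
    IsReflexive P p ↔
      ∀ T : Set (Finset (Fin 3 → ℝ)),
        IsTriangulationOf P T → IsCentral p T → IsFine P T → IsUnimodular T := by
  have hpP : p ∈ P := interior_subset hP.mem_interior
  constructor
  · intro hrefl T hT hc hf S hS hcard
    obtain ⟨s, hSs, hs⟩ := hT.exists_vertices hP hc hf hS hcard
    have hsS : ∀ i, s i ∈ (S : Set (Fin 3 → ℝ)) := fun i => by
      rw [hSs]
      exact mem_insert_of_mem _ (mem_range_self i)
    have hsP : ∀ i, s i ∈ P ∩ latticePts := fun i => (hT.2.1 S hS).1 (hsS i)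
    obtain ⟨f, b, hle, hfs, hfp⟩ := hT.exists_supporting hP hc hS hcard hSs hs
    obtain ⟨a, b', haF, -, hap⟩ :=
      hrefl _ (isFacetOf_supporting hs (fun i => (hsP i).1) hle hfs hfp)
    have hdet := abs_det_eq_one_of_empty hs hP.2.1 (fun i => (hsP i).2)
      (fun x hx hxS => by
        rw [← hSs] at hxS ⊢
        exact hT.mem_of_mem_convexHull hf hS hx hxS)
      (a := a) (fun i => by rw [haF _ ⟨(hsP i).1, hfs i⟩, hap]; ring)
    rw [hSs, volume_convexHull_simplex, hdet]
  · rintro huni F ⟨a, b, hle, rfl, hfin⟩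
    obtain ⟨T, hT, hc, hf⟩ := hP.exists_triangulation
    obtain ⟨S, hS, hcard, s, hSs, hs, has⟩ := hT.exists_simplex_in_facet hP hc hf hle hfin
    have hpb := lt_dotp_of_isFacet hP.mem_interior hle hfin
    have hsL : ∀ i, s i ∈ latticePts := fun i =>
      ((hT.2.1 S hS).1 (by rw [hSs]; exact mem_insert_of_mem _ (mem_range_self i))).2
    have hvol := huni T hT hc hf S hS hcard
    rw [hSs, volume_convexHull_simplex,
      ENNReal.ofReal_eq_ofReal_iff (by positivity) (by positivity)] at hvol
    obtain ⟨a', b', has', hap'⟩ := exists_dotp_eq_of_abs_det_eq_one hP.2.1 hsL (by linarith)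
    have key : ∀ x, dotp a x - b = (dotp a p - b) * (dotp (fun i => (a' i : ℝ)) x - b') := by
      intro x
      obtain ⟨c, rfl⟩ := simplexMap_surjective hs x
      rw [← dotpLin_apply a, ← dotpLin_apply (fun i => (a' i : ℝ)), map_simplexMap,
        map_simplexMap]
      simp only [dotpLin_apply, has, has', hap', ← Finset.sum_mul]
      ring
    refine ⟨a', b', fun x hx => ?_, fun x hx => ?_, hap'⟩
    · have hxb : dotp a x = b := hx.2
      have h := key x
      rw [hxb, sub_self] at h
      exact sub_eq_zero.1 ((mul_eq_zero.1 h.symm).resolve_left (by linarith))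
    · have h := hle x hx
      have hk := key x
      by_contra! hlt
      nlinarith
end
end
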